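/- Let s, s' ∈ ℝ with s + s' ≥ −1/2 and fix a sign ±. There exists C > 0 such that for all Schwartz functions u, v on ℝ²: ‖ ∂_x P^+( R( P^± v, P^+ u ) ) ‖_{X^{s+s', −1/2, 1}} ≤ C ‖u‖_{X^{s, 1/2, 1}} ‖v‖_{X^{s', 1/2, 1}}. -/

import Mathlib

open MeasureTheory SchwartzMap
open scoped FourierTransform ENNReal NNReal

noncomputable section

/-- Fourier transform on `ℝ` (pointwise Fourier integral). -/
def FT (g : ℝ → ℂ) : ℝ → ℂ := 𝓕 g

/-- Inverse Fourier transform on `ℝ`. -/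
def FTinv (g : ℝ → ℂ) : ℝ → ℂ := 𝓕⁻ g

/-- `φ` is an admissible Littlewood–Paley filter: a Schwartz function whose Fourier
transform equals `1` on `|ξ| ≤ 1` and `0` on `|ξ| ≥ 2`. -/
def IsLPfilter (φ : 𝓢(ℝ, ℂ)) : Prop :=
  (∀ ξ : ℝ, |ξ| ≤ 1 → FT (⇑φ) ξ = 1) ∧ (∀ ξ : ℝ, 2 ≤ |ξ| → FT (⇑φ) ξ = 0)

/-- `S_j f = φ_j * f`, where `φ_j(x) = 2^j φ(2^j x)`. -/
def LPS (φ : ℝ → ℂ) (j : ℕ) (f : ℝ → ℂ) : ℝ → ℂ :=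
  fun x => ∫ y : ℝ, ((2 : ℝ) ^ j : ℝ) * φ ((2 : ℝ) ^ j * (x - y)) * f y

/-- Space–time Fourier transform on `ℝ²`, `(t,x) ↦ (τ,ξ)`. -/
def FT2 (u : ℝ × ℝ → ℂ) (q : ℝ × ℝ) : ℂ :=
  ∫ p : ℝ × ℝ,
    Complex.exp (-(2 * Real.pi * Complex.I) * ((p.1 * q.1 + p.2 * q.2 : ℝ) : ℂ)) * u p

/-- Inverse space–time Fourier transform on `ℝ²`. -/
def FT2inv (u : ℝ × ℝ → ℂ) (p : ℝ × ℝ) : ℂ :=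
  ∫ q : ℝ × ℝ,
    Complex.exp ((2 * Real.pi * Complex.I) * ((p.1 * q.1 + p.2 * q.2 : ℝ) : ℂ)) * u q

/-- The dyadic bump `ψ_{m-1}` (index shifted by one: `psiLP φ 0 = 𝓕φ` is the
low-frequency bump `ψ_{-1}`, and for `m ≥ 1`,
`psiLP φ m (ξ) = 𝓕φ(2^{-m} ξ) - 𝓕φ(2^{-(m-1)} ξ)` is `ψ_{m-1}`). -/
def psiLP (φ : 𝓢(ℝ, ℂ)) : ℕ → ℝ → ℂ
  | 0 => fun ξ => FT (⇑φ) ξ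
  | (n + 1) => fun ξ =>
      FT (⇑φ) ((2 : ℝ) ^ (-((n : ℝ) + 1)) * ξ) - FT (⇑φ) ((2 : ℝ) ^ (-(n : ℝ)) * ξ)

/-- The space–time block `Δ^±_{jk}` (sign `ε = ±1`), with both indices shifted by one
(`m, n : ℕ` correspond to `j = m - 1 ≥ -1`, `k = n - 1 ≥ -1`):
`Δ^±_{jk} w = 𝓕⁻¹(1_{±ξ ≥ 0} ψ_j(ξ) ψ_k(τ ∓ ξ²) 𝓕w)`. -/
def Xblock (φ : 𝓢(ℝ, ℂ)) (ε : ℝ) (m n : ℕ) (w : ℝ × ℝ → ℂ) : ℝ × ℝ → ℂ :=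
  FT2inv fun q =>
    (if 0 ≤ ε * q.2 then (1 : ℂ) else 0) * psiLP φ m q.2 *
      psiLP φ n (q.1 - ε * q.2 ^ 2) * FT2 w q

/-- The Bourgain norm `‖w‖_{X^{σ,b,1}} = Σ_{j,k ≥ -1} 2^{jσ + kb} ‖Δ_{jk} w‖_{L²}`,
where `Δ_{jk} = Δ^+_{jk} + Δ^-_{jk}` (indices shifted by one as in `Xblock`). -/
def XNorm (φ : 𝓢(ℝ, ℂ)) (σ b : ℝ) (w : ℝ × ℝ → ℂ) : ℝ≥0∞ :=
  ∑' m : ℕ, ∑' n : ℕ,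
    ENNReal.ofReal ((2 : ℝ) ^ (((m : ℝ) - 1) * σ + ((n : ℝ) - 1) * b)) *
      eLpNorm (fun p : ℝ × ℝ => Xblock φ 1 m n w p + Xblock φ (-1) m n w p) 2
        (volume : Measure (ℝ × ℝ))

/-- The spatial Fourier projection `P^±` onto `{± ξ ≥ 0}` (sign `ε = ±1`), acting in
the `x` variable for each fixed `t`. -/
def Pproj (ε : ℝ) (f : ℝ × ℝ → ℂ) : ℝ × ℝ → ℂ :=
  fun p => FTinv (fun ξ =>
    (if 0 ≤ ε * ξ then (1 : ℂ) else 0) * FT (fun y => f (p.1, y)) ξ) p.2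

/-- `S_j` acting in the `x` variable for each fixed `t`. -/
def Sx (φ : 𝓢(ℝ, ℂ)) (j : ℕ) (f : ℝ × ℝ → ℂ) : ℝ × ℝ → ℂ :=
  fun p => LPS (⇑φ) j (fun y => f (p.1, y)) p.2

/-- `Δ_j` acting in the `x` variable for each fixed `t`. -/
def Dx (φ : 𝓢(ℝ, ℂ)) (j : ℕ) (f : ℝ × ℝ → ℂ) : ℝ × ℝ → ℂ :=
  fun p => Sx φ (j + 1) f p - Sx φ j f p

/-- The paraproduct `T_g f = Σ_{j ≥ 1} S_{j-1} g · Δ_j f` (in the `x` variable). -/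
def paraT (φ : 𝓢(ℝ, ℂ)) (g f : ℝ × ℝ → ℂ) : ℝ × ℝ → ℂ :=
  fun p => ∑' i : ℕ, Sx φ i g p * Dx φ (i + 1) f p

/-- The remainder `R(f,g) = Σ_{j,j' ≥ 0, |j-j'| ≤ 1} Δ_j f · Δ_{j'} g` of the Bony
decomposition (in the `x` variable). -/
def remR (φ : 𝓢(ℝ, ℂ)) (f g : ℝ × ℝ → ℂ) : ℝ × ℝ → ℂ :=
  fun p => ∑' j : ℕ, ∑' j' : ℕ,
    if |(j : ℤ) - (j' : ℤ)| ≤ 1 then Dx φ j f p * Dx φ j' g p else 0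

/-- Spatial derivative `∂_x` of a space–time function. -/
def dX (f : ℝ × ℝ → ℂ) : ℝ × ℝ → ℂ := fun p => deriv (fun y => f (p.1, y)) p.2

theorem continuous_fourier_of_integrable {E : Type*} [NormedAddCommGroup E] [InnerProductSpace ℝ E]
    [FiniteDimensional ℝ E] [MeasurableSpace E] [BorelSpace E] {f : E → ℂ} (hf : Integrable f) :
    Continuous (𝓕 f) :=
  VectorFourier.fourierIntegral_continuous Real.continuous_fourierChar
    (by exact continuous_inner) hf

theorem eLpNorm_fourier_eq {E : Type*} [NormedAddCommGroup E] [InnerProductSpace ℝ E]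
    [FiniteDimensional ℝ E] [MeasurableSpace E] [BorelSpace E] {f : E → ℂ}
    (hf : Integrable f) (hf2 : MemLp f 2) :
    eLpNorm (𝓕 f) 2 volume = eLpNorm f 2 volume := by
  have hcont := continuous_fourier_of_integrable hf
  let F : Lp (α := E) ℂ 2 := hf2.toLp f
  let G : Lp (α := E) ℂ 2 := 𝓕 F
  have key : 𝓕 f =ᵐ[volume] G := by
    apply ae_eq_of_integral_contDiff_smul_eq
    · exact hcont.locallyIntegrable
    · exact (Lp.memLp _).locallyIntegrable (by norm_num)
    · intro g g_smooth g_cpt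
      have hg₁ : HasCompactSupport (Complex.ofRealCLM ∘ g) := g_cpt.comp_left rfl
      have hg₂ : ContDiff ℝ ((⊤ : ℕ∞) : WithTop ℕ∞) (Complex.ofRealCLM ∘ g) := by fun_prop
      let θ : 𝓢(E, ℂ) := hg₁.toSchwartzMap hg₂
      have hθ : ∀ x, θ x = (g x : ℂ) := fun x => rfl
      have h1 := congrArg (fun T => T θ)
        (Lp.fourier_toTemperedDistribution_eq F)
      simp only [TemperedDistribution.fourier_apply, Lp.toTemperedDistribution_apply] at h1
      have h2 : ∫ x, g x • G x
          = ∫ x, θ x • G x := by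
        simp [hθ]
      rw [h2, ← h1]
      have h3 : ∫ x, (𝓕 θ) x • F x = ∫ x, f x • (𝓕 θ) x := by
        apply integral_congr_ae
        filter_upwards [hf2.coeFn_toLp] with x hx
        rw [hx, smul_eq_mul, smul_eq_mul, mul_comm]
      rw [h3]
      have h4 := VectorFourier.integral_fourierIntegral_smul_eq_flip (L := innerₗ E)
        (μ := (volume : Measure E)) (ν := (volume : Measure E))
        Real.continuous_fourierChar (by exact continuous_inner) hf
        (SchwartzMap.integrable θ)
      rw [flip_innerₗ] at h4
      have h5 : ∫ x, f x • (𝓕 θ) x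
          = ∫ x, f x • VectorFourier.fourierIntegral Real.fourierChar volume (innerₗ E) θ x := by
        rfl
      rw [h5, ← h4]
      apply integral_congr_ae
      filter_upwards with x
      rw [hθ, smul_eq_mul, mul_comm]
      rfl
  rw [eLpNorm_congr_ae key]
  have := Lp.norm_fourier_eq F
  rw [Lp.norm_def, Lp.norm_def] at this
  rw [ENNReal.toReal_eq_toReal_iff' (Lp.eLpNorm_ne_top _) (Lp.eLpNorm_ne_top _)] at this
  rw [this, eLpNorm_congr_ae hf2.coeFn_toLp]

theorem eLpNorm_fourierInv_eq {E : Type*} [NormedAddCommGroup E] [InnerProductSpace ℝ E]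
    [FiniteDimensional ℝ E] [MeasurableSpace E] [BorelSpace E] {f : E → ℂ}
    (hf : Integrable f) (hf2 : MemLp f 2) :
    eLpNorm (𝓕⁻ f) 2 volume = eLpNorm f 2 volume := by
  rw [Real.fourierInv_eq_fourier_comp_neg]
  have hmp := Measure.measurePreserving_neg (volume : Measure E)
  rw [eLpNorm_fourier_eq (hf.comp_neg) (hf2.comp_measurePreserving hmp)]
  exact eLpNorm_comp_measurePreserving hf2.1 hmp

theorem FT2inv_eq_fourierInv (h : ℝ × ℝ → ℂ) (p : ℝ × ℝ) :
    FT2inv h p = 𝓕⁻ (fun q : WithLp 2 (ℝ × ℝ) => h q.ofLp) (WithLp.toLp 2 p) := by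
  rw [Real.fourierInv_eq']
  unfold FT2inv
  rw [← (WithLp.volume_preserving_ofLp ℝ ℝ).integral_comp
    (MeasurableEquiv.toLp 2 (ℝ × ℝ)).symm.measurableEmbedding]
  congr 1
  ext q
  rw [smul_eq_mul]
  congr 2
  simp [WithLp.prod_inner_apply]
  ring

theorem FT2_eq_fourier (h : ℝ × ℝ → ℂ) (p : ℝ × ℝ) :
    FT2 h p = 𝓕 (fun q : WithLp 2 (ℝ × ℝ) => h q.ofLp) (WithLp.toLp 2 p) := by
  rw [Real.fourier_eq']
  unfold FT2
  rw [← (WithLp.volume_preserving_ofLp ℝ ℝ).integral_comp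
    (MeasurableEquiv.toLp 2 (ℝ × ℝ)).symm.measurableEmbedding]
  congr 1
  ext q
  rw [smul_eq_mul]
  congr 2
  simp [WithLp.prod_inner_apply]
  ring

theorem eLpNorm_FT2inv_eq {h : ℝ × ℝ → ℂ} (hh : Integrable h) (hh2 : MemLp h 2) :
    eLpNorm (FT2inv h) 2 volume = eLpNorm h 2 volume := by
  have e1 := WithLp.volume_preserving_ofLp ℝ ℝ
  have e2 := WithLp.volume_preserving_toLp ℝ ℝ
  have emb := (MeasurableEquiv.toLp 2 (ℝ × ℝ)).symm.measurableEmbedding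
  have emb2 := (MeasurableEquiv.toLp 2 (ℝ × ℝ)).measurableEmbedding
  have h1 : Integrable (fun q : WithLp 2 (ℝ × ℝ) => h q.ofLp) :=
    (e1.integrable_comp_emb emb).2 hh
  have h2 : MemLp (fun q : WithLp 2 (ℝ × ℝ) => h q.ofLp) 2 := hh2.comp_measurePreserving e1
  have h3 : FT2inv h = (𝓕⁻ (fun q : WithLp 2 (ℝ × ℝ) => h q.ofLp)) ∘ WithLp.toLp 2 := by
    ext p; exact FT2inv_eq_fourierInv h p
  have hc : Continuous (𝓕⁻ (fun q : WithLp 2 (ℝ × ℝ) => h q.ofLp)) := by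
    rw [Real.fourierInv_eq_fourier_comp_neg]
    exact continuous_fourier_of_integrable h1.comp_neg
  rw [h3, eLpNorm_comp_measurePreserving hc.aestronglyMeasurable e2, eLpNorm_fourierInv_eq h1 h2]
  exact eLpNorm_comp_measurePreserving hh2.1 e1

theorem FT2inv_of_not_integrable {h : ℝ × ℝ → ℂ} (hh : ¬ Integrable h) : FT2inv h = 0 := by
  ext p
  rw [FT2inv_eq_fourierInv, Real.fourierInv_eq_fourier_neg, Pi.zero_apply, Real.fourier_eq]
  apply integral_undef
  rw [Real.fourierIntegral_convergent_iff]
  intro h1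
  exact hh (((WithLp.volume_preserving_ofLp ℝ ℝ).integrable_comp_emb
    (MeasurableEquiv.toLp 2 (ℝ × ℝ)).symm.measurableEmbedding).1 h1)

theorem FT2_of_not_integrable {h : ℝ × ℝ → ℂ} (hh : ¬ Integrable h) : FT2 h = 0 := by
  ext p
  rw [FT2_eq_fourier, Pi.zero_apply, Real.fourier_eq]
  apply integral_undef
  rw [Real.fourierIntegral_convergent_iff]
  intro h1
  exact hh (((WithLp.volume_preserving_ofLp ℝ ℝ).integrable_comp_emb
    (MeasurableEquiv.toLp 2 (ℝ × ℝ)).symm.measurableEmbedding).1 h1)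

theorem eLpNorm_FT2inv_le (h : ℝ × ℝ → ℂ) :
    eLpNorm (FT2inv h) 2 volume ≤ eLpNorm h 2 volume := by
  by_cases hh : Integrable h
  · by_cases h2 : eLpNorm h 2 volume = ⊤
    · rw [h2]; exact le_top
    · exact (eLpNorm_FT2inv_eq hh ⟨hh.1, lt_top_iff_ne_top.2 h2⟩).le
  · rw [FT2inv_of_not_integrable hh]; simp

theorem exists_schwartz_FT2 (u : 𝓢(ℝ × ℝ, ℂ)) : ∃ g : 𝓢(ℝ × ℝ, ℂ), FT2 u = g := by
  let e := WithLp.prodContinuousLinearEquiv 2 ℝ ℝ ℝ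
  let u' : 𝓢(WithLp 2 (ℝ × ℝ), ℂ) := SchwartzMap.compCLMOfContinuousLinearEquiv ℝ e u
  refine ⟨SchwartzMap.compCLMOfContinuousLinearEquiv ℝ e.symm (𝓕 u'), ?_⟩
  ext p
  rw [FT2_eq_fourier]
  rfl

theorem FT_eq_schwartz (φ : 𝓢(ℝ, ℂ)) : FT φ = (𝓕 φ : 𝓢(ℝ, ℂ)) := by
  rw [SchwartzMap.fourier_coe]; rfl

theorem continuous_FT_schwartz (φ : 𝓢(ℝ, ℂ)) : Continuous (FT φ) := by
  rw [FT_eq_schwartz]; exact (𝓕 φ : 𝓢(ℝ, ℂ)).continuous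

theorem continuous_psiLP (φ : 𝓢(ℝ, ℂ)) (m : ℕ) : Continuous (psiLP φ m) := by
  have h := continuous_FT_schwartz φ
  cases m with
  | zero => exact h
  | succ n => exact (h.comp (by fun_prop)).sub (h.comp (by fun_prop))

theorem exists_norm_psiLP_le (φ : 𝓢(ℝ, ℂ)) : ∃ B : ℝ, 0 < B ∧ ∀ m ξ, ‖psiLP φ m ξ‖ ≤ B := by
  obtain ⟨C, hC⟩ : ∃ C : ℝ, ∀ ξ, ‖FT φ ξ‖ ≤ C := by
    refine ⟨SchwartzMap.seminorm ℝ 0 0 (𝓕 φ : 𝓢(ℝ, ℂ)), fun ξ => ?_⟩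
    rw [FT_eq_schwartz]
    exact SchwartzMap.norm_le_seminorm ℝ _ ξ
  have hC0 : 0 ≤ C := (norm_nonneg _).trans (hC 0)
  refine ⟨C + C + 1, by positivity, fun m ξ => ?_⟩
  cases m with
  | zero => exact (hC ξ).trans (by linarith)
  | succ n => exact ((norm_sub_le _ _).trans (add_le_add (hC _) (hC _))).trans (by linarith)

theorem two_rpow_neg_natCast (n : ℕ) : (2 : ℝ) ^ (-(n : ℝ)) = ((2 : ℝ) ^ n)⁻¹ := by
  rw [Real.rpow_neg (by norm_num), Real.rpow_natCast]

theorem psiLP_succ (φ : 𝓢(ℝ, ℂ)) (n : ℕ) (ξ : ℝ) : psiLP φ (n + 1) ξ =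
    FT φ (((2 : ℝ) ^ (n + 1))⁻¹ * ξ) - FT φ (((2 : ℝ) ^ n)⁻¹ * ξ) := by
  have : (2 : ℝ) ^ (-((n : ℝ) + 1)) = ((2 : ℝ) ^ (n + 1))⁻¹ := by
    rw [← two_rpow_neg_natCast]; push_cast; rfl
  simp only [psiLP, this, two_rpow_neg_natCast]

theorem psiLP_support_le {φ : 𝓢(ℝ, ℂ)} (hφ : IsLPfilter φ) {m : ℕ} {ξ : ℝ}
    (h : psiLP φ m ξ ≠ 0) : |ξ| ≤ 2 ^ (m + 1) := by
  by_contra! hlt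
  apply h
  cases m with
  | zero => exact hφ.2 ξ (by simpa using hlt.le)
  | succ n =>
    rw [psiLP_succ, hφ.2, hφ.2, sub_zero]
    · rw [abs_mul, abs_inv, abs_of_pos (by positivity : (0 : ℝ) < 2 ^ n), ← div_eq_inv_mul,
        le_div_iff₀ (by positivity)]
      have : (0 : ℝ) < 2 ^ n := by positivity
      rw [pow_succ, pow_succ] at hlt
      linarith
    · rw [abs_mul, abs_inv, abs_of_pos (by positivity : (0 : ℝ) < 2 ^ (n + 1)), ← div_eq_inv_mul,
        le_div_iff₀ (by positivity)]
      rw [pow_succ] at hlt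
      linarith

theorem psiLP_support_ge {φ : 𝓢(ℝ, ℂ)} (hφ : IsLPfilter φ) {m : ℕ} {ξ : ℝ}
    (h : psiLP φ (m + 1) ξ ≠ 0) : 2 ^ m ≤ |ξ| := by
  by_contra! hlt
  apply h
  have h2 : (0 : ℝ) < 2 ^ m := by positivity
  rw [psiLP_succ, hφ.1, hφ.1, sub_self]
  · rw [abs_mul, abs_inv, abs_of_pos h2, ← div_eq_inv_mul, div_le_iff₀ h2]
    linarith
  · rw [abs_mul, abs_inv, abs_of_pos (by positivity : (0 : ℝ) < 2 ^ (m + 1)), ← div_eq_inv_mul,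
      div_le_iff₀ (by positivity), pow_succ]
    linarith

theorem sum_range_psiLP (φ : 𝓢(ℝ, ℂ)) (N : ℕ) (ξ : ℝ) :
    ∑ m ∈ Finset.range (N + 1), psiLP φ m ξ = FT φ (((2 : ℝ) ^ N)⁻¹ * ξ) := by
  induction N with
  | zero => simp [psiLP]
  | succ n ih => rw [Finset.sum_range_succ, ih, psiLP_succ]; ring

theorem one_le_tsum_enorm_psiLP {φ : 𝓢(ℝ, ℂ)} (hφ : IsLPfilter φ) (ξ : ℝ) :
    1 ≤ ∑' m, ‖psiLP φ m ξ‖ₑ := by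
  obtain ⟨N, hN⟩ := pow_unbounded_of_one_lt |ξ| (by norm_num : (1 : ℝ) < 2)
  have h1 : ∑ m ∈ Finset.range (N + 1), psiLP φ m ξ = 1 := by
    rw [sum_range_psiLP, hφ.1]
    rw [abs_mul, abs_inv, abs_of_pos (by positivity : (0 : ℝ) < 2 ^ N), ← div_eq_inv_mul,
      div_le_iff₀ (by positivity)]
    linarith
  calc (1 : ℝ≥0∞) = ‖∑ m ∈ Finset.range (N + 1), psiLP φ m ξ‖ₑ := by rw [h1]; simp
    _ ≤ ∑ m ∈ Finset.range (N + 1), ‖psiLP φ m ξ‖ₑ := enorm_sum_le _ _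
    _ ≤ _ := ENNReal.sum_le_tsum _

/-- The Fourier side of the block `Xblock φ ε m n u`. -/
def XblockHat (φ : 𝓢(ℝ, ℂ)) (ε : ℝ) (m n : ℕ) (u : ℝ × ℝ → ℂ) (q : ℝ × ℝ) : ℂ :=
  (if 0 ≤ ε * q.2 then (1 : ℂ) else 0) * psiLP φ m q.2 * psiLP φ n (q.1 - ε * q.2 ^ 2) * FT2 u q

theorem Xblock_eq (φ : 𝓢(ℝ, ℂ)) (ε : ℝ) (m n : ℕ) (u : ℝ × ℝ → ℂ) :
    Xblock φ ε m n u = FT2inv (XblockHat φ ε m n u) := rfl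

theorem FT2inv_add {f g : ℝ × ℝ → ℂ} (hf : Integrable f) (hg : Integrable g) (p : ℝ × ℝ) :
    FT2inv (fun q => f q + g q) p = FT2inv f p + FT2inv g p := by
  unfold FT2inv
  rw [← integral_add]
  · simp only [mul_add]
  all_goals
    refine (Integrable.bdd_mul (c := 1) (by assumption) ?_ ?_)
    · exact Continuous.aestronglyMeasurable (by fun_prop)
    · filter_upwards with q
      rw [mul_comm, mul_comm (2 * (Real.pi : ℂ)), ← mul_assoc,
        show ((p.1 * q.1 + p.2 * q.2 : ℝ) : ℂ) * Complex.I * (2 * Real.pi)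
          = ((p.1 * q.1 + p.2 * q.2) * (2 * Real.pi) : ℝ) * Complex.I by push_cast; ring,
        Complex.norm_exp_ofReal_mul_I]

theorem measurable_XblockHat (φ : 𝓢(ℝ, ℂ)) (ε : ℝ) (m n : ℕ) (u : 𝓢(ℝ × ℝ, ℂ)) :
    Measurable (XblockHat φ ε m n u) := by
  obtain ⟨g, hg⟩ := exists_schwartz_FT2 u
  have h1 := (continuous_psiLP φ m).measurable
  have h2 := (continuous_psiLP φ n).measurable
  have h3 := g.continuous.measurable
  unfold XblockHat
  rw [hg]
  refine ((Measurable.mul ?_ (h1.comp measurable_snd)).mul (h2.comp (by fun_prop))).mul h3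
  exact Measurable.ite (measurableSet_le measurable_const (by fun_prop)) measurable_const
    measurable_const

theorem exists_norm_XblockHat_le (φ : 𝓢(ℝ, ℂ)) (ε : ℝ) (m n : ℕ) (u : ℝ × ℝ → ℂ) :
    ∃ B : ℝ, ∀ q, ‖XblockHat φ ε m n u q‖ ≤ B * ‖FT2 u q‖ := by
  obtain ⟨B, hB, h⟩ := exists_norm_psiLP_le φ
  refine ⟨1 * B * B, fun q => ?_⟩
  unfold XblockHat
  rw [norm_mul, norm_mul, norm_mul]
  gcongr
  · split_ifs <;> simp
  · exact h _ _
  · exact h _ _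

theorem integrable_XblockHat (φ : 𝓢(ℝ, ℂ)) (ε : ℝ) (m n : ℕ) (u : 𝓢(ℝ × ℝ, ℂ)) :
    Integrable (XblockHat φ ε m n u) := by
  obtain ⟨B, hB⟩ := exists_norm_XblockHat_le φ ε m n u
  obtain ⟨g, hg⟩ := exists_schwartz_FT2 u
  rw [hg] at hB
  exact (g.integrable.norm.const_mul B).mono' (measurable_XblockHat φ ε m n u).aestronglyMeasurable
    (Filter.Eventually.of_forall hB)

theorem memLp_XblockHat (φ : 𝓢(ℝ, ℂ)) (ε : ℝ) (m n : ℕ) (u : 𝓢(ℝ × ℝ, ℂ)) :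
    MemLp (XblockHat φ ε m n u) 2 := by
  obtain ⟨B, hB⟩ := exists_norm_XblockHat_le φ ε m n u
  obtain ⟨g, hg⟩ := exists_schwartz_FT2 u
  rw [hg] at hB
  exact (g.memLp 2).of_le_mul (measurable_XblockHat φ ε m n u).aestronglyMeasurable
    (Filter.Eventually.of_forall hB)

theorem ae_snd_ne_zero : ∀ᵐ q : ℝ × ℝ, q.2 ≠ 0 := by
  have : ∀ᵐ x : ℝ, x ≠ 0 := by
    simp [ae_iff]
  exact Measure.quasiMeasurePreserving_snd.ae this

theorem eLpNorm_XblockHat_le (φ : 𝓢(ℝ, ℂ)) {ε : ℝ} (hε : ε = 1 ∨ ε = -1) (m n : ℕ)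
    (u : 𝓢(ℝ × ℝ, ℂ)) :
    eLpNorm (XblockHat φ ε m n u) 2 volume ≤
      eLpNorm (fun p : ℝ × ℝ => Xblock φ 1 m n u p + Xblock φ (-1) m n u p) 2 volume := by
  have i1 := integrable_XblockHat φ 1 m n u
  have i2 := integrable_XblockHat φ (-1) m n u
  have e : (fun p : ℝ × ℝ => Xblock φ 1 m n u p + Xblock φ (-1) m n u p)
      = FT2inv (fun q => XblockHat φ 1 m n u q + XblockHat φ (-1) m n u q) := by
    ext p
    rw [FT2inv_add i1 i2]
    rfl
  rw [e]
  refine le_of_le_of_eq ?_ (eLpNorm_FT2inv_eq (i1.add i2)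
    ((memLp_XblockHat φ 1 m n u).add (memLp_XblockHat φ (-1) m n u))).symm
  apply eLpNorm_mono_ae
  filter_upwards [ae_snd_ne_zero] with q hq
  rcases lt_or_gt_of_ne hq with h | h
  · rcases hε with rfl | rfl
    · simp [XblockHat, h.not_ge]
    · simp [XblockHat, h.not_ge]
  · rcases hε with rfl | rfl
    · simp [XblockHat, h.not_ge]
    · simp [XblockHat, h.not_ge]

theorem eLpNorm_Xblock_add_le (φ : 𝓢(ℝ, ℂ)) (m n : ℕ) (w : ℝ × ℝ → ℂ)
    (hw : ∀ q : ℝ × ℝ, q.2 ≤ 0 → FT2 w q = 0) :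
    eLpNorm (fun p : ℝ × ℝ => Xblock φ 1 m n w p + Xblock φ (-1) m n w p) 2 volume ≤
      eLpNorm (XblockHat φ 1 m n w) 2 volume := by
  have h0 : XblockHat φ (-1) m n w = 0 := by
    ext q
    by_cases hq : q.2 ≤ 0
    · simp [XblockHat, hw q hq]
    · simp [XblockHat, hq]
  have : (fun p : ℝ × ℝ => Xblock φ 1 m n w p + Xblock φ (-1) m n w p)
      = FT2inv (XblockHat φ 1 m n w) := by
    ext p
    rw [Xblock_eq, Xblock_eq, h0]
    simp [FT2inv]
  rw [this]
  exact eLpNorm_FT2inv_le _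

theorem FT_eq_integral (f : ℝ → ℂ) (ξ : ℝ) :
    FT f ξ = ∫ x, Complex.exp (-(2 * Real.pi * Complex.I) * ((x * ξ : ℝ) : ℂ)) * f x := by
  unfold FT
  rw [Real.fourier_real_eq_integral_exp_smul]
  congr 1; ext x
  rw [smul_eq_mul]
  congr 2
  push_cast; ring

theorem FTinv_eq_integral (f : ℝ → ℂ) (x : ℝ) :
    FTinv f x = ∫ ξ, Complex.exp ((2 * Real.pi * Complex.I) * ((x * ξ : ℝ) : ℂ)) * f ξ := by
  unfold FTinv
  rw [Real.fourierInv_eq']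
  congr 1; ext ξ
  rw [smul_eq_mul]
  congr 2
  simp
  ring

theorem norm_exp_two_pi_I_mul (x : ℝ) :
    ‖Complex.exp ((2 * Real.pi * Complex.I) * (x : ℂ))‖ = 1 := by
  rw [show (2 * Real.pi * Complex.I) * (x : ℂ) = ((2 * Real.pi * x : ℝ) : ℂ) * Complex.I by
    push_cast; ring, Complex.norm_exp_ofReal_mul_I]

theorem norm_exp_neg_two_pi_I_mul (x : ℝ) :
    ‖Complex.exp (-(2 * Real.pi * Complex.I) * (x : ℂ))‖ = 1 := by
  rw [show -(2 * Real.pi * Complex.I) * (x : ℂ) = ((-(2 * Real.pi * x) : ℝ) : ℂ) * Complex.I by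
    push_cast; ring, Complex.norm_exp_ofReal_mul_I]

theorem norm_FT_le (f : ℝ → ℂ) (ξ : ℝ) : ‖FT f ξ‖ ≤ ∫ x, ‖f x‖ := by
  rw [FT_eq_integral]
  refine (norm_integral_le_integral_norm _).trans (le_of_eq ?_)
  simp only [norm_mul, norm_exp_neg_two_pi_I_mul, one_mul]

theorem norm_FTinv_le (f : ℝ → ℂ) (ξ : ℝ) : ‖FTinv f ξ‖ ≤ ∫ x, ‖f x‖ := by
  rw [FTinv_eq_integral]
  refine (norm_integral_le_integral_norm _).trans (le_of_eq ?_)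
  simp only [norm_mul, norm_exp_two_pi_I_mul, one_mul]

theorem FTinv_FT {f : ℝ → ℂ} (hc : Continuous f) (hf : Integrable f) (hf' : Integrable (FT f)) :
    FTinv (FT f) = f := hc.fourierInv_fourier_eq hf hf'

theorem FT_FTinv {f : ℝ → ℂ} (hc : Continuous f) (hf : Integrable f) (hf' : Integrable (FTinv f)) :
    FT (FTinv f) = f := by
  have : Integrable (FT f) := by
    have h := hf'.comp_neg
    refine h.congr (Filter.Eventually.of_forall fun x => ?_)
    simp only [FTinv, FT, Real.fourierInv_eq_fourier_neg, neg_neg]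
  exact hc.fourier_fourierInv_eq hf this

theorem exists_schwartz_decay (g : 𝓢(ℝ × ℝ, ℂ)) (a b : ℕ) : ∃ C : ℝ, 0 < C ∧ ∀ p : ℝ × ℝ,
    ‖g p‖ ≤ C * (((1 + p.1 ^ 2)⁻¹) ^ a * ((1 + p.2 ^ 2)⁻¹) ^ b) := by
  let S := 2 ^ (2 * (a + b)) * ((Finset.Iic (2 * (a + b), 0)).sup
    (fun m => SchwartzMap.seminorm ℝ (E := ℝ × ℝ) (F := ℂ) m.1 m.2)) g
  have hS : ∀ p : ℝ × ℝ, (1 + ‖p‖) ^ (2 * (a + b)) * ‖g p‖ ≤ S := fun p => by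
    simpa using SchwartzMap.one_add_le_sup_seminorm_apply (𝕜 := ℝ) (m := (2 * (a + b), 0))
      le_rfl le_rfl g p
  have hS0 : 0 ≤ S := le_trans (by positivity) (hS 0)
  refine ⟨S + 1, by positivity, fun p => ?_⟩
  have h1 : 1 + p.1 ^ 2 ≤ (1 + ‖p‖) ^ 2 := by
    have := norm_fst_le p
    have h0 := norm_nonneg p
    rw [Real.norm_eq_abs] at this
    have : p.1 ^ 2 ≤ ‖p‖ ^ 2 := by rw [← sq_abs]; gcongr
    nlinarith
  have h2 : 1 + p.2 ^ 2 ≤ (1 + ‖p‖) ^ 2 := by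
    have := norm_snd_le p
    have h0 := norm_nonneg p
    rw [Real.norm_eq_abs] at this
    have : p.2 ^ 2 ≤ ‖p‖ ^ 2 := by rw [← sq_abs]; gcongr
    nlinarith
  have h3 : (1 + p.1 ^ 2) ^ a * (1 + p.2 ^ 2) ^ b ≤ (1 + ‖p‖) ^ (2 * (a + b)) := by
    rw [mul_add, pow_add, pow_mul, pow_mul]
    gcongr
  rw [inv_pow, inv_pow, ← mul_inv, ← div_eq_mul_inv, le_div_iff₀ (by positivity)]
  calc ‖g p‖ * ((1 + p.1 ^ 2) ^ a * (1 + p.2 ^ 2) ^ b)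
      ≤ ‖g p‖ * (1 + ‖p‖) ^ (2 * (a + b)) := by gcongr
    _ ≤ S := by rw [mul_comm]; exact hS p
    _ ≤ S + 1 := by linarith

/-- The Fourier transform of `u` in the second variable. -/
def pft (u : ℝ × ℝ → ℂ) (t ξ : ℝ) : ℂ := FT (fun y => u (t, y)) ξ

theorem continuous_pft (u : 𝓢(ℝ × ℝ, ℂ)) : Continuous (fun p : ℝ × ℝ => pft u p.1 p.2) := by
  obtain ⟨C, hC, h⟩ := exists_schwartz_decay u 0 1
  simp only [pft, FT_eq_integral]
  have hu := u.continuous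
  refine continuous_of_dominated (bound := fun y => C * (1 + y ^ 2)⁻¹) ?_ ?_ ?_ ?_
  · intro p; exact Continuous.aestronglyMeasurable (by fun_prop)
  · intro p
    filter_upwards with y
    rw [norm_mul, norm_exp_neg_two_pi_I_mul, one_mul]
    simpa using h (p.1, y)
  · exact integrable_inv_one_add_sq.const_mul C
  · filter_upwards with y
    fun_prop

theorem continuous_pft_left (u : 𝓢(ℝ × ℝ, ℂ)) (ξ : ℝ) : Continuous (fun t => pft u t ξ) :=
  (continuous_pft u).comp (f := fun t => (t, ξ)) (by fun_prop)

theorem continuous_pft_right (u : 𝓢(ℝ × ℝ, ℂ)) (t : ℝ) : Continuous (fun ξ => pft u t ξ) :=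
  (continuous_pft u).comp (f := fun ξ => (t, ξ)) (by fun_prop)

theorem norm_pft_le_left (u : 𝓢(ℝ × ℝ, ℂ)) : ∃ C : ℝ, 0 < C ∧ ∀ t ξ,
    ‖pft u t ξ‖ ≤ C * ((1 + t ^ 2)⁻¹) ^ 2 := by
  obtain ⟨C, hC, h⟩ := exists_schwartz_decay u 2 1
  refine ⟨C * Real.pi, by positivity, fun t ξ => (norm_FT_le _ _).trans ?_⟩
  calc ∫ x, ‖u (t, x)‖ ≤ ∫ x, C * ((1 + t ^ 2)⁻¹) ^ 2 * (1 + x ^ 2)⁻¹ := by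
        refine integral_mono_of_nonneg (Filter.Eventually.of_forall fun x => norm_nonneg _)
          (integrable_inv_one_add_sq.const_mul _) (Filter.Eventually.of_forall fun x => ?_)
        simpa [mul_assoc] using h (t, x)
    _ = _ := by rw [integral_const_mul, integral_univ_inv_one_add_sq]; ring

theorem inv_one_add_sq_le_one (t : ℝ) : (1 + t ^ 2)⁻¹ ≤ 1 :=
  inv_le_one_of_one_le₀ (by nlinarith [sq_nonneg t])

theorem integrable_pft_left (u : 𝓢(ℝ × ℝ, ℂ)) (ξ : ℝ) : Integrable (fun t => pft u t ξ) := by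
  obtain ⟨C, hC, h⟩ := norm_pft_le_left u
  refine (integrable_inv_one_add_sq.const_mul C).mono'
    (continuous_pft_left u ξ).aestronglyMeasurable (Filter.Eventually.of_forall fun t => ?_)
  refine (h t ξ).trans ?_
  have h1 := inv_one_add_sq_le_one t
  have h2 : 0 ≤ (1 + t ^ 2)⁻¹ := by positivity
  gcongr
  nlinarith

theorem FT_pft (u : 𝓢(ℝ × ℝ, ℂ)) (τ ξ : ℝ) : FT (fun t => pft u t ξ) τ = FT2 u (τ, ξ) := by
  have hu := u.continuous
  unfold FT2
  rw [Measure.volume_eq_prod, integral_prod, FT_eq_integral]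
  · congr 1; ext t
    rw [pft, FT_eq_integral, ← integral_const_mul]
    congr 1; ext y
    rw [← mul_assoc, ← Complex.exp_add]
    congr 2
    push_cast; ring
  · refine Integrable.bdd_mul (c := 1) u.integrable ?_ ?_
    · exact Continuous.aestronglyMeasurable (by fun_prop)
    · filter_upwards with q
      rw [norm_exp_neg_two_pi_I_mul]

theorem continuous_FT2 (u : 𝓢(ℝ × ℝ, ℂ)) : Continuous (FT2 u) := by
  obtain ⟨g, hg⟩ := exists_schwartz_FT2 u
  rw [hg]; exact g.continuous

theorem integrable_FT2_left (u : 𝓢(ℝ × ℝ, ℂ)) (ξ : ℝ) : Integrable (fun τ => FT2 u (τ, ξ)) := by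
  obtain ⟨g, hg⟩ := exists_schwartz_FT2 u
  obtain ⟨C, hC, h⟩ := exists_schwartz_decay g 1 0
  refine (integrable_inv_one_add_sq.const_mul C).mono' ((continuous_FT2 u).comp
    (f := fun τ => (τ, ξ)) (by fun_prop)).aestronglyMeasurable
    (Filter.Eventually.of_forall fun t => ?_)
  rw [hg]
  simpa using h (t, ξ)

theorem FTinv_FT2 (u : 𝓢(ℝ × ℝ, ℂ)) (t ξ : ℝ) :
    FTinv (fun τ => FT2 u (τ, ξ)) t = pft u t ξ := by
  have h1 : (fun τ => FT2 u (τ, ξ)) = FT (fun t => pft u t ξ) := by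
    ext τ; rw [FT_pft]
  rw [h1, FTinv_FT (continuous_pft_left u ξ) (integrable_pft_left u ξ)]
  rw [← h1]; exact integrable_FT2_left u ξ

theorem norm_pft_le_right (u : 𝓢(ℝ × ℝ, ℂ)) : ∃ C : ℝ, 0 < C ∧ ∀ t ξ,
    ‖pft u t ξ‖ ≤ C * ((1 + ξ ^ 2)⁻¹) ^ 4 := by
  obtain ⟨g, hg⟩ := exists_schwartz_FT2 u
  obtain ⟨C, hC, h⟩ := exists_schwartz_decay g 1 4
  refine ⟨C * Real.pi, by positivity, fun t ξ => ?_⟩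
  rw [← FTinv_FT2]
  refine (norm_FTinv_le _ _).trans ?_
  calc ∫ τ, ‖FT2 u (τ, ξ)‖ ≤ ∫ τ, C * ((1 + ξ ^ 2)⁻¹) ^ 4 * (1 + τ ^ 2)⁻¹ := by
        refine integral_mono_of_nonneg (Filter.Eventually.of_forall fun x => norm_nonneg _)
          (integrable_inv_one_add_sq.const_mul _) (Filter.Eventually.of_forall fun x => ?_)
        rw [hg]
        refine (h (x, ξ)).trans (le_of_eq ?_)
        simp only; ring
    _ = _ := by rw [integral_const_mul, integral_univ_inv_one_add_sq]; ring

theorem exists_norm_pft_le (u : 𝓢(ℝ × ℝ, ℂ)) : ∃ C : ℝ, 0 < C ∧ ∀ t ξ,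
    ‖pft u t ξ‖ ≤ C * ((1 + t ^ 2)⁻¹ * ((1 + ξ ^ 2)⁻¹) ^ 2) := by
  obtain ⟨C₁, hC₁, h₁⟩ := norm_pft_le_left u
  obtain ⟨C₂, hC₂, h₂⟩ := norm_pft_le_right u
  refine ⟨C₁ + C₂, by positivity, fun t ξ => ?_⟩
  have := h₁ t ξ
  have := h₂ t ξ
  refine (sq_le_sq₀ (norm_nonneg _) (by positivity)).1 ?_
  calc ‖pft u t ξ‖ ^ 2 = ‖pft u t ξ‖ * ‖pft u t ξ‖ := sq _
    _ ≤ ((C₁ + C₂) * ((1 + t ^ 2)⁻¹) ^ 2) * ((C₁ + C₂) * ((1 + ξ ^ 2)⁻¹) ^ 4) := by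
        gcongr
        · exact (h₁ t ξ).trans (by gcongr; linarith)
        · exact (h₂ t ξ).trans (by gcongr; linarith)
    _ = _ := by ring

theorem memLp_two_of_bdd {α : Type*} [MeasurableSpace α] {μ : Measure α} {f : α → ℂ}
    (hf : Integrable f μ) {M : ℝ} (hM : ∀ x, ‖f x‖ ≤ M) : MemLp f 2 μ := by
  rw [memLp_two_iff_integrable_sq_norm hf.1]
  refine (hf.norm.const_mul M).mono' (hf.1.norm.pow 2) (Filter.Eventually.of_forall fun x => ?_)
  rw [Real.norm_of_nonneg (by positivity), sq]
  gcongr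
  exact hM x

theorem continuous_FTinv {f : ℝ → ℂ} (hf : Integrable f) : Continuous (FTinv f) := by
  have h : FTinv f = fun x => 𝓕 f (-x) := by
    ext x; exact Real.fourierInv_eq_fourier_neg f x
  rw [h]
  exact (continuous_fourier_of_integrable hf).comp continuous_neg

theorem FTinv_eq_FT_neg (f : ℝ → ℂ) (x : ℝ) : FTinv f x = FT f (-x) :=
  Real.fourierInv_eq_fourier_neg f x

theorem FT_mul_FTinv {A B : ℝ → ℂ} (hB : Continuous B) (hA' : Integrable A)
    (hB' : Integrable B) {M : ℝ} (hM : ∀ x, ‖B x‖ ≤ M)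
    (hAB : Integrable (fun x => FTinv A x * FTinv B x)) (τ : ℝ) :
    FT (fun x => FTinv A x * FTinv B x) τ = ∫ y, A y * B (τ - y) := by
  set c := convolution A B (ContinuousLinearMap.mul ℂ ℂ) volume with hc
  have hcc : Continuous c :=
    BddAbove.continuous_convolution_right_of_integrable (L := ContinuousLinearMap.mul ℂ ℂ)
      ⟨M, by rintro _ ⟨x, rfl⟩; exact hM x⟩ hA' hB
  have hci : Integrable c := hA'.integrable_convolution (ContinuousLinearMap.mul ℂ ℂ) hB'
  have h : FTinv c = fun x => FTinv A x * FTinv B x := by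
    ext x
    rw [FTinv_eq_FT_neg, FTinv_eq_FT_neg, FTinv_eq_FT_neg]
    exact Real.fourier_mul_convolution_eq hA' hB' (-x)
  rw [← h, FT_FTinv hcc hci (h ▸ hAB)]
  rfl

theorem LPS_FTinv (φ : 𝓢(ℝ, ℂ)) (j : ℕ) {h : ℝ → ℂ} (hh : Integrable h) (x : ℝ) :
    LPS φ j (FTinv h) x = FTinv (fun ξ => FT φ (((2 : ℝ) ^ j)⁻¹ * ξ) * h ξ) x := by
  have h2 : (0 : ℝ) < 2 ^ j := by positivity
  have hφ : Integrable (fun y : ℝ => ((2 : ℝ) ^ j : ℝ) * φ ((2 : ℝ) ^ j * (x - y))) := by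
    have := ((φ.integrable (μ := volume)).comp_mul_left' (ne_of_gt h2)).comp_sub_left x
    simpa using this.const_mul ((2 : ℝ) ^ j : ℂ)
  unfold LPS
  have e1 : ∀ y : ℝ, ((2 : ℝ) ^ j : ℝ) * φ ((2 : ℝ) ^ j * (x - y)) * FTinv h y =
      ∫ ξ, (((2 : ℝ) ^ j : ℝ) * φ ((2 : ℝ) ^ j * (x - y))) *
        (Complex.exp ((2 * Real.pi * Complex.I) * ((y * ξ : ℝ) : ℂ)) * h ξ) := fun y => by
    rw [FTinv_eq_integral, ← integral_const_mul]
  simp only [e1]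
  rw [integral_integral_swap]
  · rw [FTinv_eq_integral]
    congr 1; ext ξ
    have e2 : ∀ y : ℝ, (((2 : ℝ) ^ j : ℝ) * φ ((2 : ℝ) ^ j * (x - y))) *
        (Complex.exp ((2 * Real.pi * Complex.I) * ((y * ξ : ℝ) : ℂ)) * h ξ) =
        (fun z => (((2 : ℝ) ^ j : ℝ) * (Complex.exp ((2 * Real.pi * Complex.I) * ((x * ξ : ℝ) : ℂ)) *
          h ξ) * (Complex.exp (-(2 * Real.pi * Complex.I) *
          (((2 ^ j * z) * ((2 ^ j)⁻¹ * ξ) : ℝ) : ℂ)) * φ (2 ^ j * z)))) (x - y) := fun y => by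
      have : Complex.exp ((2 * Real.pi * Complex.I) * ((y * ξ : ℝ) : ℂ)) =
          Complex.exp ((2 * Real.pi * Complex.I) * ((x * ξ : ℝ) : ℂ)) *
          Complex.exp (-(2 * Real.pi * Complex.I) *
          (((2 ^ j * (x - y)) * ((2 ^ j)⁻¹ * ξ) : ℝ) : ℂ)) := by
        rw [← Complex.exp_add]
        congr 1
        rw [show (2 ^ j * (x - y)) * ((2 ^ j)⁻¹ * ξ) = (x - y) * ξ by field_simp]
        push_cast; ring
      rw [this]; ring
    simp only [e2]
    rw [integral_sub_left_eq_self (fun z => (((2 : ℝ) ^ j : ℝ) *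
          (Complex.exp ((2 * Real.pi * Complex.I) * ((x * ξ : ℝ) : ℂ)) *
          h ξ) * (Complex.exp (-(2 * Real.pi * Complex.I) *
          (((2 ^ j * z) * ((2 ^ j)⁻¹ * ξ) : ℝ) : ℂ)) * φ (2 ^ j * z)))) volume x,
      integral_const_mul,
      Measure.integral_comp_mul_left (fun z => Complex.exp (-(2 * Real.pi * Complex.I) *
          (((z) * ((2 ^ j)⁻¹ * ξ) : ℝ) : ℂ)) * φ z), ← FT_eq_integral, abs_of_pos (by positivity),
      Complex.real_smul]
    push_cast
    field_simp
  · have hp := hφ.mul_prod hh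
    refine (hp.bdd_mul (c := 1) (f := fun p : ℝ × ℝ =>
      Complex.exp ((2 * Real.pi * Complex.I) * ((p.1 * p.2 : ℝ) : ℂ)))
      (Continuous.aestronglyMeasurable (by fun_prop)) ?_).congr ?_
    · filter_upwards with q
      rw [norm_exp_two_pi_I_mul]
    · filter_upwards with q
      simp only [Function.uncurry]
      ring

/-- The symbol of `Δ_j P^±`. -/
def halfPsi (φ : 𝓢(ℝ, ℂ)) (ε : ℝ) (j : ℕ) (ξ : ℝ) : ℂ :=
  if 0 ≤ ε * ξ then psiLP φ (j + 1) ξ else 0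

theorem halfPsi_support {φ : 𝓢(ℝ, ℂ)} (hφ : IsLPfilter φ) {ε : ℝ} {j : ℕ} {ξ : ℝ}
    (h : halfPsi φ ε j ξ ≠ 0) : 0 ≤ ε * ξ ∧ 2 ^ j ≤ |ξ| ∧ |ξ| ≤ 2 ^ (j + 2) := by
  unfold halfPsi at h
  split_ifs at h with h0
  · exact ⟨h0, psiLP_support_ge hφ h, psiLP_support_le hφ h⟩
  · exact absurd rfl h

theorem continuous_halfPsi {φ : 𝓢(ℝ, ℂ)} (hφ : IsLPfilter φ) {ε : ℝ} (hε : ε = 1 ∨ ε = -1)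
    (j : ℕ) : Continuous (halfPsi φ ε j) := by
  unfold halfPsi
  refine Continuous.if_le (continuous_psiLP φ _) continuous_const continuous_const
    (by fun_prop) fun x hx => ?_
  have hx0 : x = 0 := by rcases hε with rfl | rfl <;> linarith
  by_contra h
  have := psiLP_support_ge hφ h
  rw [hx0, abs_zero] at this
  have : (0 : ℝ) < 2 ^ j := by positivity
  linarith

theorem norm_halfPsi_le {φ : 𝓢(ℝ, ℂ)} {B : ℝ} (hB : ∀ m ξ, ‖psiLP φ m ξ‖ ≤ B)
    (ε : ℝ) (j : ℕ) (ξ : ℝ) : ‖halfPsi φ ε j ξ‖ ≤ B := by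
  have h := hB (j + 1) ξ
  unfold halfPsi
  split_ifs
  · exact h
  · rw [norm_zero]; exact (norm_nonneg _).trans h

theorem integrable_pft_right (u : 𝓢(ℝ × ℝ, ℂ)) (t : ℝ) : Integrable (fun ξ => pft u t ξ) := by
  obtain ⟨C, hC, h⟩ := norm_pft_le_right u
  refine (integrable_inv_one_add_sq.const_mul C).mono'
    (continuous_pft_right u t).aestronglyMeasurable (Filter.Eventually.of_forall fun ξ => ?_)
  refine (h t ξ).trans ?_
  gcongr
  exact pow_le_of_le_one (by positivity) (inv_one_add_sq_le_one ξ) (by norm_num)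

theorem Dx_Pproj (φ : 𝓢(ℝ, ℂ)) (ε : ℝ) (j : ℕ)
    (u : 𝓢(ℝ × ℝ, ℂ)) (t x : ℝ) :
    Dx φ j (Pproj ε u) (t, x) = FTinv (fun ξ => halfPsi φ ε j ξ * pft u t ξ) x := by
  set h : ℝ → ℂ := fun ξ => (if 0 ≤ ε * ξ then (1 : ℂ) else 0) * pft u t ξ with hh
  have hi : Integrable h := by
    refine (integrable_pft_right u t).bdd_mul (c := 1) ?_ ?_
    · exact (Measurable.ite (measurableSet_le measurable_const (by fun_prop))
        measurable_const measurable_const).aestronglyMeasurable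
    · filter_upwards with ξ
      split_ifs <;> simp
  have key : ∀ k : ℕ, Integrable (fun ξ => FT φ (((2 : ℝ) ^ k)⁻¹ * ξ) * h ξ) := fun k => by
    obtain ⟨B, hB⟩ : ∃ B, ∀ ξ, ‖FT φ ξ‖ ≤ B := ⟨_, norm_FT_le φ⟩
    refine hi.bdd_mul (c := B) ((continuous_FT_schwartz φ).comp
      (by fun_prop)).aestronglyMeasurable ?_
    filter_upwards with ξ using hB _
  have e : ∀ k, Sx φ k (Pproj ε u) (t, x) =
      FTinv (fun ξ => FT φ (((2 : ℝ) ^ k)⁻¹ * ξ) * h ξ) x := fun k => LPS_FTinv φ k hi x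
  unfold Dx
  rw [e, e, FTinv_eq_integral, FTinv_eq_integral, FTinv_eq_integral, ← integral_sub]
  · congr 1; ext ξ
    simp only [hh, halfPsi]
    split_ifs
    · rw [psiLP_succ]; ring
    · ring
  all_goals
    refine (key _).bdd_mul (c := 1) (Continuous.aestronglyMeasurable (by fun_prop)) ?_
    filter_upwards with ξ using (norm_exp_two_pi_I_mul _).le

/-- The symbol of `∑_{|j-j'| ≤ 1} Δ_{j'} P^+`. -/
def nearPsi (φ : 𝓢(ℝ, ℂ)) (j : ℕ) (ξ : ℝ) : ℂ :=
  ∑ j' ∈ Finset.range (j + 2), if |(j : ℤ) - (j' : ℤ)| ≤ 1 then halfPsi φ 1 j' ξ else 0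

theorem nearPsi_support {φ : 𝓢(ℝ, ℂ)} (hφ : IsLPfilter φ) {j : ℕ} {ξ : ℝ}
    (h : nearPsi φ j ξ ≠ 0) : 0 ≤ ξ ∧ 1 ≤ |ξ| ∧ 2 ^ j ≤ 2 * |ξ| ∧ |ξ| ≤ 2 ^ (j + 3) := by
  obtain ⟨j', -, hj⟩ := Finset.exists_ne_zero_of_sum_ne_zero h
  split_ifs at hj with h1
  · obtain ⟨h2, h3, h4⟩ := halfPsi_support hφ hj
    rw [abs_le] at h1
    refine ⟨by linarith, le_trans (one_le_pow₀ (by norm_num)) h3, ?_, ?_⟩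
    · calc (2 : ℝ) ^ j ≤ 2 ^ (j' + 1) := pow_le_pow_right₀ (by norm_num) (by omega)
        _ = 2 * 2 ^ j' := by ring
        _ ≤ _ := by linarith
    · exact h4.trans (pow_le_pow_right₀ (by norm_num) (by omega))
  · exact absurd rfl hj

theorem continuous_nearPsi {φ : 𝓢(ℝ, ℂ)} (hφ : IsLPfilter φ) (j : ℕ) :
    Continuous (nearPsi φ j) := by
  unfold nearPsi
  refine continuous_finsetSum _ fun i _ => ?_
  split_ifs
  · exact continuous_halfPsi hφ (Or.inl rfl) i
  · exact continuous_const

theorem norm_nearPsi_le {φ : 𝓢(ℝ, ℂ)} {B : ℝ} (hB : ∀ m ξ, ‖psiLP φ m ξ‖ ≤ B)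
    (j : ℕ) (ξ : ℝ) : ‖nearPsi φ j ξ‖ ≤ 3 * B := by
  unfold nearPsi
  rw [← Finset.sum_filter]
  refine (norm_sum_le _ _).trans ?_
  refine (Finset.sum_le_card_nsmul _ _ B fun i _ => norm_halfPsi_le hB _ _ _).trans ?_
  rw [nsmul_eq_mul]
  have hB0 : 0 ≤ B := (norm_nonneg _).trans (hB 0 0)
  gcongr
  have : (Finset.range (j + 2)).filter (fun j' : ℕ => |(j : ℤ) - (j' : ℤ)| ≤ 1) ⊆
      Finset.Icc (j - 1) (j + 1) := by
    intro i hi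
    rw [Finset.mem_filter, abs_le] at hi
    rw [Finset.mem_Icc]; omega
  have h2 := Finset.card_le_card this
  rw [Nat.card_Icc] at h2
  have h3 := h2.trans (show j + 1 + 1 - (j - 1) ≤ 3 by omega)
  exact_mod_cast h3

theorem sum_FTinv_mul_eq (φ : 𝓢(ℝ, ℂ)) (hφ : IsLPfilter φ) (u : 𝓢(ℝ × ℝ, ℂ)) (j : ℕ)
    (t x : ℝ) : (∑' j' : ℕ, if |(j : ℤ) - (j' : ℤ)| ≤ 1 then Dx φ j' (Pproj 1 u) (t, x) else 0) =
      FTinv (fun ξ => nearPsi φ j ξ * pft u t ξ) x := by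
  obtain ⟨B, -, hB⟩ := exists_norm_psiLP_le φ
  rw [tsum_eq_sum (s := Finset.range (j + 2)), FTinv_eq_integral]
  · simp only [nearPsi, Finset.sum_mul, Finset.mul_sum]
    rw [integral_finsetSum]
    · refine Finset.sum_congr rfl fun i _ => ?_
      split_ifs
      · rw [Dx_Pproj, FTinv_eq_integral]
      · simp
    · intro i _
      refine Integrable.bdd_mul (c := 1) ?_ (Continuous.aestronglyMeasurable (by fun_prop)) ?_
      · refine (integrable_pft_right u t).bdd_mul (c := B) ?_ ?_
        · split_ifs
          · exact (continuous_halfPsi hφ (Or.inl rfl) i).aestronglyMeasurable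
          · exact aestronglyMeasurable_const
        · filter_upwards with ξ
          split_ifs
          · exact norm_halfPsi_le hB _ _ _
          · rw [norm_zero]; exact (norm_nonneg _).trans (hB 0 0)
      · filter_upwards with ξ using (norm_exp_two_pi_I_mul _).le
  · intro i hi
    rw [Finset.mem_range] at hi
    rw [if_neg]
    rw [abs_le]; omega

theorem remR_eq (φ : 𝓢(ℝ, ℂ)) (hφ : IsLPfilter φ) (ε : ℝ) (u v : 𝓢(ℝ × ℝ, ℂ)) (t x : ℝ) :
    remR φ (Pproj ε v) (Pproj 1 u) (t, x) =
      ∑' j : ℕ, FTinv (fun ξ => halfPsi φ ε j ξ * pft v t ξ) x *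
        FTinv (fun ξ => nearPsi φ j ξ * pft u t ξ) x := by
  unfold remR
  congr 1; ext j
  rw [← sum_FTinv_mul_eq φ hφ, ← Dx_Pproj, ← tsum_mul_left]
  congr 1; ext j'
  split_ifs <;> simp

theorem exists_norm_halfPsi_mul_pft_le {φ : 𝓢(ℝ, ℂ)} (hφ : IsLPfilter φ) (v : 𝓢(ℝ × ℝ, ℂ)) :
    ∃ K : ℝ, 0 < K ∧ ∀ ε j t ξ,
      ‖halfPsi φ ε j ξ * pft v t ξ‖ ≤ K * (2⁻¹ : ℝ) ^ j * (1 + ξ ^ 2)⁻¹ := by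
  obtain ⟨B, hB0, hB⟩ := exists_norm_psiLP_le φ
  obtain ⟨C, hC, h⟩ := norm_pft_le_right v
  refine ⟨B * C, by positivity, fun ε j t ξ => ?_⟩
  by_cases h0 : halfPsi φ ε j ξ = 0
  · rw [h0, zero_mul, norm_zero]; positivity
  obtain ⟨-, h1, -⟩ := halfPsi_support hφ h0
  have h2 : (1 + ξ ^ 2)⁻¹ ≤ (2⁻¹ : ℝ) ^ j := by
    rw [inv_pow]
    refine inv_anti₀ (by positivity) ?_
    rw [← sq_abs]
    nlinarith [one_le_pow₀ (n := j) (show (1 : ℝ) ≤ 2 by norm_num)]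
  have h3 := inv_one_add_sq_le_one ξ
  rw [norm_mul]
  calc ‖halfPsi φ ε j ξ‖ * ‖pft v t ξ‖ ≤ B * (C * ((1 + ξ ^ 2)⁻¹) ^ 4) :=
        mul_le_mul (norm_halfPsi_le hB _ _ _) (h t ξ) (norm_nonneg _) hB0.le
    _ = B * C * (1 + ξ ^ 2)⁻¹ * ((1 + ξ ^ 2)⁻¹ * ((1 + ξ ^ 2)⁻¹) ^ 2) := by ring
    _ ≤ B * C * (2⁻¹ : ℝ) ^ j * ((1 + ξ ^ 2)⁻¹ * 1 ^ 2) := by gcongr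
    _ = _ := by ring

theorem exists_norm_nearPsi_mul_pft_le (φ : 𝓢(ℝ, ℂ)) (u : 𝓢(ℝ × ℝ, ℂ)) :
    ∃ K : ℝ, 0 < K ∧ ∀ j t ξ, ‖nearPsi φ j ξ * pft u t ξ‖ ≤ K * (1 + ξ ^ 2)⁻¹ := by
  obtain ⟨B, hB0, hB⟩ := exists_norm_psiLP_le φ
  obtain ⟨C, hC, h⟩ := norm_pft_le_right u
  refine ⟨3 * B * C, by positivity, fun j t ξ => ?_⟩
  rw [norm_mul, mul_assoc (3 * B)]
  refine mul_le_mul (norm_nearPsi_le hB _ _) ((h t ξ).trans ?_) (norm_nonneg _) (by positivity)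
  gcongr
  exact pow_le_of_le_one (by positivity) (inv_one_add_sq_le_one ξ) (by norm_num)

/-- The bilinear symbol of `(f, g) ↦ R(P^± f, P^+ g)`. -/
def remSymbol (φ : 𝓢(ℝ, ℂ)) (ε ξ₁ ξ₂ : ℝ) : ℂ :=
  ∑' j : ℕ, halfPsi φ ε j ξ₁ * nearPsi φ j ξ₂

theorem exists_finset_halfPsi {φ : 𝓢(ℝ, ℂ)} (hφ : IsLPfilter φ) (ε ξ : ℝ) :
    ∃ S : Finset ℕ, S.card ≤ 3 ∧ ∀ j ∉ S, halfPsi φ ε j ξ = 0 := by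
  set L := Nat.log 2 ⌊|ξ|⌋₊ with hL
  refine ⟨Finset.Icc (L - 2) L, by rw [Nat.card_Icc]; omega, fun j hj => ?_⟩
  by_contra h0
  obtain ⟨-, h1, h2⟩ := halfPsi_support hφ h0
  apply hj
  have h3 : 2 ^ j ≤ ⌊|ξ|⌋₊ := Nat.le_floor (by exact_mod_cast h1)
  have h4 : ⌊|ξ|⌋₊ ≤ 2 ^ (j + 2) := by
    refine Nat.floor_le_of_le ?_
    exact_mod_cast h2
  have h5 : j ≤ L := by
    have := Nat.log_mono_right (b := 2) h3
    rwa [Nat.log_pow (by norm_num)] at this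
  have h6 : L ≤ j + 2 := by
    have := Nat.log_mono_right (b := 2) h4
    rwa [Nat.log_pow (by norm_num)] at this
  rw [Finset.mem_Icc]; omega

theorem hasSum_remSymbol {φ : 𝓢(ℝ, ℂ)} (hφ : IsLPfilter φ) (ε ξ₁ ξ₂ : ℝ) :
    HasSum (fun j => halfPsi φ ε j ξ₁ * nearPsi φ j ξ₂) (remSymbol φ ε ξ₁ ξ₂) := by
  obtain ⟨S, -, hS⟩ := exists_finset_halfPsi hφ ε ξ₁
  refine Summable.hasSum ?_
  exact summable_of_ne_finset_zero (s := S) fun j hj => by rw [hS j hj, zero_mul]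

theorem exists_norm_remSymbol_le {φ : 𝓢(ℝ, ℂ)} (hφ : IsLPfilter φ) :
    ∃ K : ℝ, 0 < K ∧ ∀ ε ξ₁ ξ₂, ‖remSymbol φ ε ξ₁ ξ₂‖ ≤ K := by
  obtain ⟨B, hB0, hB⟩ := exists_norm_psiLP_le φ
  refine ⟨3 * (B * (3 * B)), by positivity, fun ε ξ₁ ξ₂ => ?_⟩
  obtain ⟨S, hc, hS⟩ := exists_finset_halfPsi hφ ε ξ₁
  unfold remSymbol
  rw [tsum_eq_sum (s := S) fun j hj => by rw [hS j hj, zero_mul]]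
  refine (norm_sum_le _ _).trans ((Finset.sum_le_card_nsmul _ _ (B * (3 * B))
    fun i _ => ?_).trans ?_)
  · rw [norm_mul]
    exact mul_le_mul (norm_halfPsi_le hB _ _ _) (norm_nearPsi_le hB _ _) (norm_nonneg _) hB0.le
  · rw [nsmul_eq_mul]
    gcongr
    exact_mod_cast hc

theorem remSymbol_support {φ : 𝓢(ℝ, ℂ)} (hφ : IsLPfilter φ) {ε ξ₁ ξ₂ : ℝ}
    (h : remSymbol φ ε ξ₁ ξ₂ ≠ 0) : 0 ≤ ε * ξ₁ ∧ 0 ≤ ξ₂ ∧ 1 ≤ |ξ₁| ∧ 1 ≤ |ξ₂| ∧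
      |ξ₁| ≤ 8 * |ξ₂| ∧ |ξ₂| ≤ 8 * |ξ₁| := by
  have : ∃ j, halfPsi φ ε j ξ₁ * nearPsi φ j ξ₂ ≠ 0 := by
    by_contra! h0
    exact h (by simp only [remSymbol, h0, tsum_zero])
  obtain ⟨j, hj⟩ := this
  obtain ⟨a1, a2, a3⟩ := halfPsi_support hφ (left_ne_zero_of_mul hj)
  obtain ⟨b0, b1, b2, b3⟩ := nearPsi_support hφ (right_ne_zero_of_mul hj)
  rw [pow_add] at a3 b3
  have := one_le_pow₀ (n := j) (show (1 : ℝ) ≤ 2 by norm_num)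
  exact ⟨a1, b0, by linarith, b1, by linarith, by linarith⟩

theorem measurable_remSymbol {φ : 𝓢(ℝ, ℂ)} (hφ : IsLPfilter φ) {ε : ℝ} (hε : ε = 1 ∨ ε = -1) :
    Measurable (fun p : ℝ × ℝ => remSymbol φ ε p.1 p.2) := by
  refine measurable_of_tendsto_metrizable (f := fun n (p : ℝ × ℝ) =>
    ∑ j ∈ Finset.range n, halfPsi φ ε j p.1 * nearPsi φ j p.2) (fun n => ?_) ?_
  · refine Continuous.measurable (continuous_finsetSum _ fun i _ => ?_)
    exact ((continuous_halfPsi hφ hε i).comp continuous_fst).mul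
      ((continuous_nearPsi hφ i).comp continuous_snd)
  · rw [tendsto_pi_nhds]
    exact fun p => (hasSum_remSymbol hφ ε p.1 p.2).tendsto_sum_nat

/-- The `L¹` norm of a product of two inverse Fourier transforms with quadratically decaying
symbols. -/
theorem lintegral_enorm_FTinv_mul_le {A B : ℝ → ℂ} (hA : Continuous A) (hB : Continuous B)
    {a b : ℝ} (ha : ∀ ξ, ‖A ξ‖ ≤ a * (1 + ξ ^ 2)⁻¹) (hb : ∀ ξ, ‖B ξ‖ ≤ b * (1 + ξ ^ 2)⁻¹) :
    ∫⁻ x, ‖FTinv A x * FTinv B x‖ₑ ≤ ENNReal.ofReal a * (ENNReal.ofReal b *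
      eLpNorm (fun ξ : ℝ => (1 + ξ ^ 2)⁻¹) 2 ^ 2) := by
  have hbase : Integrable (fun ξ : ℝ => (1 + ξ ^ 2)⁻¹) := integrable_inv_one_add_sq
  have key : ∀ {A : ℝ → ℂ} {a : ℝ}, Continuous A → (∀ ξ, ‖A ξ‖ ≤ a * (1 + ξ ^ 2)⁻¹) →
      Continuous (FTinv A) ∧
      eLpNorm (FTinv A) 2 ≤ ENNReal.ofReal a * eLpNorm (fun ξ : ℝ => (1 + ξ ^ 2)⁻¹) 2 := by
    intro A a hA ha
    have hi : Integrable A := (hbase.const_mul a).mono' hA.aestronglyMeasurable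
      (Filter.Eventually.of_forall ha)
    have ha0 : 0 ≤ a := by simpa using (norm_nonneg _).trans (ha 0)
    have h2 : MemLp A 2 := memLp_two_of_bdd hi (M := a) fun x => (ha x).trans
      (mul_le_of_le_one_right ha0 (inv_one_add_sq_le_one x))
    refine ⟨continuous_FTinv hi, ?_⟩
    rw [show eLpNorm (FTinv A) 2 volume = eLpNorm A 2 volume from eLpNorm_fourierInv_eq hi h2]
    refine eLpNorm_le_mul_eLpNorm_of_ae_le_mul (Filter.Eventually.of_forall fun x => ?_) 2
    rw [Real.norm_of_nonneg (by positivity)]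
    exact ha x
  obtain ⟨cA, hA2⟩ := key hA ha
  obtain ⟨cB, hB2⟩ := key hB hb
  have h1 : ∫⁻ x, ‖FTinv A x * FTinv B x‖ₑ = eLpNorm (FTinv A • FTinv B) 1 := by
    simp only [eLpNorm_one_eq_lintegral_enorm, smul_eq_mul, Pi.mul_apply]
  have h2 : eLpNorm (FTinv A • FTinv B) 1 ≤ eLpNorm (FTinv A) 2 * eLpNorm (FTinv B) 2 :=
    eLpNorm_smul_le_mul_eLpNorm cB.aestronglyMeasurable cA.aestronglyMeasurable
  rw [h1]
  refine h2.trans ((mul_le_mul' hA2 hB2).trans (le_of_eq ?_))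
  generalize eLpNorm (fun ξ : ℝ => (1 + ξ ^ 2)⁻¹) 2 = c
  ring

theorem eLpNorm_inv_one_add_sq_ne_top : eLpNorm (fun ξ : ℝ => (1 + ξ ^ 2)⁻¹) 2 ≠ ⊤ := by
  have h := (integrable_inv_one_add_sq.ofReal (𝕜 := ℂ))
  have h2 := memLp_two_of_bdd (M := 1) h fun x => by
    rw [RCLike.norm_ofReal, abs_of_nonneg (by positivity)]
    exact inv_one_add_sq_le_one x
  have h3 := h2.norm.2
  simp only [RCLike.norm_ofReal] at h3
  refine ne_of_lt (lt_of_eq_of_lt (eLpNorm_congr_norm_ae ?_) h3)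
  filter_upwards with x
  simp

theorem FT_remR {φ : 𝓢(ℝ, ℂ)} (hφ : IsLPfilter φ) {ε : ℝ} (hε : ε = 1 ∨ ε = -1)
    (u v : 𝓢(ℝ × ℝ, ℂ)) (t : ℝ) :
    Integrable (fun x => remR φ (Pproj ε v) (Pproj 1 u) (t, x)) ∧
    ∀ ξ, FT (fun x => remR φ (Pproj ε v) (Pproj 1 u) (t, x)) ξ =
      ∫ η, remSymbol φ ε η (ξ - η) * (pft v t η * pft u t (ξ - η)) := by
  obtain ⟨K, hK, hKv⟩ := exists_norm_halfPsi_mul_pft_le hφ v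
  obtain ⟨K', hK', hKu⟩ := exists_norm_nearPsi_mul_pft_le φ u
  set A : ℕ → ℝ → ℂ := fun j ξ => halfPsi φ ε j ξ * pft v t ξ with hAdef
  set B : ℕ → ℝ → ℂ := fun j ξ => nearPsi φ j ξ * pft u t ξ with hBdef
  have hA : ∀ j, Continuous (A j) := fun j =>
    (continuous_halfPsi hφ hε j).mul (continuous_pft_right v t)
  have hB : ∀ j, Continuous (B j) := fun j =>
    (continuous_nearPsi hφ j).mul (continuous_pft_right u t)
  have hbase : Integrable (fun ξ : ℝ => (1 + ξ ^ 2)⁻¹) := integrable_inv_one_add_sq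
  have bA : ∀ j ξ, ‖A j ξ‖ ≤ K * (2⁻¹ : ℝ) ^ j * (1 + ξ ^ 2)⁻¹ := fun j ξ => hKv ε j t ξ
  have bB : ∀ j ξ, ‖B j ξ‖ ≤ K' * (1 + ξ ^ 2)⁻¹ := fun j ξ => hKu j t ξ
  have iA : ∀ j, Integrable (A j) := fun j => (hbase.const_mul _).mono'
    (hA j).aestronglyMeasurable (Filter.Eventually.of_forall (bA j))
  have iB : ∀ j, Integrable (B j) := fun j => (hbase.const_mul _).mono'
    (hB j).aestronglyMeasurable (Filter.Eventually.of_forall (bB j))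
  have cf : ∀ j, Continuous (fun x => FTinv (A j) x * FTinv (B j) x) := fun j =>
    (continuous_FTinv (iA j)).mul (continuous_FTinv (iB j))
  have geom : ∑' j : ℕ, ENNReal.ofReal (K * (2⁻¹ : ℝ) ^ j) ≠ ⊤ :=
    ((summable_geometric_of_lt_one (by norm_num) (by norm_num)).mul_left K).tsum_ofReal_ne_top
  have hsum : ∑' j, ∫⁻ x, ‖FTinv (A j) x * FTinv (B j) x‖ₑ ≠ ⊤ := by
    refine ne_top_of_le_ne_top ?_ (ENNReal.tsum_le_tsum fun j =>
      lintegral_enorm_FTinv_mul_le (hA j) (hB j) (bA j) (bB j))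
    rw [ENNReal.tsum_mul_right]
    refine ENNReal.mul_ne_top geom (ENNReal.mul_ne_top ENNReal.ofReal_ne_top
      (ENNReal.pow_ne_top eLpNorm_inv_one_add_sq_ne_top))
  have hR : (fun x => remR φ (Pproj ε v) (Pproj 1 u) (t, x)) =
      fun x => ∑' j, FTinv (A j) x * FTinv (B j) x := by
    ext x; exact remR_eq φ hφ ε u v t x
  rw [hR]
  have ij : ∀ j, Integrable (fun x => FTinv (A j) x * FTinv (B j) x) := fun j =>
    ⟨(cf j).aestronglyMeasurable, lt_top_iff_ne_top.2 (ne_top_of_le_ne_top hsum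
      (ENNReal.le_tsum j))⟩
  constructor
  · refine ⟨Continuous.aestronglyMeasurable ?_, ?_⟩
    · refine continuous_tsum (u := fun j : ℕ => (K * Real.pi) * (2⁻¹ : ℝ) ^ j * (K' * Real.pi)) cf
        (((summable_geometric_of_lt_one (by norm_num) (by norm_num)).mul_left _).mul_right _)
        fun j x => ?_
      rw [norm_mul]
      have n1 : ‖FTinv (A j) x‖ ≤ K * Real.pi * (2⁻¹ : ℝ) ^ j := by
        refine (norm_FTinv_le _ _).trans ((integral_mono (iA j).norm (hbase.const_mul _)
          (bA j)).trans (le_of_eq ?_))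
        rw [integral_const_mul, integral_univ_inv_one_add_sq]; ring
      have n2 : ‖FTinv (B j) x‖ ≤ K' * Real.pi := by
        refine (norm_FTinv_le _ _).trans ((integral_mono (iB j).norm (hbase.const_mul _)
          (bB j)).trans (le_of_eq ?_))
        rw [integral_const_mul, integral_univ_inv_one_add_sq]
      exact mul_le_mul n1 n2 (norm_nonneg _) (by positivity)
    · refine lt_of_le_of_lt (lintegral_mono fun x => enorm_tsum_le_tsum_enorm) ?_
      rw [lintegral_tsum fun j => (cf j).measurable.enorm.aemeasurable]
      exact lt_top_iff_ne_top.2 hsum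
  · intro ξ
    have e1 : FT (fun x => ∑' j, FTinv (A j) x * FTinv (B j) x) ξ =
        ∑' j, FT (fun x => FTinv (A j) x * FTinv (B j) x) ξ := by
      simp only [FT_eq_integral, ← tsum_mul_left]
      refine integral_tsum (fun j => Continuous.aestronglyMeasurable ?_) ?_
      · have := cf j
        fun_prop
      · have he : ∀ y : ℝ, ‖Complex.exp (-(2 * Real.pi * Complex.I) * (y : ℂ))‖ₑ = 1 := fun y => by
          rw [← ofReal_norm, norm_exp_neg_two_pi_I_mul, ENNReal.ofReal_one]
        simpa only [enorm_mul, he, one_mul] using hsum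
    have e2 : ∀ η, remSymbol φ ε η (ξ - η) * (pft v t η * pft u t (ξ - η)) =
        ∑' j, A j η * B j (ξ - η) := fun η => by
      unfold remSymbol
      rw [← tsum_mul_right]
      congr 1; ext j
      simp only [hAdef, hBdef]; ring
    rw [e1]
    simp only [e2]
    rw [integral_tsum]
    · congr 1; ext j
      refine FT_mul_FTinv (hB j) (iA j) (iB j) (M := K') (fun x => (bB j x).trans
        (mul_le_of_le_one_right hK'.le (inv_one_add_sq_le_one x))) (ij j) ξ
    · intro j
      exact ((hA j).mul ((hB j).comp (continuous_const.sub continuous_id))).aestronglyMeasurable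
    · have : ∀ j η, ‖A j η * B j (ξ - η)‖ₑ ≤ ENNReal.ofReal (K * (2⁻¹ : ℝ) ^ j) *
          (ENNReal.ofReal K' * ENNReal.ofReal ((1 + η ^ 2)⁻¹)) := fun j η => by
        rw [← ofReal_norm, ← ENNReal.ofReal_mul hK'.le,
          ← ENNReal.ofReal_mul (by positivity)]
        refine ENNReal.ofReal_le_ofReal ?_
        rw [norm_mul]
        refine (mul_le_mul (bA j η) ((bB j (ξ - η)).trans
          (mul_le_of_le_one_right hK'.le (inv_one_add_sq_le_one _))) (norm_nonneg _)
          (by positivity)).trans (le_of_eq (by ring))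
      refine ne_top_of_le_ne_top ?_ (ENNReal.tsum_le_tsum fun j => lintegral_mono (this j))
      simp only [lintegral_const_mul' _ _ ENNReal.ofReal_ne_top]
      rw [ENNReal.tsum_mul_right]
      exact ENNReal.mul_ne_top geom (ENNReal.mul_ne_top ENNReal.ofReal_ne_top
        (by simpa [ofReal_norm] using hbase.lintegral_lt_top.ne))

/-- The spatial Fourier transform of `R(P^± v, P^+ u)`. -/
def remSpec (φ : 𝓢(ℝ, ℂ)) (ε : ℝ) (u v : ℝ × ℝ → ℂ) (t ξ : ℝ) : ℂ :=
  ∫ η, remSymbol φ ε η (ξ - η) * (pft v t η * pft u t (ξ - η))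

theorem inv_one_add_sq_mul_le (ξ η : ℝ) :
    (1 + η ^ 2)⁻¹ * (1 + (ξ - η) ^ 2)⁻¹ ≤ 2 * (1 + ξ ^ 2)⁻¹ := by
  rw [← mul_inv, ← div_eq_mul_inv, inv_le_comm₀ (by positivity) (by positivity), inv_div,
    div_le_iff₀ (by norm_num)]
  nlinarith [sq_nonneg (ξ - 2 * η), mul_nonneg (sq_nonneg η) (sq_nonneg (ξ - η))]

theorem exists_norm_remSpec_le {φ : 𝓢(ℝ, ℂ)} (hφ : IsLPfilter φ) (ε : ℝ)
    (u v : 𝓢(ℝ × ℝ, ℂ)) : ∃ K : ℝ, 0 < K ∧ ∀ t ξ,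
      ‖remSpec φ ε u v t ξ‖ ≤ K * ((1 + ξ ^ 2)⁻¹) ^ 3 := by
  obtain ⟨K, hK, hK'⟩ := exists_norm_remSymbol_le hφ
  obtain ⟨C, hC, h⟩ := norm_pft_le_right u
  obtain ⟨C', hC', h'⟩ := norm_pft_le_right v
  refine ⟨K * C' * C * 8 * Real.pi, by positivity, fun t ξ => ?_⟩
  unfold remSpec
  refine (norm_integral_le_integral_norm _).trans ?_
  calc ∫ η, ‖remSymbol φ ε η (ξ - η) * (pft v t η * pft u t (ξ - η))‖
      ≤ ∫ η : ℝ, K * C' * C * 8 * ((1 + ξ ^ 2)⁻¹) ^ 3 * (1 + η ^ 2)⁻¹ := by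
        refine integral_mono_of_nonneg (Filter.Eventually.of_forall fun x => norm_nonneg _)
          (integrable_inv_one_add_sq.const_mul _) (Filter.Eventually.of_forall fun η => ?_)
        simp only [norm_mul]
        have i1 := inv_one_add_sq_le_one (ξ - η)
        calc _ ≤ K * ((C' * ((1 + η ^ 2)⁻¹) ^ 4) * (C * ((1 + (ξ - η) ^ 2)⁻¹) ^ 4)) := by
              gcongr
              · exact hK' _ _ _
              · exact h' _ _
              · exact h _ _
          _ = K * C' * C * ((1 + η ^ 2)⁻¹ * (1 + (ξ - η) ^ 2)⁻¹) ^ 3 * (1 + η ^ 2)⁻¹ *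
              (1 + (ξ - η) ^ 2)⁻¹ := by ring
          _ ≤ K * C' * C * (2 * (1 + ξ ^ 2)⁻¹) ^ 3 * (1 + η ^ 2)⁻¹ * 1 := by
              have := pow_le_pow_left₀ (by positivity) (inv_one_add_sq_mul_le ξ η) 3
              gcongr
          _ = _ := by ring
    _ = _ := by rw [integral_const_mul, integral_univ_inv_one_add_sq]; ring

theorem continuous_remSpec {φ : 𝓢(ℝ, ℂ)} (hφ : IsLPfilter φ) {ε : ℝ} (hε : ε = 1 ∨ ε = -1)
    (u v : 𝓢(ℝ × ℝ, ℂ)) (t : ℝ) : Continuous (remSpec φ ε u v t) := by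
  obtain ⟨h1, h2⟩ := FT_remR hφ hε u v t
  rw [show remSpec φ ε u v t = FT _ from funext fun ξ => (h2 ξ).symm]
  exact continuous_fourier_of_integrable h1

/-- The spatial Fourier transform of `∂_x P^+ R(P^± v, P^+ u)`. -/
def outSpec (φ : 𝓢(ℝ, ℂ)) (ε : ℝ) (u v : ℝ × ℝ → ℂ) (t ξ : ℝ) : ℂ :=
  2 * Real.pi * Complex.I * (max ξ 0 : ℝ) * remSpec φ ε u v t ξ

theorem continuous_outSpec {φ : 𝓢(ℝ, ℂ)} (hφ : IsLPfilter φ) {ε : ℝ} (hε : ε = 1 ∨ ε = -1)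
    (u v : 𝓢(ℝ × ℝ, ℂ)) (t : ℝ) : Continuous (outSpec φ ε u v t) := by
  have := continuous_remSpec hφ hε u v t
  unfold outSpec
  fun_prop

theorem abs_mul_inv_one_add_sq_le (ξ : ℝ) : |ξ| * (1 + ξ ^ 2)⁻¹ ≤ 1 := by
  rw [← div_eq_mul_inv, div_le_one (by positivity)]
  nlinarith [sq_abs ξ, sq_nonneg (|ξ| - 1)]

theorem integrable_outSpec {φ : 𝓢(ℝ, ℂ)} (hφ : IsLPfilter φ) {ε : ℝ} (hε : ε = 1 ∨ ε = -1)
    (u v : 𝓢(ℝ × ℝ, ℂ)) (t : ℝ) : Integrable (outSpec φ ε u v t) := by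
  obtain ⟨K, hK, h⟩ := exists_norm_remSpec_le hφ ε u v
  refine (integrable_inv_one_add_sq.const_mul (2 * Real.pi * K)).mono'
    (continuous_outSpec hφ hε u v t).aestronglyMeasurable (Filter.Eventually.of_forall fun ξ => ?_)
  unfold outSpec
  have e : ‖(2 * Real.pi * Complex.I * (max ξ 0 : ℝ) : ℂ)‖ ≤ 2 * Real.pi * |ξ| := by
    simp only [norm_mul, Complex.norm_I, Complex.norm_real, Complex.norm_ofNat, Real.norm_eq_abs,
      abs_of_pos Real.pi_pos, mul_one]
    refine mul_le_mul_of_nonneg_left ?_ (by positivity)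
    rcases le_total ξ 0 with h | h
    · rw [max_eq_right h, abs_zero]; positivity
    · rw [max_eq_left h]
  rw [norm_mul]
  calc _ ≤ 2 * Real.pi * |ξ| * (K * ((1 + ξ ^ 2)⁻¹) ^ 3) := by gcongr; exact h t ξ
    _ = 2 * Real.pi * K * ((|ξ| * (1 + ξ ^ 2)⁻¹) * (1 + ξ ^ 2)⁻¹ * (1 + ξ ^ 2)⁻¹) := by ring
    _ ≤ 2 * Real.pi * K * (1 * 1 * (1 + ξ ^ 2)⁻¹) := by
        gcongr
        · exact abs_mul_inv_one_add_sq_le ξ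
        · exact inv_one_add_sq_le_one ξ
    _ = _ := by ring

theorem dX_Pproj_remR {φ : 𝓢(ℝ, ℂ)} (hφ : IsLPfilter φ) {ε : ℝ} (hε : ε = 1 ∨ ε = -1)
    (u v : 𝓢(ℝ × ℝ, ℂ)) (t x : ℝ) :
    dX (Pproj 1 (remR φ (Pproj ε v) (Pproj 1 u))) (t, x) = FTinv (outSpec φ ε u v t) x := by
  set h : ℝ → ℂ := fun ξ => (if 0 ≤ 1 * ξ then (1 : ℂ) else 0) * remSpec φ ε u v t ξ with hh
  obtain ⟨K, hK, hb⟩ := exists_norm_remSpec_le hφ ε u v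
  have hbase : Integrable (fun ξ : ℝ => (1 + ξ ^ 2)⁻¹) := integrable_inv_one_add_sq
  have hm : AEStronglyMeasurable h := by
    refine AEStronglyMeasurable.mul ?_ (continuous_remSpec hφ hε u v t).aestronglyMeasurable
    exact (Measurable.ite (measurableSet_le measurable_const (by fun_prop))
        measurable_const measurable_const).aestronglyMeasurable
  have hle : ∀ ξ, ‖h ξ‖ ≤ K * ((1 + ξ ^ 2)⁻¹) ^ 3 := fun ξ => by
    refine le_trans ?_ (hb t ξ)
    simp only [hh]
    split_ifs <;> simp
  have hi : Integrable h := by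
    refine (hbase.const_mul K).mono' hm (Filter.Eventually.of_forall fun ξ => (hle ξ).trans ?_)
    gcongr
    exact pow_le_of_le_one (by positivity) (inv_one_add_sq_le_one ξ) (by norm_num)
  have hi' : Integrable (fun ξ => ξ • h ξ) := by
    refine (hbase.const_mul K).mono' (aestronglyMeasurable_id.smul hm)
      (Filter.Eventually.of_forall fun ξ => ?_)
    rw [norm_smul, Real.norm_eq_abs]
    calc |ξ| * ‖h ξ‖ ≤ |ξ| * (K * ((1 + ξ ^ 2)⁻¹) ^ 3) := by gcongr; exact hle ξ
      _ = K * ((|ξ| * (1 + ξ ^ 2)⁻¹) * (1 + ξ ^ 2)⁻¹ * (1 + ξ ^ 2)⁻¹) := by ring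
      _ ≤ K * (1 * 1 * (1 + ξ ^ 2)⁻¹) := by
          gcongr
          · exact abs_mul_inv_one_add_sq_le ξ
          · exact inv_one_add_sq_le_one ξ
      _ = _ := by ring
  have e1 : (fun y => Pproj 1 (remR φ (Pproj ε v) (Pproj 1 u)) (t, y)) =
      fun y => 𝓕 h (-y) := by
    ext y
    rw [← Real.fourierInv_eq_fourier_neg]
    refine congrArg (fun f : ℝ → ℂ => FTinv f y) (funext fun ξ => ?_)
    simp only [hh]
    rw [show remSpec φ ε u v t ξ = _ from ((FT_remR hφ hε u v t).2 ξ).symm]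
  unfold dX
  simp only
  rw [e1, deriv_comp_neg, Real.deriv_fourier hi hi', FTinv_eq_FT_neg]
  unfold FT
  rw [Real.fourier_real_eq_integral_exp_smul, Real.fourier_real_eq_integral_exp_smul,
    ← integral_neg]
  congr 1; ext ξ
  simp only [outSpec, hh, smul_eq_mul, one_mul]
  split_ifs with h0
  · rw [max_eq_left h0]; ring
  · rw [max_eq_right (by linarith)]; simp

theorem FT_dX_Pproj_remR {φ : 𝓢(ℝ, ℂ)} (hφ : IsLPfilter φ) {ε : ℝ} (hε : ε = 1 ∨ ε = -1)
    (u v : 𝓢(ℝ × ℝ, ℂ)) (t ξ : ℝ)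
    (hi : Integrable fun x => dX (Pproj 1 (remR φ (Pproj ε v) (Pproj 1 u))) (t, x)) :
    FT (fun x => dX (Pproj 1 (remR φ (Pproj ε v) (Pproj 1 u))) (t, x)) ξ =
      outSpec φ ε u v t ξ := by
  simp only [dX_Pproj_remR hφ hε] at hi ⊢
  rw [show (fun x => FTinv (outSpec φ ε u v t) x) = FTinv (outSpec φ ε u v t) from rfl,
    FT_FTinv (continuous_outSpec hφ hε u v t) (integrable_outSpec hφ hε u v t) hi]

/-- The frequency pairs seen by the remainder `R(P^± v, P^+ u)`. -/
def comparableSet (ε : ℝ) : Set (ℝ × ℝ) :=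
  {p | 0 ≤ ε * p.1 ∧ 0 ≤ p.2 ∧ 1 ≤ |p.1| ∧ 1 ≤ |p.2| ∧ |p.1| ≤ 8 * |p.2| ∧ |p.2| ≤ 8 * |p.1|}

theorem measurableSet_comparableSet (ε : ℝ) : MeasurableSet (comparableSet ε) := by
  have hc : IsClosed (comparableSet ε) := by
    unfold comparableSet
    simp only [Set.ofPred_and]
    refine IsClosed.inter ?_ (IsClosed.inter ?_ (IsClosed.inter ?_ (IsClosed.inter ?_
      (IsClosed.inter ?_ ?_)))) <;> refine isClosed_le ?_ ?_ <;> fun_prop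
  exact hc.measurableSet

theorem integral_exp_mul_remSpec {φ : 𝓢(ℝ, ℂ)} (hφ : IsLPfilter φ) {ε : ℝ}
    (hε : ε = 1 ∨ ε = -1) (u v : 𝓢(ℝ × ℝ, ℂ)) (τ ξ : ℝ) :
    ∫ t : ℝ, Complex.exp (-(2 * Real.pi * Complex.I) * ((t * τ : ℝ) : ℂ)) *
      remSpec φ ε u v t ξ =
    ∫ η, remSymbol φ ε η (ξ - η) * ∫ σ, FT2 v (σ, η) * FT2 u (τ - σ, ξ - η) := by
  obtain ⟨K, hK, hK'⟩ := exists_norm_remSymbol_le hφ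
  obtain ⟨C, hC, h⟩ := exists_norm_pft_le u
  obtain ⟨C', hC', h'⟩ := exists_norm_pft_le v
  have hbase : Integrable (fun ξ : ℝ => (1 + ξ ^ 2)⁻¹) := integrable_inv_one_add_sq
  have hbd : ∀ t η, ‖pft v t η * pft u t (ξ - η)‖ ≤
      C' * C * ((1 + t ^ 2)⁻¹ * (1 + η ^ 2)⁻¹) := fun t η => by
    have i1 := inv_one_add_sq_le_one t
    have i2 := inv_one_add_sq_le_one η
    have i3 := inv_one_add_sq_le_one (ξ - η)
    rw [norm_mul]
    calc _ ≤ (C' * ((1 + t ^ 2)⁻¹ * ((1 + η ^ 2)⁻¹) ^ 2)) *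
          (C * ((1 + t ^ 2)⁻¹ * ((1 + (ξ - η) ^ 2)⁻¹) ^ 2)) := by
            gcongr
            · exact h' _ _
            · exact h _ _
      _ = C' * C * ((1 + t ^ 2)⁻¹ * (1 + η ^ 2)⁻¹) * ((1 + η ^ 2)⁻¹ * (1 + t ^ 2)⁻¹ *
            ((1 + (ξ - η) ^ 2)⁻¹) ^ 2) := by ring
      _ ≤ C' * C * ((1 + t ^ 2)⁻¹ * (1 + η ^ 2)⁻¹) * (1 * 1 * 1 ^ 2) := by gcongr
      _ = _ := by ring
  have inner : ∀ η, FT (fun t => pft v t η * pft u t (ξ - η)) τ =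
      ∫ σ, FT2 v (σ, η) * FT2 u (τ - σ, ξ - η) := fun η => by
    obtain ⟨g, hg⟩ := exists_schwartz_FT2 u
    obtain ⟨D, hD, hgD⟩ := exists_schwartz_decay g 0 0
    have e : (fun t => pft v t η * pft u t (ξ - η)) = fun t =>
        FTinv (fun τ => FT2 v (τ, η)) t * FTinv (fun τ => FT2 u (τ, ξ - η)) t := by
      ext t; rw [FTinv_FT2, FTinv_FT2]
    rw [e, FT_mul_FTinv (A := fun τ => FT2 v (τ, η)) (B := fun τ => FT2 u (τ, ξ - η))
      ((continuous_FT2 u).comp (f := fun τ => (τ, ξ - η)) (by fun_prop))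
      (integrable_FT2_left v η) (integrable_FT2_left u (ξ - η)) (M := D)]
    · intro x; simpa [hg] using hgD (x, ξ - η)
    · rw [← e]
      refine ((hbase.mul_const ((1 + η ^ 2)⁻¹)).const_mul (C' * C)).mono'
        ((continuous_pft_left v η).mul (continuous_pft_left u _)).aestronglyMeasurable
        (Filter.Eventually.of_forall fun t => hbd t η)
  have hl : ∀ t, Complex.exp (-(2 * Real.pi * Complex.I) * ((t * τ : ℝ) : ℂ)) *
      remSpec φ ε u v t ξ = ∫ η, Complex.exp (-(2 * Real.pi * Complex.I) * ((t * τ : ℝ) : ℂ)) *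
        (remSymbol φ ε η (ξ - η) * (pft v t η * pft u t (ξ - η))) := fun t => by
    rw [remSpec, ← integral_const_mul]
  simp only [hl]
  rw [integral_integral_swap]
  · congr 1; ext η
    rw [← inner η, FT_eq_integral, ← integral_const_mul]
    congr 1; ext t
    ring
  · have hp := hbase.mul_prod hbase
    refine (hp.const_mul (K * (C' * C))).mono' ?_ (Filter.Eventually.of_forall fun p => ?_)
    · have m1 : Measurable fun p : ℝ × ℝ => remSymbol φ ε p.2 (ξ - p.2) :=
        (measurable_remSymbol hφ hε).comp (g := fun p : ℝ × ℝ => remSymbol φ ε p.1 p.2)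
          (f := fun p : ℝ × ℝ => (p.2, ξ - p.2)) (by fun_prop)
      have c1 : Continuous fun p : ℝ × ℝ => pft v p.1 p.2 := continuous_pft v
      have c2 : Continuous fun p : ℝ × ℝ => pft u p.1 (ξ - p.2) :=
        (continuous_pft u).comp (f := fun p : ℝ × ℝ => (p.1, ξ - p.2)) (by fun_prop)
      have c3 : Continuous fun p : ℝ × ℝ =>
        Complex.exp (-(2 * Real.pi * Complex.I) * ((p.1 * τ : ℝ) : ℂ)) := by fun_prop
      exact (c3.measurable.mul (m1.mul (c1.mul c2).measurable)).aestronglyMeasurable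
    · simp only [Function.uncurry]
      rw [norm_mul, norm_exp_neg_two_pi_I_mul, one_mul, norm_mul, mul_assoc K]
      exact mul_le_mul (hK' _ _ _) (hbd _ _) (norm_nonneg _) hK.le

theorem FT2_dX_Pproj_remR {φ : 𝓢(ℝ, ℂ)} (hφ : IsLPfilter φ) {ε : ℝ} (hε : ε = 1 ∨ ε = -1)
    (u v : 𝓢(ℝ × ℝ, ℂ))
    (hi : Integrable (dX (Pproj 1 (remR φ (Pproj ε v) (Pproj 1 u))))) (q : ℝ × ℝ) :
    FT2 (dX (Pproj 1 (remR φ (Pproj ε v) (Pproj 1 u)))) q =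
      2 * Real.pi * Complex.I * (max q.2 0 : ℝ) *
        ∫ η, remSymbol φ ε η (q.2 - η) * ∫ σ, FT2 v (σ, η) * FT2 u (q.1 - σ, q.2 - η) := by
  set w := dX (Pproj 1 (remR φ (Pproj ε v) (Pproj 1 u))) with hw
  have h1 : FT2 w q = ∫ t : ℝ, Complex.exp (-(2 * Real.pi * Complex.I) * ((t * q.1 : ℝ) : ℂ)) *
      FT (fun x => w (t, x)) q.2 := by
    unfold FT2
    rw [Measure.volume_eq_prod, integral_prod]
    · congr 1; ext t
      rw [FT_eq_integral, ← integral_const_mul]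
      congr 1; ext y
      rw [← mul_assoc, ← Complex.exp_add]
      congr 2
      push_cast; ring
    · refine Integrable.bdd_mul (c := 1) hi (Continuous.aestronglyMeasurable (by fun_prop)) ?_
      filter_upwards with p using (norm_exp_neg_two_pi_I_mul _).le
  have h2 : ∀ᵐ t : ℝ, Integrable (fun x => w (t, x)) := by
    rw [Measure.volume_eq_prod] at hi
    exact hi.prod_right_ae
  rw [h1, ← integral_exp_mul_remSpec hφ hε, ← integral_const_mul]
  refine integral_congr_ae ?_
  filter_upwards [h2] with t ht
  rw [hw, FT_dX_Pproj_remR hφ hε u v t q.2 ht, outSpec]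
  ring

theorem exists_enorm_FT2_dX_le {φ : 𝓢(ℝ, ℂ)} (hφ : IsLPfilter φ) {ε : ℝ}
    (hε : ε = 1 ∨ ε = -1) : ∃ K : ℝ, 0 < K ∧ ∀ (u v : 𝓢(ℝ × ℝ, ℂ)) (q : ℝ × ℝ),
      ‖FT2 (dX (Pproj 1 (remR φ (Pproj ε v) (Pproj 1 u)))) q‖ₑ ≤
        ENNReal.ofReal K * ENNReal.ofReal q.2 *
          ∫⁻ r : ℝ × ℝ, (comparableSet ε).indicator 1 (r.2, q.2 - r.2) *
            (‖FT2 v r‖ₑ * ‖FT2 u (q - r)‖ₑ) := by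
  obtain ⟨K, hK, hK'⟩ := exists_norm_remSymbol_le hφ
  refine ⟨2 * Real.pi * K, by positivity, fun u v q => ?_⟩
  by_cases hi : Integrable (dX (Pproj 1 (remR φ (Pproj ε v) (Pproj 1 u))))
  swap
  · rw [FT2_of_not_integrable hi]; simp
  rw [FT2_dX_Pproj_remR hφ hε u v hi, enorm_mul]
  have cu := continuous_FT2 u
  have cv := continuous_FT2 v
  have e1 : ‖(2 * Real.pi * Complex.I * (max q.2 0 : ℝ) : ℂ)‖ₑ =
      ENNReal.ofReal (2 * Real.pi) * ENNReal.ofReal q.2 := by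
    rw [← ofReal_norm, ← ENNReal.ofReal_mul (by positivity)]
    simp only [norm_mul, Complex.norm_I, Complex.norm_real, Complex.norm_ofNat, Real.norm_eq_abs,
      abs_of_pos Real.pi_pos, mul_one, abs_of_nonneg (le_max_right q.2 0)]
    rcases le_total q.2 0 with h | h
    · rw [max_eq_right h, mul_zero, ENNReal.ofReal_zero, ENNReal.ofReal_of_nonpos]
      exact mul_nonpos_of_nonneg_of_nonpos (by positivity) h
    · rw [max_eq_left h]
  have e2 : ∀ η, ‖remSymbol φ ε η (q.2 - η)‖ₑ ≤
      ENNReal.ofReal K * (comparableSet ε).indicator 1 (η, q.2 - η) := fun η => by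
    by_cases h0 : remSymbol φ ε η (q.2 - η) = 0
    · rw [h0]; simp
    · rw [Set.indicator_of_mem (show (η, q.2 - η) ∈ comparableSet ε from remSymbol_support hφ h0),
        Pi.one_apply, mul_one, ← ofReal_norm]
      exact ENNReal.ofReal_le_ofReal (hK' _ _ _)
  have mF : Measurable fun r : ℝ × ℝ => (comparableSet ε).indicator (1 : ℝ × ℝ → ℝ≥0∞)
      (r.2, q.2 - r.2) * (‖FT2 v r‖ₑ * ‖FT2 u (q - r)‖ₑ) := by
    refine Measurable.mul ?_ ((cv.measurable.enorm).mul
      (cu.comp (continuous_const.sub continuous_id)).measurable.enorm)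
    exact ((measurable_const (a := (1 : ℝ≥0∞))).indicator (measurableSet_comparableSet ε)).comp
      (f := fun r : ℝ × ℝ => (r.2, q.2 - r.2)) (by fun_prop)
  rw [e1]
  have e3 : ‖∫ η, remSymbol φ ε η (q.2 - η) * ∫ σ, FT2 v (σ, η) * FT2 u (q.1 - σ, q.2 - η)‖ₑ ≤
      ENNReal.ofReal K * ∫⁻ r : ℝ × ℝ, (comparableSet ε).indicator 1 (r.2, q.2 - r.2) *
            (‖FT2 v r‖ₑ * ‖FT2 u (q - r)‖ₑ) := by
    rw [Measure.volume_eq_prod, lintegral_prod_symm _ mF.aemeasurable,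
      ← lintegral_const_mul' _ _ ENNReal.ofReal_ne_top]
    refine (enorm_integral_le_lintegral_enorm _).trans (lintegral_mono fun η => ?_)
    simp only
    rw [enorm_mul, lintegral_const_mul', ← mul_assoc]
    · refine mul_le_mul' (e2 η) ((enorm_integral_le_lintegral_enorm _).trans
        (lintegral_mono fun σ => ?_))
      rw [enorm_mul]; rfl
    · by_cases h0 : (η, q.2 - η) ∈ comparableSet ε <;> simp [h0]
  refine (mul_le_mul_right e3 _).trans (le_of_eq ?_)
  rw [ENNReal.ofReal_mul (show 0 ≤ 2 * Real.pi by positivity)]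
  ring

theorem lintegral_mul_sq_le {α : Type*} [MeasurableSpace α] {μ : Measure α} {f g : α → ℝ≥0∞}
    (hf : AEMeasurable f μ) (hg : AEMeasurable g μ) :
    (∫⁻ x, f x * g x ∂μ) ^ 2 ≤ (∫⁻ x, f x ^ 2 ∂μ) * ∫⁻ x, g x ^ 2 ∂μ := by
  have h := ENNReal.lintegral_mul_le_Lp_mul_Lq μ Real.HolderConjugate.two_two hf hg
  have h2 := pow_le_pow_left' h 2
  have e : ∀ y : ℝ≥0∞, (y ^ (1 / (2 : ℝ))) ^ 2 = y := fun y => by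
    rw [← ENNReal.rpow_natCast, ← ENNReal.rpow_mul]; norm_num
  rw [mul_pow, e, e] at h2
  simpa [Pi.mul_apply] using h2

theorem lintegral_mul_sq_lintegral_indicator_le {α β : Type*} [MeasurableSpace α]
    [MeasurableSpace β] {μ : Measure α} {ν : Measure β} {F : α × β → ℝ≥0∞}
    (hF : Measurable F) {S : Set (α × β)} (hS : MeasurableSet S) {ω : α → ℝ≥0∞}
    {c : ℝ≥0∞} (hc : c ≠ ∞) (h : ∀ x, ω x * ν {y | (x, y) ∈ S} ≤ c) :
    ∫⁻ x, ω x * (∫⁻ y, S.indicator 1 (x, y) * F (x, y) ∂ν) ^ 2 ∂μ ≤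
      c * ∫⁻ x, ∫⁻ y, F (x, y) ^ 2 ∂ν ∂μ := by
  rw [← lintegral_const_mul' _ _ hc]
  refine lintegral_mono fun x => ?_
  have m1 : Measurable fun y => S.indicator (1 : α × β → ℝ≥0∞) (x, y) :=
    (measurable_one.indicator hS).comp measurable_prodMk_left
  have e : ∫⁻ y, S.indicator (1 : α × β → ℝ≥0∞) (x, y) ^ 2 ∂ν = ν {y | (x, y) ∈ S} := by
    refine Eq.trans ?_ (lintegral_indicator_one (μ := ν) (measurable_prodMk_left (x := x) hS))
    congr 1; ext y
    by_cases hy : (x, y) ∈ S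
    · rw [Set.indicator_of_mem hy, Set.indicator_of_mem (show y ∈ {y | (x, y) ∈ S} from hy)]; simp
    · rw [Set.indicator_of_notMem hy,
        Set.indicator_of_notMem (show y ∉ {y | (x, y) ∈ S} from hy)]; simp
  have h1 := lintegral_mul_sq_le (μ := ν) m1.aemeasurable
    (hF.comp (measurable_prodMk_left (x := x))).aemeasurable
  rw [e] at h1
  calc _ ≤ ω x * (ν {y | (x, y) ∈ S} * ∫⁻ y, F (x, y) ^ 2 ∂ν) := by gcongr; exact h1
    _ = (ω x * ν {y | (x, y) ∈ S}) * ∫⁻ y, F (x, y) ^ 2 ∂ν := by ring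
    _ ≤ _ := by gcongr; exact h x

/-- Restriction to `S` of the convolution of `V` and `U`. -/
def restrictedConv (S : Set ((ℝ × ℝ) × (ℝ × ℝ))) (V U : ℝ × ℝ → ℝ≥0∞) (q : ℝ × ℝ) : ℝ≥0∞ :=
  ∫⁻ r, S.indicator 1 (q, r) * (V r * U (q - r))

section restrictedConv

variable {S : Set ((ℝ × ℝ) × (ℝ × ℝ))} {V U : ℝ × ℝ → ℝ≥0∞}

theorem measurable_restrictedConv (hS : MeasurableSet S) (hV : Measurable V) (hU : Measurable U) :
    Measurable (restrictedConv S V U) := by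
  unfold restrictedConv
  refine Measurable.lintegral_prod_right' (f := fun p : (ℝ × ℝ) × (ℝ × ℝ) =>
    S.indicator 1 p * (V p.2 * U (p.1 - p.2))) ?_
  exact (measurable_one.indicator hS).mul ((hV.comp measurable_snd).mul
    (hU.comp (measurable_fst.sub measurable_snd)))

theorem restrictedConv_swap (q : ℝ × ℝ) :
    restrictedConv S V U q = restrictedConv {p | (p.1, p.1 - p.2) ∈ S} U V q := by
  unfold restrictedConv
  rw [← lintegral_sub_left_eq_self _ q]
  congr 1; ext r
  rw [sub_sub_cancel, mul_comm (V _)]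
  by_cases hr : (q, q - r) ∈ S
  · rw [Set.indicator_of_mem hr, Set.indicator_of_mem (by exact hr)]; rfl
  · rw [Set.indicator_of_notMem hr, Set.indicator_of_notMem (by exact hr)]

theorem lintegral_lintegral_conv_sq (hV : Measurable V) (hU : Measurable U) :
    ∫⁻ q : ℝ × ℝ, ∫⁻ r : ℝ × ℝ, (V r * U (q - r)) ^ 2 = (∫⁻ r, V r ^ 2) * ∫⁻ r, U r ^ 2 := by
  rw [lintegral_lintegral_swap]
  · simp only [mul_pow]
    have : ∀ r : ℝ × ℝ, ∫⁻ q, V r ^ 2 * U (q - r) ^ 2 = V r ^ 2 * ∫⁻ q, U q ^ 2 := fun r => by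
      rw [lintegral_const_mul _ (by fun_prop), lintegral_sub_right_eq_self (fun q => U q ^ 2)]
    simp only [this]
    rw [lintegral_mul_const _ (by fun_prop)]
  · have : Measurable fun p : (ℝ × ℝ) × (ℝ × ℝ) => (V p.2 * U (p.1 - p.2)) ^ 2 :=
      ((hV.comp measurable_snd).mul (hU.comp (measurable_fst.sub measurable_snd))).pow_const 2
    exact this.aemeasurable

theorem lintegral_mul_restrictedConv_sq_le (hS : MeasurableSet S) (hV : Measurable V)
    (hU : Measurable U) {ω : ℝ × ℝ → ℝ≥0∞} {c : ℝ≥0∞} (hc : c ≠ ∞)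
    (h : ∀ q, ω q * volume {r | (q, r) ∈ S} ≤ c) :
    ∫⁻ q, ω q * restrictedConv S V U q ^ 2 ≤ c * ((∫⁻ r, V r ^ 2) * ∫⁻ r, U r ^ 2) := by
  rw [← lintegral_lintegral_conv_sq hV hU]
  exact lintegral_mul_sq_lintegral_indicator_le (μ := (volume : Measure (ℝ × ℝ)))
    (ν := (volume : Measure (ℝ × ℝ))) (F := fun p => V p.2 * U (p.1 - p.2))
    ((hV.comp measurable_snd).mul (hU.comp (measurable_fst.sub measurable_snd))) hS hc h

theorem lintegral_restrictedConv_sq_le_of_fst (hS : MeasurableSet S) (hV : Measurable V)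
    (hU : Measurable U) (hVs : volume (Function.support V) ≠ ∞) (hV2 : ∫⁻ r, V r ^ 2 ≠ ∞)
    (hU2 : ∫⁻ r, U r ^ 2 ≠ ∞) {c : ℝ≥0∞} (hc : c ≠ ∞)
    (h : ∀ r, volume {q | (q, r) ∈ S} ≤ c) :
    ∫⁻ q, restrictedConv S V U q ^ 2 ≤ c * ((∫⁻ r, V r ^ 2) * ∫⁻ r, U r ^ 2) := by
  have mG := measurable_restrictedConv hS hV hU
  set G := restrictedConv S V U with hG
  have fin : ∫⁻ q, G q ^ 2 ≠ ∞ := by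
    have hS' : MeasurableSet (S ∩ Prod.snd ⁻¹' Function.support V) :=
      hS.inter (measurable_snd (measurableSet_support hV))
    have h1 := lintegral_mul_restrictedConv_sq_le (ω := 1) hS' hV hU hVs (fun q => by
      rw [Pi.one_apply, one_mul]
      exact measure_mono fun r hr => hr.2)
    have h2 : ∀ q, G q = restrictedConv (S ∩ Prod.snd ⁻¹' Function.support V) V U q := fun q => by
      rw [hG]; unfold restrictedConv
      congr 1; ext r
      by_cases hr : V r = 0
      · simp [hr]
      · by_cases hs : (q, r) ∈ S
        · rw [Set.indicator_of_mem hs, Set.indicator_of_mem (by exact ⟨hs, hr⟩)]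
        · rw [Set.indicator_of_notMem hs, Set.indicator_of_notMem (fun h => hs h.1)]
    simp only [Pi.one_apply, one_mul, ← h2] at h1
    exact ne_top_of_le_ne_top (ENNReal.mul_ne_top hVs (ENNReal.mul_ne_top hV2 hU2)) h1
  have key : (∫⁻ q, G q ^ 2) ^ 2 ≤
      (∫⁻ r, V r ^ 2) * (c * ((∫⁻ q, G q ^ 2) * ∫⁻ r, U r ^ 2)) := by
    have mI : Measurable fun p : (ℝ × ℝ) × (ℝ × ℝ) =>
        S.indicator (1 : (ℝ × ℝ) × (ℝ × ℝ) → ℝ≥0∞) p :=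
      measurable_one.indicator hS
    have mF : Measurable fun p : (ℝ × ℝ) × (ℝ × ℝ) => G p.2 * U (p.2 - p.1) :=
      (mG.comp measurable_snd).mul (hU.comp (measurable_snd.sub measurable_fst))
    have hS' : MeasurableSet (Prod.swap ⁻¹' S : Set ((ℝ × ℝ) × (ℝ × ℝ))) := measurable_swap hS
    have mI' : Measurable fun p : (ℝ × ℝ) × (ℝ × ℝ) =>
        (Prod.swap ⁻¹' S : Set ((ℝ × ℝ) × (ℝ × ℝ))).indicator (1 : (ℝ × ℝ) × (ℝ × ℝ) → ℝ≥0∞) p :=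
      measurable_one.indicator hS'
    have e : ∫⁻ q, G q ^ 2 = ∫⁻ r, V r * ∫⁻ q, (Prod.swap ⁻¹' S :
        Set ((ℝ × ℝ) × (ℝ × ℝ))).indicator 1 (r, q) * (G q * U (q - r)) := by
      have e1 : ∀ q, G q ^ 2 = ∫⁻ r, G q * (S.indicator 1 (q, r) * (V r * U (q - r))) :=
        fun q => by
        rw [lintegral_const_mul, sq]
        · rfl
        · exact (mI.comp measurable_prodMk_left).mul (hV.mul
            (hU.comp (measurable_const.sub measurable_id)))
      simp only [e1]
      rw [lintegral_lintegral_swap]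
      · congr 1; ext r
        rw [← lintegral_const_mul]
        · congr 1; ext q
          have : (Prod.swap ⁻¹' S : Set ((ℝ × ℝ) × (ℝ × ℝ))).indicator (1 : (ℝ × ℝ) × (ℝ × ℝ) → ℝ≥0∞) (r, q) =
            S.indicator (1 : (ℝ × ℝ) × (ℝ × ℝ) → ℝ≥0∞) (q, r) := rfl
          rw [this]; ring
        · exact (mI'.comp measurable_prodMk_left).mul (mF.comp measurable_prodMk_left)
      · exact ((mG.comp measurable_fst).mul (mI.mul ((hV.comp measurable_snd).mul
          (hU.comp (measurable_fst.sub measurable_snd))))).aemeasurable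
    have mK : Measurable fun r => ∫⁻ q, (Prod.swap ⁻¹' S :
        Set ((ℝ × ℝ) × (ℝ × ℝ))).indicator (1 : (ℝ × ℝ) × (ℝ × ℝ) → ℝ≥0∞) (r, q) * (G q * U (q - r)) :=
      (mI'.mul mF).lintegral_prod_right'
    have h1 := lintegral_mul_sq_le (μ := volume) hV.aemeasurable mK.aemeasurable
    rw [← e] at h1
    refine h1.trans ?_
    gcongr
    have h2 := lintegral_mul_sq_lintegral_indicator_le (μ := (volume : Measure (ℝ × ℝ)))
      (ν := (volume : Measure (ℝ × ℝ))) (ω := 1) mF hS' hc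
      (fun r => by rw [Pi.one_apply, one_mul]; exact h r)
    simp only [Pi.one_apply, one_mul] at h2
    refine h2.trans ?_
    gcongr
    rw [lintegral_lintegral_swap (by exact (mF.pow_const 2).aemeasurable)]
    have : ∀ q : ℝ × ℝ, ∫⁻ r, (G q * U (q - r)) ^ 2 = G q ^ 2 * ∫⁻ r, U r ^ 2 := fun q => by
      simp only [mul_pow]
      rw [lintegral_const_mul _ (by fun_prop), lintegral_sub_left_eq_self (fun q => U q ^ 2)]
    simp only [this]
    rw [lintegral_mul_const _ (by fun_prop)]
  generalize (∫⁻ q, G q ^ 2) = x at fin key ⊢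
  rcases eq_or_ne x 0 with h0 | h0
  · rw [h0]; exact zero_le
  · rw [sq] at key
    refine (ENNReal.mul_le_mul_iff_left h0 fin).1 (key.trans (le_of_eq ?_))
    ring

theorem lintegral_restrictedConv_sq_le_of_snd (hS : MeasurableSet S) (hV : Measurable V)
    (hU : Measurable U) (hUs : volume (Function.support U) ≠ ∞) (hV2 : ∫⁻ r, V r ^ 2 ≠ ∞)
    (hU2 : ∫⁻ r, U r ^ 2 ≠ ∞) {c : ℝ≥0∞} (hc : c ≠ ∞)
    (h : ∀ r, volume {q | (q, q - r) ∈ S} ≤ c) :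
    ∫⁻ q, restrictedConv S V U q ^ 2 ≤ c * ((∫⁻ r, V r ^ 2) * ∫⁻ r, U r ^ 2) := by
  simp only [restrictedConv_swap (S := S)]
  rw [mul_comm (∫⁻ r, V r ^ 2)]
  refine lintegral_restrictedConv_sq_le_of_fst ?_ hU hV hUs hU2 hV2 hc h
  exact (measurable_fst.prodMk (measurable_fst.sub measurable_snd)) hS

end restrictedConv

theorem volume_tube_inter_le {c d : ℝ → ℝ} (hc : Continuous c) (hd : Continuous d) {J : Set ℝ}
    (hJ : MeasurableSet J) (A B : ℝ) :
    volume {p : ℝ × ℝ | p.2 ∈ J ∧ |p.1 - c p.2| ≤ A ∧ |p.1 - d p.2| ≤ B} ≤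
      ENNReal.ofReal (2 * min A B) * volume {x | x ∈ J ∧ |c x - d x| ≤ A + B} := by
  have mS : MeasurableSet {p : ℝ × ℝ | p.2 ∈ J ∧ |p.1 - c p.2| ≤ A ∧ |p.1 - d p.2| ≤ B} := by
    refine (measurable_snd hJ).inter (MeasurableSet.inter ?_ ?_)
    · exact (isClosed_le (f := fun p : ℝ × ℝ => |p.1 - c p.2|) (by fun_prop)
        continuous_const).measurableSet
    · exact (isClosed_le (f := fun p : ℝ × ℝ => |p.1 - d p.2|) (by fun_prop)
        continuous_const).measurableSet
  have mT : MeasurableSet {x | x ∈ J ∧ |c x - d x| ≤ A + B} :=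
    hJ.inter (isClosed_le (f := fun x => |c x - d x|) (by fun_prop) continuous_const).measurableSet
  rw [Measure.volume_eq_prod, Measure.prod_apply_symm mS, ← lintegral_indicator_one mT,
    ← lintegral_const_mul' _ _ ENNReal.ofReal_ne_top]
  refine lintegral_mono fun x => ?_
  by_cases hx : x ∈ {x | x ∈ J ∧ |c x - d x| ≤ A + B}
  · rw [Set.indicator_of_mem hx, Pi.one_apply, mul_one]
    rcases le_total A B with h | h
    · rw [min_eq_left h, ← Real.volume_closedBall (c x)]
      refine measure_mono fun t ht => ?_
      rw [Metric.mem_closedBall, Real.dist_eq]; exact ht.2.1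
    · rw [min_eq_right h, ← Real.volume_closedBall (d x)]
      refine measure_mono fun t ht => ?_
      rw [Metric.mem_closedBall, Real.dist_eq]; exact ht.2.2
  · rw [Set.indicator_of_notMem hx, mul_zero, nonpos_iff_eq_zero]
    convert measure_empty (μ := (volume : Measure ℝ))
    ext t
    simp only [Set.mem_preimage, Set.mem_ofPred_eq, Set.mem_empty_iff_false, iff_false]
    rintro ⟨h1, h2, h3⟩
    refine hx ⟨h1, ?_⟩
    calc |c x - d x| = |(t - d x) - (t - c x)| := by ring_nf
      _ ≤ |t - d x| + |t - c x| := abs_sub _ _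
      _ ≤ A + B := by linarith

theorem volume_abs_linear_le {β : ℝ} (hβ : β ≠ 0) (γ M : ℝ) :
    volume {x : ℝ | |β * x + γ| ≤ M} ≤ ENNReal.ofReal (2 * (M / |β|)) := by
  rw [← Real.volume_closedBall (-γ / β)]
  refine measure_mono fun x hx => ?_
  rw [Metric.mem_closedBall, Real.dist_eq, le_div_iff₀ (abs_pos.2 hβ), ← abs_mul]
  have : (x - -γ / β) * β = β * x + γ := by field_simp; ring
  rw [this]; exact hx

theorem volume_abs_quadratic_le (β γ M : ℝ) :
    volume {x : ℝ | |2 * x ^ 2 + β * x + γ| ≤ M} ≤ ENNReal.ofReal (2 * √M) := by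
  have key : ∀ e : ℝ, (e = 1 ∨ e = -1) →
      volume {x : ℝ | |2 * x ^ 2 + β * x + γ| ≤ M ∧ 0 ≤ e * (x + β / 4)} ≤
        ENNReal.ofReal √M := fun e he => by
    refine (Real.volume_le_diam _).trans (Metric.ediam_le fun x hx y hy => ?_)
    rw [edist_dist, Real.dist_eq]
    refine ENNReal.ofReal_le_ofReal (Real.le_sqrt_of_sq_le ?_)
    have hx1 := abs_le.1 hx.1
    have hy1 := abs_le.1 hy.1
    have hx2 := hx.2
    have hy2 := hy.2
    rw [sq_abs]
    rcases he with rfl | rfl <;> rcases le_total x y with h | h <;> nlinarith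
  have hsub : {x : ℝ | |2 * x ^ 2 + β * x + γ| ≤ M} ⊆
      {x : ℝ | |2 * x ^ 2 + β * x + γ| ≤ M ∧ 0 ≤ 1 * (x + β / 4)} ∪
      {x : ℝ | |2 * x ^ 2 + β * x + γ| ≤ M ∧ 0 ≤ (-1) * (x + β / 4)} := fun x hx => by
    rcases le_total 0 (x + β / 4) with h | h
    · exact Or.inl ⟨hx, by linarith⟩
    · exact Or.inr ⟨hx, by linarith⟩
  refine (measure_mono hsub).trans ((measure_union_le _ _).trans ?_)
  rw [two_mul, ENNReal.ofReal_add (Real.sqrt_nonneg _) (Real.sqrt_nonneg _)]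
  exact add_le_add (key 1 (Or.inl rfl)) (key (-1) (Or.inr rfl))

theorem volume_abs_sq_sub_sq_le {e : ℝ} (he : e = 1 ∨ e = -1) {p : ℝ} (hp : p ≠ 0) (γ : ℝ)
    {M : ℝ} (hM : 0 ≤ M) :
    volume {x : ℝ | x ∈ Set.Icc 0 (9 * |p|) ∧ |x ^ 2 - (γ + e * (x - p) ^ 2)| ≤ M} ≤
      ENNReal.ofReal (3 * √M) := by
  rcases he with rfl | rfl
  · have hp' := abs_pos.2 hp
    rcases le_total (9 * |p|) (3 * √M) with h | h
    · calc _ ≤ volume (Set.Icc 0 (9 * |p|)) := measure_mono fun x hx => hx.1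
        _ ≤ _ := by
          rw [Real.volume_Icc, sub_zero]; exact ENNReal.ofReal_le_ofReal h
    · have h1 := volume_abs_linear_le (β := 2 * p) (by simpa using hp) (-γ - p ^ 2) M
      refine (measure_mono fun x hx => ?_).trans (h1.trans (ENNReal.ofReal_le_ofReal ?_))
      · have := hx.2
        rw [Set.mem_ofPred_eq]
        convert this using 2; ring
      · rw [abs_mul, abs_two]
        have hs := Real.sq_sqrt hM
        have hs0 := Real.sqrt_nonneg M
        rw [show 2 * (M / (2 * |p|)) = M / |p| by field_simp, div_le_iff₀ hp']
        nlinarith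
  · have h1 := volume_abs_quadratic_le (-2 * p) (p ^ 2 - γ) M
    refine (measure_mono fun x hx => ?_).trans (h1.trans (ENNReal.ofReal_le_ofReal ?_))
    · have := hx.2
      rw [Set.mem_ofPred_eq]
      convert this using 2; ring
    · have hs0 := Real.sqrt_nonneg M
      linarith

theorem min_mul_sqrt_add_le {A B : ℝ} (hA : 0 ≤ A) (hB : 0 ≤ B) :
    min A B * √(A + B) ≤ 2 * (B * √A) := by
  have key : ∀ x y : ℝ, 0 ≤ x → x ≤ y → √(x + y) ≤ 2 * √y := fun x y hx h => by
    rw [show 2 * √y = √(2 ^ 2 * y) by rw [Real.sqrt_mul (by norm_num), Real.sqrt_sq (by norm_num)]]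
    exact Real.sqrt_le_sqrt (by linarith)
  rcases le_total A B with h | h
  · rw [min_eq_left h]
    have h1 := key A B hA h
    have h2 : √A * √A = A := Real.mul_self_sqrt hA
    have h3 : √B * √B = B := Real.mul_self_sqrt hB
    have h4 := Real.sqrt_le_sqrt h
    calc A * √(A + B) ≤ A * (2 * √B) := by gcongr
      _ = 2 * (√A * √A * √B) := by rw [h2]; ring
      _ ≤ 2 * (√A * √B * √B) := by gcongr
      _ = 2 * ((√B * √B) * √A) := by ring
      _ = _ := by rw [h3]
  · rw [min_eq_right h]
    have h1 := key B A hB h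
    rw [add_comm B A] at h1
    calc B * √(A + B) ≤ B * (2 * √A) := by gcongr
      _ = _ := by ring

theorem volume_output_slice_le {e : ℝ} (he : e = 1 ∨ e = -1) {r : ℝ × ℝ} (hr : r.2 ≠ 0)
    {A B : ℝ} (hA : 0 ≤ A) (hB : 0 ≤ B) :
    volume {q : ℝ × ℝ | q.2 ∈ Set.Icc 0 (9 * |r.2|) ∧ |q.1 - q.2 ^ 2| ≤ A ∧
      |q.1 - (r.1 + e * (q.2 - r.2) ^ 2)| ≤ B} ≤ ENNReal.ofReal (12 * (B * √A)) := by
  refine (volume_tube_inter_le (c := fun x => x ^ 2) (d := fun x => r.1 + e * (x - r.2) ^ 2)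
    (by fun_prop) (by fun_prop) measurableSet_Icc A B).trans ?_
  refine (mul_le_mul_right (volume_abs_sq_sub_sq_le he hr r.1 (add_nonneg hA hB)) _).trans ?_
  rw [← ENNReal.ofReal_mul (by positivity)]
  refine ENNReal.ofReal_le_ofReal ?_
  have := min_mul_sqrt_add_le hA hB
  nlinarith

theorem volume_input_slice_le (q : ℝ × ℝ) {A B : ℝ} (hA : 0 ≤ A) (hB : 0 ≤ B) :
    volume {r : ℝ × ℝ | |r.1 - r.2 ^ 2| ≤ A ∧ |r.1 - (q.1 - (q.2 - r.2) ^ 2)| ≤ B} ≤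
      ENNReal.ofReal (8 * (B * √A)) := by
  have h1 := volume_tube_inter_le (c := fun x => x ^ 2) (d := fun x => q.1 - (q.2 - x) ^ 2)
    (by fun_prop) (by fun_prop) MeasurableSet.univ A B
  simp only [Set.mem_univ, true_and] at h1
  refine h1.trans ?_
  have h2 := volume_abs_quadratic_le (-2 * q.2) (q.2 ^ 2 - q.1) (A + B)
  refine (mul_le_mul_right ((measure_mono fun x hx => ?_).trans h2) _).trans ?_
  · rw [Set.mem_ofPred_eq] at hx ⊢
    convert hx using 2; ring
  · rw [← ENNReal.ofReal_mul (by positivity)]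
    refine ENNReal.ofReal_le_ofReal ?_
    have := min_mul_sqrt_add_le hA hB
    nlinarith

theorem mul_volume_input_slice_le (q : ℝ × ℝ) {A B : ℝ} (hA : 0 ≤ A) (hB : 0 ≤ B) :
    ENNReal.ofReal q.2 * volume {r : ℝ × ℝ | |r.1 - (-1) * r.2 ^ 2| ≤ A ∧
      |r.1 - (q.1 - (q.2 - r.2) ^ 2)| ≤ B} ≤ ENNReal.ofReal (4 * (A * B)) := by
  rcases le_or_gt q.2 0 with h0 | h0
  · rw [ENNReal.ofReal_of_nonpos h0, zero_mul]; exact zero_le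
  have h1 := volume_tube_inter_le (c := fun x => (-1) * x ^ 2) (d := fun x => q.1 - (q.2 - x) ^ 2)
    (by fun_prop) (by fun_prop) MeasurableSet.univ A B
  simp only [Set.mem_univ, true_and] at h1
  have h2 := volume_abs_linear_le (β := -2 * q.2) (by simpa using h0.ne') (q.2 ^ 2 - q.1) (A + B)
  refine (mul_le_mul_right (h1.trans (mul_le_mul_right
    ((measure_mono fun x hx => ?_).trans h2) _)) _).trans ?_
  · rw [Set.mem_ofPred_eq] at hx ⊢
    convert hx using 2; ring
  · rw [← ENNReal.ofReal_mul (by positivity), ← ENNReal.ofReal_mul h0.le]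
    refine ENNReal.ofReal_le_ofReal ?_
    rw [abs_mul, abs_neg, abs_two, abs_of_pos h0]
    have : q.2 * (2 * min A B * (2 * ((A + B) / (2 * q.2)))) = 2 * (min A B * (A + B)) := by
      field_simp
    rw [this]
    rcases le_total A B with h | h
    · rw [min_eq_left h]; nlinarith
    · rw [min_eq_right h]; nlinarith

theorem volume_tube_le {d : ℝ → ℝ} (hd : Continuous d) {B : ℝ} (hB : 0 ≤ B) (x y : ℝ) :
    volume {q : ℝ × ℝ | q.2 ∈ Set.Icc x y ∧ |q.1 - d q.2| ≤ B} ≤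
      ENNReal.ofReal (2 * (B * (y - x))) := by
  have h1 := volume_tube_inter_le hd hd (measurableSet_Icc (a := x) (b := y)) B B
  simp only [and_self, min_self] at h1
  refine h1.trans ((mul_le_mul_right (measure_mono fun x hx => hx.1) _).trans ?_)
  rw [Real.volume_Icc, ← ENNReal.ofReal_mul (by positivity), mul_assoc]

/-- The space–time frequencies of the block `Δ^ε_{m-1,n-1}`. -/
def blockSet (ε : ℝ) (m n : ℕ) : Set (ℝ × ℝ) :=
  {q | 0 ≤ ε * q.2 ∧ |q.2| ≤ 2 ^ (m + 1) ∧ (m = 0 ∨ 2 ^ m ≤ 2 * |q.2|) ∧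
    |q.1 - ε * q.2 ^ 2| ≤ 2 ^ (n + 1)}

theorem measurableSet_blockSet (ε : ℝ) (m n : ℕ) : MeasurableSet (blockSet ε m n) := by
  refine MeasurableSet.inter ?_ (MeasurableSet.inter ?_ (MeasurableSet.inter ?_ ?_))
  · exact (isClosed_le (f := fun _ : ℝ × ℝ => (0 : ℝ)) (g := fun q => ε * q.2) (by fun_prop)
      (by fun_prop)).measurableSet
  · exact (isClosed_le (f := fun q : ℝ × ℝ => |q.2|) (g := fun _ => 2 ^ (m + 1)) (by fun_prop)
      (by fun_prop)).measurableSet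
  · refine (MeasurableSet.const (m = 0)).union ?_
    exact (isClosed_le (f := fun _ : ℝ × ℝ => (2 : ℝ) ^ m) (g := fun q => 2 * |q.2|)
      (by fun_prop) (by fun_prop)).measurableSet
  · exact (isClosed_le (f := fun q : ℝ × ℝ => |q.1 - ε * q.2 ^ 2|) (g := fun _ => 2 ^ (n + 1))
      (by fun_prop) (by fun_prop)).measurableSet

theorem volume_blockSet_ne_top (ε : ℝ) (m n : ℕ) : volume (blockSet ε m n) ≠ ∞ := by
  have h := volume_tube_le (d := fun x => ε * x ^ 2) (by fun_prop)
    (show (0 : ℝ) ≤ 2 ^ (n + 1) by positivity) (-(2 ^ (m + 1))) (2 ^ (m + 1))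
  refine ne_top_of_le_ne_top ENNReal.ofReal_ne_top (le_trans (measure_mono ?_) h)
  exact fun q hq => ⟨abs_le.1 hq.2.1, hq.2.2.2⟩

/-- The interactions between an input block `(a, n₁)` of sign `ε`, an input block `(b, n₂)` of
sign `1` and an output block `(m, n)`. -/
def triSet (ε : ℝ) (m n a n₁ b n₂ : ℕ) : Set ((ℝ × ℝ) × (ℝ × ℝ)) :=
  {p | p.1 ∈ blockSet 1 m n ∧ p.2 ∈ blockSet ε a n₁ ∧ p.1 - p.2 ∈ blockSet 1 b n₂ ∧
    (p.2.2, p.1.2 - p.2.2) ∈ comparableSet ε}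

theorem measurableSet_triSet (ε : ℝ) (m n a n₁ b n₂ : ℕ) :
    MeasurableSet (triSet ε m n a n₁ b n₂) := by
  refine MeasurableSet.inter ?_ (MeasurableSet.inter ?_ (MeasurableSet.inter ?_ ?_))
  · exact measurable_fst (measurableSet_blockSet 1 m n)
  · exact measurable_snd (measurableSet_blockSet ε a n₁)
  · exact (measurable_fst.sub measurable_snd) (measurableSet_blockSet 1 b n₂)
  · exact (show Measurable fun p : (ℝ × ℝ) × (ℝ × ℝ) => (p.2.2, p.1.2 - p.2.2) by fun_prop)
      (measurableSet_comparableSet ε)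

section triSet

variable {ε : ℝ} {m n a n₁ b n₂ : ℕ} {p : (ℝ × ℝ) × (ℝ × ℝ)}

theorem two_pow_le_of_mem_blockSet {ε : ℝ} {m n : ℕ} {q : ℝ × ℝ} (h : q ∈ blockSet ε m n)
    (h1 : 1 ≤ |q.2|) : 2 ^ m ≤ 2 * |q.2| := by
  rcases h.2.2.1 with rfl | h
  · rw [pow_zero]; linarith
  · exact h

theorem le_of_two_pow_le {i j : ℕ} (h : (2 : ℝ) ^ i ≤ 2 ^ j) : i ≤ j :=
  (pow_le_pow_iff_right₀ (by norm_num)).1 h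

theorem lower_index_close_of_mem_triSet (hp : p ∈ triSet ε m n a n₁ b n₂) :
    a ≤ b + 5 ∧ b ≤ a + 5 := by
  obtain ⟨-, hV, hU, -, -, h1, h2, h3, h4⟩ := hp
  have hx := two_pow_le_of_mem_blockSet hV h1
  have hy := two_pow_le_of_mem_blockSet hU h2
  have hx' := hV.2.1
  have hy' := hU.2.1
  simp only [Prod.snd_sub] at *
  constructor
  · refine le_of_two_pow_le ?_
    rw [pow_add]; rw [pow_succ] at hy'; linarith
  · refine le_of_two_pow_le ?_
    rw [pow_add]; rw [pow_succ] at hx'; linarith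

theorem output_nonneg_of_mem_triSet (hp : p ∈ triSet ε m n a n₁ b n₂) : 0 ≤ p.1.2 := by
  have := hp.1.1; linarith

theorem output_le_of_mem_triSet (hp : p ∈ triSet ε m n a n₁ b n₂) :
    p.1.2 ≤ 9 * |p.2.2| ∧ p.1.2 ≤ 9 * |p.1.2 - p.2.2| := by
  obtain ⟨-, -, -, -, -, h1, h2, h3, h4⟩ := hp
  simp only at *
  have e1 := le_abs_self p.2.2
  have e2 := le_abs_self (p.1.2 - p.2.2)
  constructor <;> linarith

theorem output_index_le_of_mem_triSet (hp : p ∈ triSet ε m n a n₁ b n₂) : m ≤ a + 6 := by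
  have h0 := output_nonneg_of_mem_triSet hp
  have h1 := (output_le_of_mem_triSet hp).1
  rcases hp.1.2.2.1 with h | h
  · omega
  · have h2 := hp.2.1.2.1
    rw [abs_of_nonneg h0] at h
    refine le_of_two_pow_le ?_
    rw [pow_add]; rw [pow_succ] at h2
    linarith [show (0 : ℝ) < 2 ^ a by positivity]

theorem resonance_of_mem_triSet (hε : ε = 1 ∨ ε = -1) (hp : p ∈ triSet ε m n a n₁ b n₂) {N : ℕ}
    (hn : n ≤ N) (hn₁ : n₁ ≤ N) (hn₂ : n₂ ≤ N) : p.1.2 * 2 ^ a ≤ 2 ^ (N + 6) := by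
  have h0 := output_nonneg_of_mem_triSet hp
  have h1 := (output_le_of_mem_triSet hp).2
  obtain ⟨hG, hV, hU, c1, c2, c3, -, -, -⟩ := hp
  have hx := two_pow_le_of_mem_blockSet hV c3
  have mG := abs_le.1 hG.2.2.2
  have mV := abs_le.1 hV.2.2.2
  have mU := abs_le.1 hU.2.2.2
  have up : ∀ k, k ≤ N → (2 : ℝ) ^ (k + 1) ≤ 2 * 2 ^ N := fun k hk => by
    rw [pow_succ, mul_comm]
    have : (2 : ℝ) ^ k ≤ 2 ^ N := pow_le_pow_right₀ (by norm_num) hk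
    linarith
  have uG := up n hn
  have uV := up n₁ hn₁
  have uU := up n₂ hn₂
  have hN : (0 : ℝ) < 2 ^ N := by positivity
  simp only [Prod.snd_sub, Prod.fst_sub] at *
  have hstep : p.1.2 * 2 ^ a ≤ p.1.2 * (2 * |p.2.2|) := by gcongr
  rw [pow_add]
  rcases hε with rfl | rfl
  · have hx0 : 0 ≤ p.2.2 := by linarith
    rw [abs_of_nonneg hx0] at hstep
    rw [abs_of_nonneg c2] at h1
    have h3 : p.1.2 * p.2.2 ≤ 9 * (p.1.2 - p.2.2) * p.2.2 := by gcongr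
    nlinarith
  · have hx0 : p.2.2 ≤ 0 := by linarith
    rw [abs_of_nonpos hx0] at hstep
    nlinarith

theorem index_add_le_of_mem_triSet (hε : ε = 1 ∨ ε = -1) (hp : p ∈ triSet ε m n a n₁ b n₂)
    {N : ℕ} (hn : n ≤ N) (hn₁ : n₁ ≤ N) (hn₂ : n₂ ≤ N) : m = 0 ∨ m + a ≤ N + 7 := by
  have h0 := output_nonneg_of_mem_triSet hp
  have h1 := resonance_of_mem_triSet hε hp hn hn₁ hn₂
  refine hp.1.2.2.1.imp_right fun h => le_of_two_pow_le ?_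
  rw [abs_of_nonneg h0] at h
  rw [pow_add]
  have : (2 : ℝ) ^ m * 2 ^ a ≤ 2 * p.1.2 * 2 ^ a := by gcongr
  have e : (2 : ℝ) ^ (N + 7) = 2 * 2 ^ (N + 6) := by ring
  linarith

theorem two_mul_index_le_of_mem_triSet (hp : p ∈ triSet 1 m n a n₁ b n₂)
    {N : ℕ} (hn : n ≤ N) (hn₁ : n₁ ≤ N) (hn₂ : n₂ ≤ N) : 2 * a ≤ N + 7 ∧ a ≤ m + 2 := by
  have h0 := output_nonneg_of_mem_triSet hp
  have h1 := resonance_of_mem_triSet (Or.inl rfl) hp hn hn₁ hn₂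
  obtain ⟨hG, hV, hU, c1, c2, c3, -, -, -⟩ := hp
  have hx := two_pow_le_of_mem_blockSet hV c3
  have hG' := hG.2.1
  simp only at *
  rw [abs_of_nonneg (show 0 ≤ p.2.2 by linarith)] at hx
  rw [abs_of_nonneg h0] at hG'
  constructor
  · refine le_of_two_pow_le ?_
    have : (2 : ℝ) ^ a * 2 ^ a ≤ 2 * p.1.2 * 2 ^ a := by gcongr; linarith
    have e : (2 : ℝ) ^ (N + 7) = 2 * 2 ^ (N + 6) := by ring
    rw [two_mul, pow_add]
    linarith
  · refine le_of_two_pow_le ?_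
    have e : (2 : ℝ) ^ (m + 2) = 2 * 2 ^ (m + 1) := by ring
    linarith

end triSet

/-- A two-sided dyadic decay factor. -/
def dyadicDecay (z : ℝ) : ℝ := (2 : ℝ) ^ (-(|z| / 4))

theorem dyadicDecay_pos (z : ℝ) : 0 < dyadicDecay z := by unfold dyadicDecay; positivity

/-- The gain in the output indices `(m, n)` for inputs of frequency `2 ^ a` and modulations
`2 ^ n₁`, `2 ^ n₂`. -/
def blockGain (a n₁ n₂ m n : ℕ) : ℝ :=
  dyadicDecay ((n : ℝ) - a) * dyadicDecay m +
  dyadicDecay ((n : ℝ) - 2 * a) * dyadicDecay ((m : ℝ) - a) +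
  dyadicDecay n * dyadicDecay ((m : ℝ) - ((n₁ : ℝ) - a)) +
  dyadicDecay n * dyadicDecay ((m : ℝ) - ((n₂ : ℝ) - a)) +
  dyadicDecay n * dyadicDecay m

theorem le_blockGain (a n₁ n₂ m n : ℕ) :
    dyadicDecay ((n : ℝ) - a) * dyadicDecay m ≤ blockGain a n₁ n₂ m n ∧
    dyadicDecay ((n : ℝ) - 2 * a) * dyadicDecay ((m : ℝ) - a) ≤ blockGain a n₁ n₂ m n ∧
    dyadicDecay n * dyadicDecay ((m : ℝ) - ((n₁ : ℝ) - a)) ≤ blockGain a n₁ n₂ m n ∧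
    dyadicDecay n * dyadicDecay ((m : ℝ) - ((n₂ : ℝ) - a)) ≤ blockGain a n₁ n₂ m n ∧
    dyadicDecay n * dyadicDecay m ≤ blockGain a n₁ n₂ m n := by
  have h := fun x y => (mul_pos (dyadicDecay_pos x) (dyadicDecay_pos y)).le
  have h1 := h ((n : ℝ) - a) m
  have h2 := h ((n : ℝ) - 2 * a) ((m : ℝ) - a)
  have h3 := h n ((m : ℝ) - ((n₁ : ℝ) - a))
  have h4 := h n ((m : ℝ) - ((n₂ : ℝ) - a))
  have h5 := h n m
  unfold blockGain
  refine ⟨?_, ?_, ?_, ?_, ?_⟩ <;> linarith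

theorem two_rpow_le_mul_sq {x y z w W : ℝ} (h : x + (|z| + |w|) / 2 ≤ y)
    (hW : dyadicDecay z * dyadicDecay w ≤ W) : (2 : ℝ) ^ x ≤ 2 ^ y * W ^ 2 := by
  have h1 : (2 : ℝ) ^ x ≤ 2 ^ y * (dyadicDecay z * dyadicDecay w) ^ 2 := by
    unfold dyadicDecay
    rw [← Real.rpow_add two_pos, ← Real.rpow_natCast, ← Real.rpow_mul two_pos.le,
      ← Real.rpow_add two_pos]
    refine Real.rpow_le_rpow_of_exponent_le one_le_two ?_
    push_cast; linarith
  refine h1.trans ?_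
  have := mul_pos (dyadicDecay_pos z) (dyadicDecay_pos w)
  gcongr

theorem two_pow_mul_sqrt_le (i j : ℕ) :
    12 * ((2 : ℝ) ^ (j + 1) * √(2 ^ (i + 1))) ≤ 2 ^ ((j : ℝ) + i / 2 + 6) := by
  have h1 : √((2 : ℝ) ^ (i + 1)) = 2 ^ (((i : ℝ) + 1) / 2) := by
    rw [Real.sqrt_eq_rpow, ← Real.rpow_natCast, ← Real.rpow_mul two_pos.le]
    push_cast; congr 1; ring
  have h2 : (2 : ℝ) ^ (j + 1) = 2 ^ ((j : ℝ) + 1) := by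
    rw [← Real.rpow_natCast]; push_cast; rfl
  have h3 : (12 : ℝ) ≤ 2 ^ (4 : ℝ) := by norm_num
  rw [h1, h2]
  calc 12 * ((2 : ℝ) ^ ((j : ℝ) + 1) * 2 ^ (((i : ℝ) + 1) / 2))
      ≤ 2 ^ (4 : ℝ) * ((2 : ℝ) ^ ((j : ℝ) + 1) * 2 ^ (((i : ℝ) + 1) / 2)) := by gcongr
    _ = 2 ^ ((4 : ℝ) + ((j + 1) + (i + 1) / 2)) := by
      rw [← Real.rpow_add two_pos, ← Real.rpow_add two_pos]
    _ ≤ _ := Real.rpow_le_rpow_of_exponent_le one_le_two (by linarith)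

theorem lintegral_weight_mul_restrictedConv_le {S : Set ((ℝ × ℝ) × (ℝ × ℝ))}
    {V U : ℝ × ℝ → ℝ≥0∞} {X : ℝ} (hX : ∀ p ∈ S, p.1.2 ≤ X) :
    ∫⁻ q, ENNReal.ofReal q.2 * restrictedConv S V U q ^ 2 ≤
      ENNReal.ofReal X * ∫⁻ q, restrictedConv S V U q ^ 2 := by
  rw [← lintegral_const_mul' _ _ ENNReal.ofReal_ne_top]
  refine lintegral_mono fun q => ?_
  by_cases h : ∃ r, (q, r) ∈ S
  · obtain ⟨r, hr⟩ := h
    gcongr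
    exact hX _ hr
  · have : restrictedConv S V U q = 0 := by
      unfold restrictedConv
      rw [lintegral_eq_zero_of_ae_eq_zero]
      filter_upwards with r
      rw [Set.indicator_of_notMem (fun hr => h ⟨r, hr⟩), zero_mul, Pi.zero_apply]
    rw [this]; simp

section block

variable {ε : ℝ} {m n a n₁ b n₂ : ℕ} {V U : ℝ × ℝ → ℝ≥0∞}

theorem weighted_bound_of_fst (hVm : Measurable V) (hUm : Measurable U)
    (hV : Function.support V ⊆ blockSet ε a n₁) (hV2 : ∫⁻ r, V r ^ 2 ≠ ∞)
    (hU2 : ∫⁻ r, U r ^ 2 ≠ ∞) {X c R : ℝ} (hX0 : 0 ≤ X)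
    (hX : ∀ p ∈ triSet ε m n a n₁ b n₂, p.1.2 ≤ X)
    (h : ∀ r, volume {q | (q, r) ∈ triSet ε m n a n₁ b n₂} ≤ ENNReal.ofReal c)
    (hR : X * c ≤ R) :
    ∫⁻ q, ENNReal.ofReal q.2 * restrictedConv (triSet ε m n a n₁ b n₂) V U q ^ 2 ≤
      ENNReal.ofReal R * ((∫⁻ r, V r ^ 2) * ∫⁻ r, U r ^ 2) := by
  refine (lintegral_weight_mul_restrictedConv_le hX).trans ?_
  refine (mul_le_mul_right (lintegral_restrictedConv_sq_le_of_fst (measurableSet_triSet ..) hVm hUm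
    (ne_top_of_le_ne_top (volume_blockSet_ne_top ε a n₁) (measure_mono hV)) hV2 hU2
    ENNReal.ofReal_ne_top h) _).trans ?_
  rw [← mul_assoc, ← ENNReal.ofReal_mul hX0]
  gcongr

theorem weighted_bound_of_snd (hVm : Measurable V) (hUm : Measurable U)
    (hU : Function.support U ⊆ blockSet 1 b n₂) (hV2 : ∫⁻ r, V r ^ 2 ≠ ∞)
    (hU2 : ∫⁻ r, U r ^ 2 ≠ ∞) {X c R : ℝ} (hX0 : 0 ≤ X)
    (hX : ∀ p ∈ triSet ε m n a n₁ b n₂, p.1.2 ≤ X)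
    (h : ∀ r, volume {q | (q, q - r) ∈ triSet ε m n a n₁ b n₂} ≤ ENNReal.ofReal c)
    (hR : X * c ≤ R) :
    ∫⁻ q, ENNReal.ofReal q.2 * restrictedConv (triSet ε m n a n₁ b n₂) V U q ^ 2 ≤
      ENNReal.ofReal R * ((∫⁻ r, V r ^ 2) * ∫⁻ r, U r ^ 2) := by
  refine (lintegral_weight_mul_restrictedConv_le hX).trans ?_
  refine (mul_le_mul_right (lintegral_restrictedConv_sq_le_of_snd (measurableSet_triSet ..) hVm hUm
    (ne_top_of_le_ne_top (volume_blockSet_ne_top 1 b n₂) (measure_mono hU)) hV2 hU2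
    ENNReal.ofReal_ne_top h) _).trans ?_
  rw [← mul_assoc, ← ENNReal.ofReal_mul hX0]
  gcongr

theorem output_le_two_pow {p : (ℝ × ℝ) × (ℝ × ℝ)} (hp : p ∈ triSet ε m n a n₁ b n₂) :
    p.1.2 ≤ (2 : ℝ) ^ ((m : ℝ) + 1) := by
  have := (le_abs_self _).trans hp.1.2.1
  rwa [← Real.rpow_natCast, Nat.cast_add, Nat.cast_one] at this

theorem output_le_two_rpow (hε : ε = 1 ∨ ε = -1) {p : (ℝ × ℝ) × (ℝ × ℝ)}
    (hp : p ∈ triSet ε m n a n₁ b n₂) {N : ℕ} (hn : n ≤ N) (hn₁ : n₁ ≤ N) (hn₂ : n₂ ≤ N) :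
    p.1.2 ≤ (2 : ℝ) ^ ((N : ℝ) - a + 6) := by
  have h := resonance_of_mem_triSet hε hp hn hn₁ hn₂
  rw [show (N : ℝ) - a + 6 = ((N + 6 : ℕ) : ℝ) - (a : ℕ) by push_cast; ring,
    Real.rpow_sub two_pos, Real.rpow_natCast, Real.rpow_natCast, le_div_iff₀ (by positivity)]
  exact h

theorem volume_output_slice_fst_le (r : ℝ × ℝ) :
    volume {q | (q, r) ∈ triSet ε m n a n₁ b n₂} ≤
      ENNReal.ofReal ((2 : ℝ) ^ ((n₂ : ℝ) + n / 2 + 6)) := by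
  by_cases hr : r.2 = 0
  · have : {q | (q, r) ∈ triSet ε m n a n₁ b n₂} = ∅ := by
      refine Set.eq_empty_of_forall_notMem fun q hq => ?_
      have h1 := hq.2.2.2.2.2.1
      simp only [hr, abs_zero] at h1
      linarith
    rw [this, measure_empty]; exact zero_le
  · refine le_trans (measure_mono fun q hq => ?_) ((volume_output_slice_le (e := 1) (Or.inl rfl) hr
      (A := 2 ^ (n + 1)) (B := 2 ^ (n₂ + 1)) (by positivity) (by positivity)).trans
      (ENNReal.ofReal_le_ofReal (two_pow_mul_sqrt_le n n₂)))
    have hG := hq.1.2.2.2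
    have hU := hq.2.2.1.2.2.2
    simp only [Prod.fst_sub, Prod.snd_sub, one_mul] at hG hU
    refine ⟨⟨output_nonneg_of_mem_triSet hq, (output_le_of_mem_triSet hq).1⟩, hG, ?_⟩
    rw [one_mul, ← sub_sub]; exact hU

theorem volume_output_slice_snd_le (hε : ε = 1 ∨ ε = -1) (r : ℝ × ℝ) :
    volume {q | (q, q - r) ∈ triSet ε m n a n₁ b n₂} ≤
      ENNReal.ofReal ((2 : ℝ) ^ ((n₁ : ℝ) + n / 2 + 6)) := by
  by_cases hr : r.2 = 0
  · have : {q | (q, q - r) ∈ triSet ε m n a n₁ b n₂} = ∅ := by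
      refine Set.eq_empty_of_forall_notMem fun q hq => ?_
      have h1 := hq.2.2.2.2.2.2.1
      simp only [Prod.snd_sub, sub_sub_cancel, hr, abs_zero] at h1
      linarith
    rw [this, measure_empty]; exact zero_le
  · refine le_trans (measure_mono fun q hq => ?_) ((volume_output_slice_le hε hr
      (A := 2 ^ (n + 1)) (B := 2 ^ (n₁ + 1)) (by positivity) (by positivity)).trans
      (ENNReal.ofReal_le_ofReal (two_pow_mul_sqrt_le n n₁)))
    have hG := hq.1.2.2.2
    have hV := hq.2.1.2.2.2
    have h9 := (output_le_of_mem_triSet hq).2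
    simp only [Prod.fst_sub, Prod.snd_sub, one_mul, sub_sub_cancel] at hG hV h9
    refine ⟨⟨output_nonneg_of_mem_triSet hq, h9⟩, hG, ?_⟩
    rw [← sub_sub]; exact hV

theorem exists_weight_bound (hε : ε = 1 ∨ ε = -1) {N : ℕ} (hn : n ≤ N) (hn₁ : n₁ ≤ N)
    (hn₂ : n₂ ≤ N) (hne : (triSet ε m n a n₁ b n₂).Nonempty) :
    ∃ x : ℝ, (∀ p ∈ triSet ε m n a n₁ b n₂, p.1.2 ≤ (2 : ℝ) ^ x) ∧
      (x ≤ (N : ℝ) - a + 16 - |(m : ℝ) - ((N : ℝ) - a)| / 2 ∨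
        (m = 0 ∧ x ≤ (N : ℝ) - a + 16)) := by
  obtain ⟨p, hp⟩ := hne
  by_cases hm : m = 0 ∧ N < a
  · refine ⟨(N : ℝ) - a + 6, fun p hp => output_le_two_rpow hε hp hn hn₁ hn₂, Or.inr ⟨hm.1, ?_⟩⟩
    linarith
  · refine ⟨(m : ℝ) + 1, fun p hp => output_le_two_pow hp, Or.inl ?_⟩
    have h1 := index_add_le_of_mem_triSet hε hp hn hn₁ hn₂
    have h2 : m + a ≤ N + 7 := by omega
    have h3 : (m : ℝ) + a ≤ N + 7 := by exact_mod_cast h2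
    rcases abs_cases ((m : ℝ) - ((N : ℝ) - a)) with h | h <;> linarith

theorem weighted_bound_input_fst (hε : ε = 1 ∨ ε = -1) (hVm : Measurable V) (hUm : Measurable U)
    (hV : Function.support V ⊆ blockSet ε a n₁) (hV2 : ∫⁻ r, V r ^ 2 ≠ ∞)
    (hU2 : ∫⁻ r, U r ^ 2 ≠ ∞) (hne : (triSet ε m n a n₁ b n₂).Nonempty)
    (hn : n ≤ n₁) (hn₂ : n₂ ≤ n₁) :
    ∫⁻ q, ENNReal.ofReal q.2 * restrictedConv (triSet ε m n a n₁ b n₂) V U q ^ 2 ≤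
      ENNReal.ofReal (2 ^ (30 + n - a + n₁ + n₂ : ℝ) * blockGain a n₁ n₂ m n ^ 2) *
        ((∫⁻ r, V r ^ 2) * ∫⁻ r, U r ^ 2) := by
  obtain ⟨x, hx, hx'⟩ := exists_weight_bound hε hn le_rfl hn₂ hne
  refine weighted_bound_of_fst hVm hUm hV hV2 hU2 (by positivity) hx volume_output_slice_fst_le ?_
  rw [← Real.rpow_add two_pos]
  obtain ⟨-, -, h3, -, h5⟩ := le_blockGain a n₁ n₂ m n
  have hn0 : |(n : ℝ)| = n := Nat.abs_cast n
  rcases hx' with h | ⟨rfl, h⟩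
  · refine two_rpow_le_mul_sq ?_ h3
    linarith
  · refine two_rpow_le_mul_sq ?_ h5
    simp only [Nat.cast_zero, abs_zero]
    linarith

theorem weighted_bound_input_snd (hε : ε = 1 ∨ ε = -1) (hVm : Measurable V) (hUm : Measurable U)
    (hU : Function.support U ⊆ blockSet 1 b n₂) (hV2 : ∫⁻ r, V r ^ 2 ≠ ∞)
    (hU2 : ∫⁻ r, U r ^ 2 ≠ ∞) (hne : (triSet ε m n a n₁ b n₂).Nonempty)
    (hn : n ≤ n₂) (hn₁ : n₁ ≤ n₂) :
    ∫⁻ q, ENNReal.ofReal q.2 * restrictedConv (triSet ε m n a n₁ b n₂) V U q ^ 2 ≤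
      ENNReal.ofReal (2 ^ (30 + n - a + n₁ + n₂ : ℝ) * blockGain a n₁ n₂ m n ^ 2) *
        ((∫⁻ r, V r ^ 2) * ∫⁻ r, U r ^ 2) := by
  obtain ⟨x, hx, hx'⟩ := exists_weight_bound hε hn hn₁ le_rfl hne
  refine weighted_bound_of_snd hVm hUm hU hV2 hU2 (by positivity) hx
    (volume_output_slice_snd_le hε) ?_
  rw [← Real.rpow_add two_pos]
  obtain ⟨-, -, -, h4, h5⟩ := le_blockGain a n₁ n₂ m n
  have hn0 : |(n : ℝ)| = n := Nat.abs_cast n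
  rcases hx' with h | ⟨rfl, h⟩
  · refine two_rpow_le_mul_sq ?_ h4
    linarith
  · refine two_rpow_le_mul_sq ?_ h5
    simp only [Nat.cast_zero, abs_zero]
    linarith

theorem weighted_bound_output_of_input_slice (hVm : Measurable V) (hUm : Measurable U) {R : ℝ}
    (h : ∀ q : ℝ × ℝ, ENNReal.ofReal q.2 * volume {r | (q, r) ∈ triSet ε m n a n₁ b n₂} ≤
      ENNReal.ofReal R) :
    ∫⁻ q, ENNReal.ofReal q.2 * restrictedConv (triSet ε m n a n₁ b n₂) V U q ^ 2 ≤
      ENNReal.ofReal R * ((∫⁻ r, V r ^ 2) * ∫⁻ r, U r ^ 2) :=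
  lintegral_mul_restrictedConv_sq_le (ω := fun q => ENNReal.ofReal q.2)
    (measurableSet_triSet ..) hVm hUm ENNReal.ofReal_ne_top h

theorem weighted_bound_output_neg (hVm : Measurable V) (hUm : Measurable U)
    (hV : Function.support V ⊆ blockSet (-1) a n₁) (hV2 : ∫⁻ r, V r ^ 2 ≠ ∞)
    (hU2 : ∫⁻ r, U r ^ 2 ≠ ∞) (hne : (triSet (-1) m n a n₁ b n₂).Nonempty)
    (hn₁ : n₁ ≤ n) (hn₂ : n₂ ≤ n) :
    ∫⁻ q, ENNReal.ofReal q.2 * restrictedConv (triSet (-1) m n a n₁ b n₂) V U q ^ 2 ≤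
      ENNReal.ofReal (2 ^ (30 + n - a + n₁ + n₂ : ℝ) * blockGain a n₁ n₂ m n ^ 2) *
        ((∫⁻ r, V r ^ 2) * ∫⁻ r, U r ^ 2) := by
  have hε : (-1 : ℝ) = 1 ∨ (-1 : ℝ) = -1 := Or.inr rfl
  obtain ⟨h1, -⟩ := le_blockGain a n₁ n₂ m n
  have hm0 : |(m : ℝ)| = m := Nat.abs_cast m
  by_cases hm : m = 0 ∧ n < a
  · refine weighted_bound_of_fst (X := 2 ^ ((n : ℝ) - a + 6))
      (c := 2 ^ ((n₂ : ℝ) + 2 + (n - a + 6))) hVm hUm hV hV2 hU2 (by positivity)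
      (fun p hp => output_le_two_rpow hε hp le_rfl hn₁ hn₂) (fun r => ?_) ?_
    · refine le_trans (measure_mono fun q hq => ?_) ((volume_tube_le
        (d := fun x => r.1 + (x - r.2) ^ 2) (by fun_prop) (B := 2 ^ (n₂ + 1)) (by positivity) 0
        (2 ^ ((n : ℝ) - a + 6))).trans (le_of_eq ?_))
      · have hU := hq.2.2.1.2.2.2
        simp only [Prod.fst_sub, Prod.snd_sub, one_mul] at hU
        refine ⟨⟨output_nonneg_of_mem_triSet hq, output_le_two_rpow hε hq le_rfl hn₁ hn₂⟩, ?_⟩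
        rw [← sub_sub]; exact hU
      · congr 1
        rw [sub_zero, ← mul_assoc, Real.rpow_add two_pos _ ((n : ℝ) - a + 6)]
        congr 1
        rw [show (n₂ : ℝ) + 2 = ((n₂ + 1 : ℕ) : ℝ) + 1 by push_cast; ring, Real.rpow_add two_pos,
          Real.rpow_natCast, Real.rpow_one, mul_comm]
    · rw [← Real.rpow_add two_pos]
      have h2 : (n : ℝ) < a := by exact_mod_cast hm.2
      refine two_rpow_le_mul_sq ?_ h1
      rw [hm.1, Nat.cast_zero, abs_zero, abs_of_neg (by linarith)]
      have : (0 : ℝ) ≤ n₁ := Nat.cast_nonneg _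
      linarith
  · obtain ⟨p, hp⟩ := hne
    refine weighted_bound_output_of_input_slice hVm hUm fun q => ?_
    have hs := mul_volume_input_slice_le q (A := 2 ^ (n₁ + 1)) (B := 2 ^ (n₂ + 1))
      (by positivity) (by positivity)
    refine le_trans (mul_le_mul_right (measure_mono fun r hr => ?_) _)
      (hs.trans (ENNReal.ofReal_le_ofReal ?_))
    · have hU' := hr.2.2.1.2.2.2
      have hV' := hr.2.1.2.2.2
      simp only [Prod.fst_sub, Prod.snd_sub, one_mul] at hU' hV'
      refine ⟨hV', ?_⟩
      rw [abs_sub_comm]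
      convert hU' using 2; ring
    · have e : (4 : ℝ) * (2 ^ (n₁ + 1) * 2 ^ (n₂ + 1)) = 2 ^ ((n₁ : ℝ) + n₂ + 4) := by
        rw [show (n₁ : ℝ) + n₂ + 4 = ((n₁ + n₂ + 4 : ℕ) : ℝ) by push_cast; ring,
          Real.rpow_natCast]
        ring
      rw [e]
      refine two_rpow_le_mul_sq ?_ h1
      have h2 := index_add_le_of_mem_triSet hε hp le_rfl hn₁ hn₂
      have h3 : m + a ≤ n + 7 := by omega
      have h4 : (m : ℝ) + a ≤ n + 7 := by exact_mod_cast h3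
      have h5 : (0 : ℝ) ≤ m := Nat.cast_nonneg _
      rcases abs_cases ((n : ℝ) - a) with h | h <;> linarith

theorem weighted_bound_output_pos (hVm : Measurable V) (hUm : Measurable U)
    (hne : (triSet 1 m n a n₁ b n₂).Nonempty) (hn₁ : n₁ ≤ n) (hn₂ : n₂ ≤ n) :
    ∫⁻ q, ENNReal.ofReal q.2 * restrictedConv (triSet 1 m n a n₁ b n₂) V U q ^ 2 ≤
      ENNReal.ofReal (2 ^ (30 + n - a + n₁ + n₂ : ℝ) * blockGain a n₁ n₂ m n ^ 2) *
        ((∫⁻ r, V r ^ 2) * ∫⁻ r, U r ^ 2) := by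
  obtain ⟨-, h1, -⟩ := le_blockGain a n₁ n₂ m n
  obtain ⟨p, hp⟩ := hne
  refine weighted_bound_output_of_input_slice hVm hUm fun q => ?_
  have hs : volume {r | (q, r) ∈ triSet 1 m n a n₁ b n₂} ≤
      ENNReal.ofReal (2 ^ ((n₂ : ℝ) + n₁ / 2 + 6)) := by
    refine le_trans (measure_mono fun r hr => ?_) ((volume_input_slice_le q
      (A := 2 ^ (n₁ + 1)) (B := 2 ^ (n₂ + 1)) (by positivity) (by positivity)).trans
      (ENNReal.ofReal_le_ofReal (le_trans ?_ (two_pow_mul_sqrt_le n₁ n₂))))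
    · have hU' := hr.2.2.1.2.2.2
      have hV' := hr.2.1.2.2.2
      simp only [Prod.fst_sub, Prod.snd_sub, one_mul] at hU' hV'
      refine ⟨hV', ?_⟩
      rw [abs_sub_comm]
      convert hU' using 2; ring
    · have : (0 : ℝ) ≤ 2 ^ (n₂ + 1) * √(2 ^ (n₁ + 1)) := by positivity
      linarith
  obtain ⟨h2, h3⟩ := two_mul_index_le_of_mem_triSet hp le_rfl hn₁ hn₂
  have h4 := output_index_le_of_mem_triSet hp
  have h2' : 2 * (a : ℝ) ≤ n + 7 := by exact_mod_cast h2
  have h3' : (a : ℝ) ≤ m + 2 := by exact_mod_cast h3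
  have h4' : (m : ℝ) ≤ a + 6 := by exact_mod_cast h4
  have h5 : (0 : ℝ) ≤ n₁ := Nat.cast_nonneg _
  by_cases hq : ∃ r, (q, r) ∈ triSet 1 m n a n₁ b n₂
  · obtain ⟨r, hr⟩ := hq
    calc _ ≤ ENNReal.ofReal (2 ^ ((m : ℝ) + 1)) *
          ENNReal.ofReal (2 ^ ((n₂ : ℝ) + n₁ / 2 + 6)) := by
            gcongr
            exact output_le_two_pow hr
      _ ≤ _ := by
        rw [← ENNReal.ofReal_mul (by positivity), ← Real.rpow_add two_pos]
        refine ENNReal.ofReal_le_ofReal (two_rpow_le_mul_sq ?_ h1)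
        rcases abs_cases ((n : ℝ) - 2 * a) with h | h <;>
          rcases abs_cases ((m : ℝ) - a) with h' | h' <;> linarith
  · rw [show {r | (q, r) ∈ triSet 1 m n a n₁ b n₂} = ∅ from
      Set.eq_empty_of_forall_notMem fun r hr => hq ⟨r, hr⟩]
    simp

theorem weighted_restrictedConv_le (hε : ε = 1 ∨ ε = -1) (hVm : Measurable V) (hUm : Measurable U)
    (hV : Function.support V ⊆ blockSet ε a n₁) (hU : Function.support U ⊆ blockSet 1 b n₂)
    (hV2 : ∫⁻ r, V r ^ 2 ≠ ∞) (hU2 : ∫⁻ r, U r ^ 2 ≠ ∞)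
    (hne : (triSet ε m n a n₁ b n₂).Nonempty) :
    ∫⁻ q, ENNReal.ofReal q.2 * restrictedConv (triSet ε m n a n₁ b n₂) V U q ^ 2 ≤
      ENNReal.ofReal (2 ^ (30 + n - a + n₁ + n₂ : ℝ) * blockGain a n₁ n₂ m n ^ 2) *
        ((∫⁻ r, V r ^ 2) * ∫⁻ r, U r ^ 2) := by
  by_cases h1 : n₁ ≤ n ∧ n₂ ≤ n
  · rcases hε with rfl | rfl
    · exact weighted_bound_output_pos hVm hUm hne h1.1 h1.2
    · exact weighted_bound_output_neg hVm hUm hV hV2 hU2 hne h1.1 h1.2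
  · rcases le_total n₁ n₂ with h | h
    · exact weighted_bound_input_snd hε hVm hUm hU hV2 hU2 hne (by omega) h
    · exact weighted_bound_input_fst hε hVm hUm hV hV2 hU2 hne (by omega) h

end block

/-- The `L²` norm of an extended nonnegative function. -/
def twoNorm (f : ℝ × ℝ → ℝ≥0∞) : ℝ≥0∞ := (∫⁻ q, f q ^ 2) ^ (1 / 2 : ℝ)

theorem twoNorm_sq (f : ℝ × ℝ → ℝ≥0∞) : twoNorm f ^ 2 = ∫⁻ q, f q ^ 2 := by
  rw [twoNorm, ← ENNReal.rpow_natCast, ← ENNReal.rpow_mul]; norm_num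

theorem ennreal_le_of_sq_le_sq {x y : ℝ≥0∞} (h : x ^ 2 ≤ y ^ 2) : x ≤ y :=
  (ENNReal.pow_le_pow_left_iff two_ne_zero).1 h

theorem twoNorm_mono {f g : ℝ × ℝ → ℝ≥0∞} (h : ∀ q, f q ≤ g q) : twoNorm f ≤ twoNorm g :=
  ENNReal.rpow_le_rpow (lintegral_mono fun q => pow_le_pow_left' (h q) 2) (by norm_num)

theorem twoNorm_const_mul (c : ℝ≥0∞) {f : ℝ × ℝ → ℝ≥0∞} (hf : Measurable f) :
    twoNorm (fun q => c * f q) = c * twoNorm f := by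
  have h : ∫⁻ q, (c * f q) ^ 2 = c ^ 2 * ∫⁻ q, f q ^ 2 := by
    rw [← lintegral_const_mul _ (hf.pow_const 2)]
    simp_rw [mul_pow]
  refine le_antisymm (ennreal_le_of_sq_le_sq ?_) (ennreal_le_of_sq_le_sq ?_) <;>
    rw [mul_pow, twoNorm_sq, twoNorm_sq, h]

theorem lintegral_mul_le_twoNorm {f g : ℝ × ℝ → ℝ≥0∞} (hf : Measurable f) (hg : Measurable g) :
    ∫⁻ q, f q * g q ≤ twoNorm f * twoNorm g := by
  refine ennreal_le_of_sq_le_sq ?_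
  rw [mul_pow, twoNorm_sq, twoNorm_sq]
  exact lintegral_mul_sq_le hf.aemeasurable hg.aemeasurable

theorem twoNorm_tsum_le {ι : Type*} [Countable ι] {f : ι → ℝ × ℝ → ℝ≥0∞}
    (hf : ∀ i, Measurable (f i)) : twoNorm (fun q => ∑' i, f i q) ≤ ∑' i, twoNorm (f i) := by
  refine ennreal_le_of_sq_le_sq ?_
  have e : ∀ g : ι → ℝ≥0∞, (∑' i, g i) ^ 2 = ∑' i, ∑' j, g i * g j := fun g => by
    rw [sq, ← ENNReal.tsum_mul_right]
    simp_rw [ENNReal.tsum_mul_left]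
  have hm : ∀ i j, Measurable fun q => f i q * f j q := fun i j => (hf i).mul (hf j)
  rw [twoNorm_sq, e]
  simp_rw [e]
  rw [lintegral_tsum fun i => (Measurable.tsum fun j => hm i j).aemeasurable]
  refine ENNReal.tsum_le_tsum fun i => ?_
  rw [lintegral_tsum fun j => (hm i j).aemeasurable]
  exact ENNReal.tsum_le_tsum fun j => lintegral_mul_le_twoNorm (hf i) (hf j)

theorem eLpNorm_two_eq_twoNorm (g : ℝ × ℝ → ℂ) :
    eLpNorm g 2 volume = twoNorm fun q => ‖g q‖ₑ := by
  rw [show (2 : ℝ≥0∞) = ((2 : ℝ≥0) : ℝ≥0∞) by simp, eLpNorm_nnreal_eq_lintegral two_ne_zero]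
  simp [twoNorm]

theorem support_XblockHat {φ : 𝓢(ℝ, ℂ)} (hφ : IsLPfilter φ) (ε : ℝ) (m n : ℕ)
    (u : ℝ × ℝ → ℂ) : Function.support (fun q => ‖XblockHat φ ε m n u q‖ₑ) ⊆ blockSet ε m n := by
  intro q hq
  have h0 : XblockHat φ ε m n u q ≠ 0 := by simpa using hq
  unfold XblockHat at h0
  have h1 := left_ne_zero_of_mul h0
  have h2 := left_ne_zero_of_mul h1
  refine ⟨?_, psiLP_support_le hφ (right_ne_zero_of_mul h2), ?_,
    psiLP_support_le hφ (right_ne_zero_of_mul h1)⟩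
  · by_contra h
    exact left_ne_zero_of_mul h2 (if_neg h)
  · cases m with
    | zero => exact Or.inl rfl
    | succ k =>
      have := psiLP_support_ge hφ (right_ne_zero_of_mul h2)
      right; rw [pow_succ]; linarith

theorem enorm_FT2_le_tsum {φ : 𝓢(ℝ, ℂ)} (hφ : IsLPfilter φ) {ε : ℝ} (u : ℝ × ℝ → ℂ)
    {r : ℝ × ℝ} (hr : 0 ≤ ε * r.2) :
    ‖FT2 u r‖ₑ ≤ ∑' i : ℕ × ℕ, ‖XblockHat φ ε i.1 i.2 u r‖ₑ := by
  simp_rw [XblockHat, if_pos hr, one_mul, enorm_mul, ENNReal.tsum_mul_right]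
  rw [ENNReal.tsum_prod' (f := fun i : ℕ × ℕ => ‖psiLP φ i.1 r.2‖ₑ * _)]
  simp_rw [ENNReal.tsum_mul_left, ENNReal.tsum_mul_right]
  calc ‖FT2 u r‖ₑ = 1 * 1 * ‖FT2 u r‖ₑ := by simp
    _ ≤ _ := by gcongr <;> exact one_le_tsum_enorm_psiLP hφ _

theorem lintegral_comparableSet_le_tsum {φ : 𝓢(ℝ, ℂ)} (hφ : IsLPfilter φ) (ε : ℝ)
    (u v : 𝓢(ℝ × ℝ, ℂ)) {m n : ℕ} {q : ℝ × ℝ} (hq : q ∈ blockSet 1 m n) :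
    ∫⁻ r, (comparableSet ε).indicator 1 (r.2, q.2 - r.2) * (‖FT2 v r‖ₑ * ‖FT2 u (q - r)‖ₑ) ≤
      ∑' i : ℕ × ℕ, ∑' j : ℕ × ℕ, restrictedConv (triSet ε m n i.1 i.2 j.1 j.2)
        (fun r => ‖XblockHat φ ε i.1 i.2 v r‖ₑ) (fun r => ‖XblockHat φ 1 j.1 j.2 u r‖ₑ) q := by
  have hmV := fun i : ℕ × ℕ => (measurable_XblockHat φ ε i.1 i.2 v).enorm
  have hmU := fun i : ℕ × ℕ => (measurable_XblockHat φ 1 i.1 i.2 u).enorm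
  have hm : ∀ i j : ℕ × ℕ, Measurable fun r : ℝ × ℝ =>
      (triSet ε m n i.1 i.2 j.1 j.2).indicator (1 : (ℝ × ℝ) × (ℝ × ℝ) → ℝ≥0∞) (q, r) *
        (‖XblockHat φ ε i.1 i.2 v r‖ₑ * ‖XblockHat φ 1 j.1 j.2 u (q - r)‖ₑ) := fun i j =>
    ((measurable_one.indicator (measurableSet_triSet ..)).comp measurable_prodMk_left).mul
      ((hmV i).mul ((hmU j).comp (measurable_const.sub measurable_id)))
  unfold restrictedConv
  simp_rw [← lintegral_tsum fun j => (hm _ j).aemeasurable]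
  rw [← lintegral_tsum fun i => (Measurable.tsum fun j => hm i j).aemeasurable]
  refine lintegral_mono fun r => ?_
  by_cases hr : (r.2, q.2 - r.2) ∈ comparableSet ε
  · rw [Set.indicator_of_mem hr, Pi.one_apply, one_mul]
    have h1 := enorm_FT2_le_tsum hφ (v : ℝ × ℝ → ℂ) (show 0 ≤ ε * r.2 from hr.1)
    have h2 := enorm_FT2_le_tsum hφ (ε := 1) (u : ℝ × ℝ → ℂ) (r := q - r)
      (by rw [one_mul]; exact hr.2.1)
    refine (mul_le_mul' h1 h2).trans ?_
    rw [← ENNReal.tsum_mul_right]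
    refine ENNReal.tsum_le_tsum fun i => ?_
    rw [← ENNReal.tsum_mul_left]
    refine ENNReal.tsum_le_tsum fun j => ?_
    by_cases hV : ‖XblockHat φ ε i.1 i.2 v r‖ₑ = 0
    · rw [hV]; simp
    by_cases hU : ‖XblockHat φ 1 j.1 j.2 u (q - r)‖ₑ = 0
    · rw [hU]; simp
    have : (q, r) ∈ triSet ε m n i.1 i.2 j.1 j.2 :=
      ⟨hq, support_XblockHat hφ ε i.1 i.2 v hV, support_XblockHat hφ 1 j.1 j.2 u hU, hr⟩
    rw [Set.indicator_of_mem this, Pi.one_apply, one_mul]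
  · rw [Set.indicator_of_notMem hr]; simp

theorem twoNorm_weight_mul_restrictedConv_le {ε : ℝ} (hε : ε = 1 ∨ ε = -1)
    {m n a n₁ b n₂ : ℕ} {V U : ℝ × ℝ → ℝ≥0∞} (hVm : Measurable V) (hUm : Measurable U)
    (hV : Function.support V ⊆ blockSet ε a n₁) (hU : Function.support U ⊆ blockSet 1 b n₂)
    (hV2 : ∫⁻ r, V r ^ 2 ≠ ∞) (hU2 : ∫⁻ r, U r ^ 2 ≠ ∞)
    (hne : (triSet ε m n a n₁ b n₂).Nonempty) :
    twoNorm (fun q => ENNReal.ofReal q.2 * restrictedConv (triSet ε m n a n₁ b n₂) V U q) ≤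
      ENNReal.ofReal (2 ^ ((31 + m + n - a + n₁ + n₂ : ℝ) / 2) * blockGain a n₁ n₂ m n) *
        (twoNorm V * twoNorm U) := by
  refine ennreal_le_of_sq_le_sq ?_
  have hg : 0 ≤ blockGain a n₁ n₂ m n :=
    (mul_pos (dyadicDecay_pos _) (dyadicDecay_pos _)).le.trans (le_blockGain a n₁ n₂ m n).1
  have e : (2 : ℝ) ^ ((m : ℝ) + 1) * (2 ^ (30 + n - a + n₁ + n₂ : ℝ) * blockGain a n₁ n₂ m n ^ 2) =
      (2 ^ ((31 + m + n - a + n₁ + n₂ : ℝ) / 2) * blockGain a n₁ n₂ m n) ^ 2 := by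
    rw [mul_pow, ← mul_assoc, ← Real.rpow_add two_pos, ← Real.rpow_natCast (2 ^ _) 2,
      ← Real.rpow_mul two_pos.le]
    congr 2; push_cast; ring
  rw [mul_pow, mul_pow, twoNorm_sq, twoNorm_sq, twoNorm_sq, ← ENNReal.ofReal_pow (by positivity),
    ← e, ENNReal.ofReal_mul (by positivity), mul_assoc]
  refine le_trans ?_ (mul_le_mul_right
    (weighted_restrictedConv_le hε hVm hUm hV hU hV2 hU2 hne) _)
  rw [← lintegral_const_mul' _ _ ENNReal.ofReal_ne_top]
  refine lintegral_mono fun q => ?_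
  by_cases hq : ∃ r, (q, r) ∈ triSet ε m n a n₁ b n₂
  · obtain ⟨r, hr⟩ := hq
    rw [mul_pow, sq (ENNReal.ofReal q.2), mul_assoc]
    gcongr
    exact output_le_two_pow hr
  · have : restrictedConv (triSet ε m n a n₁ b n₂) V U q = 0 := by
      unfold restrictedConv
      simp_rw [Set.indicator_of_notMem (fun h => hq ⟨_, h⟩), zero_mul, lintegral_zero]
    simp [this]

theorem weighted_twoNorm_restrictedConv_le {ε s s' : ℝ} (hε : ε = 1 ∨ ε = -1)
    (hss' : -(1 / 2 : ℝ) ≤ s + s') {m n a n₁ b n₂ : ℕ} {V U : ℝ × ℝ → ℝ≥0∞}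
    (hVm : Measurable V) (hUm : Measurable U)
    (hV : Function.support V ⊆ blockSet ε a n₁) (hU : Function.support U ⊆ blockSet 1 b n₂)
    (hV2 : ∫⁻ r, V r ^ 2 ≠ ∞) (hU2 : ∫⁻ r, U r ^ 2 ≠ ∞) :
    ENNReal.ofReal (2 ^ (((m : ℝ) - 1) * (s + s') + ((n : ℝ) - 1) * -(1 / 2))) *
      twoNorm (fun q => ENNReal.ofReal q.2 * restrictedConv (triSet ε m n a n₁ b n₂) V U q) ≤
    ENNReal.ofReal (2 ^ (20 + 6 * (s + s') + 5 * |s|)) *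
      (ENNReal.ofReal (blockGain a n₁ n₂ m n) *
        ((ENNReal.ofReal (2 ^ (((a : ℝ) - 1) * s' + ((n₁ : ℝ) - 1) * (1 / 2))) * twoNorm V) *
        (ENNReal.ofReal (2 ^ (((b : ℝ) - 1) * s + ((n₂ : ℝ) - 1) * (1 / 2))) * twoNorm U))) := by
  by_cases hne : (triSet ε m n a n₁ b n₂).Nonempty
  · refine (mul_le_mul_right (twoNorm_weight_mul_restrictedConv_le hε hVm hUm hV hU hV2 hU2 hne)
      _).trans ?_
    obtain ⟨p, hp⟩ := hne
    have h1 : (m : ℝ) ≤ a + 6 := by exact_mod_cast output_index_le_of_mem_triSet hp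
    have h2 : (a : ℝ) ≤ b + 5 := by exact_mod_cast (lower_index_close_of_mem_triSet hp).1
    have h3 : (b : ℝ) ≤ a + 5 := by exact_mod_cast (lower_index_close_of_mem_triSet hp).2
    have h4 : (m : ℝ) * (s + s' + 1 / 2) ≤ (a + 6) * (s + s' + 1 / 2) := by
      gcongr; linarith
    have h5 : ((a : ℝ) - b) * s ≤ 5 * |s| := by
      refine (le_abs_self _).trans ?_
      rw [abs_mul]
      gcongr
      exact abs_le.2 ⟨by linarith, by linarith⟩
    have key : (2 : ℝ) ^ (((m : ℝ) - 1) * (s + s') + ((n : ℝ) - 1) * -(1 / 2)) *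
        2 ^ ((31 + m + n - a + n₁ + n₂ : ℝ) / 2) ≤ 2 ^ (20 + 6 * (s + s') + 5 * |s|) *
        (2 ^ (((a : ℝ) - 1) * s' + ((n₁ : ℝ) - 1) * (1 / 2)) *
          2 ^ (((b : ℝ) - 1) * s + ((n₂ : ℝ) - 1) * (1 / 2))) := by
      rw [← Real.rpow_add two_pos, ← Real.rpow_add two_pos, ← Real.rpow_add two_pos]
      refine Real.rpow_le_rpow_of_exponent_le one_le_two ?_
      linarith
    have key' := ENNReal.ofReal_le_ofReal key
    rw [ENNReal.ofReal_mul (by positivity), ENNReal.ofReal_mul (by positivity),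
      ENNReal.ofReal_mul (by positivity)] at key'
    rw [ENNReal.ofReal_mul (by positivity)]
    calc _ = (ENNReal.ofReal (2 ^ (((m : ℝ) - 1) * (s + s') + ((n : ℝ) - 1) * -(1 / 2))) *
          ENNReal.ofReal (2 ^ ((31 + m + n - a + n₁ + n₂ : ℝ) / 2))) *
          (ENNReal.ofReal (blockGain a n₁ n₂ m n) * (twoNorm V * twoNorm U)) := by ring
      _ ≤ _ := mul_le_mul_left key' _
      _ = _ := by ring
  · rw [Set.not_nonempty_iff_eq_empty.1 hne]
    simp [restrictedConv, twoNorm]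

/-- The total mass of the dyadic decay factors. -/
def dyadicMass : ℝ≥0∞ := ∑' k : ℤ, ENNReal.ofReal (dyadicDecay k)

theorem dyadicMass_ne_top : dyadicMass ≠ ∞ := by
  have h : Summable fun k : ℕ => dyadicDecay k := by
    have h0 : Summable fun k : ℕ => ((2 : ℝ) ^ (-(1 / 4) : ℝ)) ^ k :=
      summable_geometric_of_lt_one (by positivity)
        (Real.rpow_lt_one_of_one_lt_of_neg one_lt_two (by norm_num))
    refine h0.congr fun k => ?_
    rw [dyadicDecay, ← Real.rpow_natCast, ← Real.rpow_mul two_pos.le, Nat.abs_cast]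
    congr 1; ring
  have h2 : Summable fun k : ℤ => dyadicDecay k := by
    refine Summable.of_nat_of_neg (by simpa using h) ?_
    simpa [dyadicDecay] using h
  rw [dyadicMass, ← ENNReal.ofReal_tsum_of_nonneg (fun k => (dyadicDecay_pos _).le) h2]
  exact ENNReal.ofReal_ne_top

theorem tsum_dyadicDecay_sub_le (z : ℤ) :
    ∑' n : ℕ, ENNReal.ofReal (dyadicDecay ((n : ℝ) - z)) ≤ dyadicMass := by
  refine le_trans (le_of_eq ?_) (ENNReal.tsum_comp_le_tsum_of_injective
    (f := fun n : ℕ => (n : ℤ) - z) (fun x y h => by simpa using h)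
    fun k => ENNReal.ofReal (dyadicDecay k))
  simp

theorem tsum_dyadicDecay_mul_le (z w : ℤ) :
    ∑' p : ℕ × ℕ, ENNReal.ofReal (dyadicDecay ((p.2 : ℝ) - z) * dyadicDecay ((p.1 : ℝ) - w)) ≤
      dyadicMass ^ 2 := by
  simp_rw [ENNReal.ofReal_mul (dyadicDecay_pos _).le]
  rw [ENNReal.tsum_prod' (f := fun p : ℕ × ℕ => ENNReal.ofReal (dyadicDecay ((p.2 : ℝ) - z)) * _)]
  simp_rw [ENNReal.tsum_mul_right, ENNReal.tsum_mul_left]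
  rw [sq]
  exact mul_le_mul' (tsum_dyadicDecay_sub_le z) (tsum_dyadicDecay_sub_le w)

theorem tsum_blockGain_le (a n₁ n₂ : ℕ) :
    ∑' p : ℕ × ℕ, ENNReal.ofReal (blockGain a n₁ n₂ p.1 p.2) ≤ 5 * dyadicMass ^ 2 := by
  have h1 := tsum_dyadicDecay_mul_le a 0
  have h2 := tsum_dyadicDecay_mul_le (2 * a) a
  have h3 := tsum_dyadicDecay_mul_le 0 (n₁ - a)
  have h4 := tsum_dyadicDecay_mul_le 0 (n₂ - a)
  have h5 := tsum_dyadicDecay_mul_le 0 0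
  push_cast at h1 h2 h3 h4 h5
  simp only [sub_zero] at h1 h2 h3 h4 h5
  refine (ENNReal.tsum_le_tsum fun p => ENNReal.ofReal_add_le.trans (add_le_add_left
    (ENNReal.ofReal_add_le.trans (add_le_add_left (ENNReal.ofReal_add_le.trans
      (add_le_add_left ENNReal.ofReal_add_le _)) _)) _)).trans ?_
  rw [ENNReal.tsum_add, ENNReal.tsum_add, ENNReal.tsum_add, ENNReal.tsum_add]
  refine (add_le_add (add_le_add (add_le_add (add_le_add h1 h2) h3) h4) h5).trans (le_of_eq ?_)
  ring

theorem enorm_XblockHat_le {φ : 𝓢(ℝ, ℂ)} {B : ℝ} (hB : ∀ m ξ, ‖psiLP φ m ξ‖ ≤ B) (ε : ℝ)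
    (m n : ℕ) (w : ℝ × ℝ → ℂ) (q : ℝ × ℝ) :
    ‖XblockHat φ ε m n w q‖ₑ ≤ ENNReal.ofReal B ^ 2 * ‖FT2 w q‖ₑ := by
  have h : ∀ k ξ, ‖psiLP φ k ξ‖ₑ ≤ ENNReal.ofReal B := fun k ξ => by
    rw [← ofReal_norm]; exact ENNReal.ofReal_le_ofReal (hB k ξ)
  have h1 : ‖(if 0 ≤ ε * q.2 then (1 : ℂ) else 0)‖ₑ ≤ 1 := by split_ifs <;> simp
  rw [XblockHat, enorm_mul, enorm_mul, enorm_mul, sq (ENNReal.ofReal B)]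
  refine mul_le_mul_left ?_ _
  have := mul_le_mul' (mul_le_mul' h1 (h m q.2)) (h n (q.1 - ε * q.2 ^ 2))
  rwa [one_mul] at this

theorem exists_enorm_XblockHat_remainder_le {φ : 𝓢(ℝ, ℂ)} (hφ : IsLPfilter φ) {ε : ℝ}
    (hε : ε = 1 ∨ ε = -1) :
    ∃ K : ℝ≥0∞, K ≠ ∞ ∧ ∀ (u v : 𝓢(ℝ × ℝ, ℂ)) (m n : ℕ) (q : ℝ × ℝ),
      ‖XblockHat φ 1 m n (dX (Pproj 1 (remR φ (Pproj ε v) (Pproj 1 u)))) q‖ₑ ≤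
        K * ∑' i : ℕ × ℕ, ∑' j : ℕ × ℕ, ENNReal.ofReal q.2 *
          restrictedConv (triSet ε m n i.1 i.2 j.1 j.2) (fun r => ‖XblockHat φ ε i.1 i.2 v r‖ₑ)
            (fun r => ‖XblockHat φ 1 j.1 j.2 u r‖ₑ) q := by
  obtain ⟨B, -, hB⟩ := exists_norm_psiLP_le φ
  obtain ⟨K, -, hK⟩ := exists_enorm_FT2_dX_le hφ hε
  refine ⟨ENNReal.ofReal B ^ 2 * ENNReal.ofReal K,
    ENNReal.mul_ne_top (ENNReal.pow_ne_top ENNReal.ofReal_ne_top) ENNReal.ofReal_ne_top,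
    fun u v m n q => ?_⟩
  by_cases hq : q ∈ blockSet 1 m n
  · refine (enorm_XblockHat_le hB _ _ _ _ _).trans ?_
    simp_rw [ENNReal.tsum_mul_left]
    rw [mul_assoc]
    gcongr
    refine (hK u v q).trans ?_
    rw [mul_assoc]
    gcongr
    exact lintegral_comparableSet_le_tsum hφ ε u v hq
  · rw [show ‖XblockHat φ 1 m n (dX (Pproj 1 (remR φ (Pproj ε v) (Pproj 1 u)))) q‖ₑ = 0 from
      Function.notMem_support.1 fun h => hq (support_XblockHat hφ 1 m n _ h)]
    exact zero_le

theorem lintegral_enorm_XblockHat_sq_ne_top (φ : 𝓢(ℝ, ℂ)) (ε : ℝ) (m n : ℕ)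
    (u : 𝓢(ℝ × ℝ, ℂ)) : ∫⁻ q, ‖XblockHat φ ε m n u q‖ₑ ^ 2 ≠ ∞ := by
  rw [← twoNorm_sq fun q => ‖XblockHat φ ε m n u q‖ₑ, ← eLpNorm_two_eq_twoNorm]
  exact ENNReal.pow_ne_top (memLp_XblockHat φ ε m n u).2.ne

theorem tsum_twoNorm_XblockHat_le_XNorm (φ : 𝓢(ℝ, ℂ)) {ε : ℝ} (hε : ε = 1 ∨ ε = -1) (σ : ℝ)
    (u : 𝓢(ℝ × ℝ, ℂ)) :
    ∑' i : ℕ × ℕ, ENNReal.ofReal (2 ^ (((i.1 : ℝ) - 1) * σ + ((i.2 : ℝ) - 1) * (1 / 2))) *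
      twoNorm (fun r => ‖XblockHat φ ε i.1 i.2 u r‖ₑ) ≤ XNorm φ σ (1 / 2) u := by
  rw [XNorm, ENNReal.tsum_prod' (f := fun i : ℕ × ℕ => ENNReal.ofReal
    (2 ^ (((i.1 : ℝ) - 1) * σ + ((i.2 : ℝ) - 1) * (1 / 2))) * _)]
  refine ENNReal.tsum_le_tsum fun m => ENNReal.tsum_le_tsum fun n => ?_
  rw [← eLpNorm_two_eq_twoNorm]
  exact mul_le_mul_right (eLpNorm_XblockHat_le φ hε m n u) _

theorem tsum_blockGain_mul_le (W Z : ℕ × ℕ → ℝ≥0∞) :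
    ∑' p : ℕ × ℕ, ∑' i : ℕ × ℕ, ∑' j : ℕ × ℕ,
      ENNReal.ofReal (blockGain i.1 i.2 j.2 p.1 p.2) * (W i * Z j) ≤
    5 * dyadicMass ^ 2 * ((∑' i, W i) * ∑' j, Z j) := by
  rw [ENNReal.tsum_comm]
  simp_rw [← ENNReal.tsum_mul_right, ← ENNReal.tsum_mul_left]
  refine ENNReal.tsum_le_tsum fun i => ?_
  rw [ENNReal.tsum_comm]
  refine ENNReal.tsum_le_tsum fun j => ?_
  rw [ENNReal.tsum_mul_right]
  exact mul_le_mul_left (tsum_blockGain_le i.1 i.2 j.2) _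

/-- **Bourgain-space product estimate for the remainder term**: for `s + s' ≥ -1/2`,
`‖∂_x P^+(R(P^± v, P^+ u))‖_{X^{s+s',-1/2,1}} ≤ C ‖u‖_{X^{s,1/2,1}} ‖v‖_{X^{s',1/2,1}}`. -/
theorem bourgain_product_remainder
    (φ : 𝓢(ℝ, ℂ)) (hφ : IsLPfilter φ)
    (s s' : ℝ) (hss' : -(1 / 2 : ℝ) ≤ s + s')
    (ε : ℝ) (hε : ε = 1 ∨ ε = -1) :
    ∃ C : ℝ, 0 < C ∧
      ∀ u v : 𝓢(ℝ × ℝ, ℂ),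
        XNorm φ (s + s') (-(1 / 2)) (dX (Pproj 1 (remR φ (Pproj ε ⇑v) (Pproj 1 ⇑u))))
          ≤ ENNReal.ofReal C * XNorm φ s (1 / 2) ⇑u * XNorm φ s' (1 / 2) ⇑v := by
  obtain ⟨K, hK, hw⟩ := exists_enorm_XblockHat_remainder_le hφ hε
  obtain ⟨K', -, hw'⟩ := exists_enorm_FT2_dX_le hφ hε
  set c : ℝ≥0∞ := ENNReal.ofReal (2 ^ (20 + 6 * (s + s') + 5 * |s|)) with hc
  have hT : K * c * (5 * dyadicMass ^ 2) ≠ ∞ :=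
    ENNReal.mul_ne_top (ENNReal.mul_ne_top hK ENNReal.ofReal_ne_top)
      (ENNReal.mul_ne_top (by norm_num) (ENNReal.pow_ne_top dyadicMass_ne_top))
  refine ⟨(K * c * (5 * dyadicMass ^ 2)).toReal + 1, by positivity, fun u v => ?_⟩
  set w := dX (Pproj 1 (remR φ (Pproj ε v) (Pproj 1 u)))
  have hw0 : ∀ q : ℝ × ℝ, q.2 ≤ 0 → FT2 w q = 0 := fun q hq => by
    have := hw' u v q
    rw [ENNReal.ofReal_of_nonpos hq, mul_zero, zero_mul] at this
    simpa using this
  set V : ℕ × ℕ → ℝ × ℝ → ℝ≥0∞ := fun i r => ‖XblockHat φ ε i.1 i.2 v r‖ₑ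
  set U : ℕ × ℕ → ℝ × ℝ → ℝ≥0∞ := fun j r => ‖XblockHat φ 1 j.1 j.2 u r‖ₑ
  have hVm : ∀ i, Measurable (V i) := fun i => (measurable_XblockHat φ ε i.1 i.2 v).enorm
  have hUm : ∀ j, Measurable (U j) := fun j => (measurable_XblockHat φ 1 j.1 j.2 u).enorm
  set W : ℕ × ℕ → ℝ≥0∞ := fun i =>
    ENNReal.ofReal (2 ^ (((i.1 : ℝ) - 1) * s' + ((i.2 : ℝ) - 1) * (1 / 2))) * twoNorm (V i)
  set Z : ℕ × ℕ → ℝ≥0∞ := fun j =>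
    ENNReal.ofReal (2 ^ (((j.1 : ℝ) - 1) * s + ((j.2 : ℝ) - 1) * (1 / 2))) * twoNorm (U j)
  have hblock : ∀ m n : ℕ,
      ENNReal.ofReal (2 ^ (((m : ℝ) - 1) * (s + s') + ((n : ℝ) - 1) * -(1 / 2))) *
        eLpNorm (fun p => Xblock φ 1 m n w p + Xblock φ (-1) m n w p) 2 volume ≤
      K * c * ∑' i : ℕ × ℕ, ∑' j : ℕ × ℕ,
        ENNReal.ofReal (blockGain i.1 i.2 j.2 m n) * (W i * Z j) := fun m n => by
    have hGm : ∀ i j : ℕ × ℕ, Measurable fun q : ℝ × ℝ => ENNReal.ofReal q.2 *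
        restrictedConv (triSet ε m n i.1 i.2 j.1 j.2) (V i) (U j) q := fun i j =>
      (by fun_prop : Measurable fun q : ℝ × ℝ => ENNReal.ofReal q.2).mul
        (measurable_restrictedConv (measurableSet_triSet ..) (hVm i) (hUm j))
    have h1 : eLpNorm (fun p => Xblock φ 1 m n w p + Xblock φ (-1) m n w p) 2 volume ≤
        K * ∑' i : ℕ × ℕ, ∑' j : ℕ × ℕ, twoNorm fun q => ENNReal.ofReal q.2 *
          restrictedConv (triSet ε m n i.1 i.2 j.1 j.2) (V i) (U j) q := by
      refine (eLpNorm_Xblock_add_le φ m n w hw0).trans ?_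
      rw [eLpNorm_two_eq_twoNorm]
      refine (twoNorm_mono (hw u v m n)).trans ?_
      rw [twoNorm_const_mul _ (Measurable.tsum fun i => Measurable.tsum fun j => hGm i j)]
      gcongr
      refine (twoNorm_tsum_le fun i => Measurable.tsum fun j => hGm i j).trans ?_
      exact ENNReal.tsum_le_tsum fun i => twoNorm_tsum_le (hGm i)
    refine (mul_le_mul_right h1 _).trans ?_
    rw [mul_left_comm, mul_assoc]
    refine mul_le_mul_right ?_ K
    simp_rw [← ENNReal.tsum_mul_left]
    refine ENNReal.tsum_le_tsum fun i => ENNReal.tsum_le_tsum fun j => ?_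
    exact weighted_twoNorm_restrictedConv_le hε hss' (hVm i) (hUm j)
      (support_XblockHat hφ ε i.1 i.2 v) (support_XblockHat hφ 1 j.1 j.2 u)
      (lintegral_enorm_XblockHat_sq_ne_top φ ε i.1 i.2 v)
      (lintegral_enorm_XblockHat_sq_ne_top φ 1 j.1 j.2 u)
  have hsum : XNorm φ (s + s') (-(1 / 2)) w ≤
      K * c * (5 * dyadicMass ^ 2 * ((∑' i, W i) * ∑' j, Z j)) := by
    refine (ENNReal.tsum_le_tsum fun m => ENNReal.tsum_le_tsum (hblock m)).trans ?_
    rw [tsum_congr fun m => ENNReal.tsum_mul_left, ENNReal.tsum_mul_left]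
    gcongr
    rw [← ENNReal.tsum_prod (f := fun m n : ℕ => ∑' i : ℕ × ℕ, ∑' j : ℕ × ℕ,
      ENNReal.ofReal (blockGain i.1 i.2 j.2 m n) * (W i * Z j))]
    exact tsum_blockGain_mul_le W Z
  have hW : ∑' i, W i ≤ XNorm φ s' (1 / 2) v := tsum_twoNorm_XblockHat_le_XNorm φ hε s' v
  have hZ : ∑' j, Z j ≤ XNorm φ s (1 / 2) u := tsum_twoNorm_XblockHat_le_XNorm φ (Or.inl rfl) s u
  have hC : K * c * (5 * dyadicMass ^ 2) ≤
      ENNReal.ofReal ((K * c * (5 * dyadicMass ^ 2)).toReal + 1) := by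
    refine (ENNReal.ofReal_toReal hT).symm.le.trans (ENNReal.ofReal_le_ofReal ?_)
    linarith
  refine hsum.trans ?_
  rw [← mul_assoc, mul_comm (∑' i, W i), ← mul_assoc]
  exact mul_le_mul' (mul_le_mul' hC hZ) hW

end
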